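/- arXiv:1512.07655 — 3 statements merged into one kernel-verified Lean document; each statement's English description precedes it below -/
import Mathlib

section
/- For every ε > 0 there exists n₀ such that for every odd n ≥ n₀, the number of Hamiltonian decompositions of the complete graph K_n satisfies n^{(1-ε)n²/2} ≤ H(K_n) ≤ n^{(1+ε)n²/2}. -/
open SimpleGraph

/-- The degree of a vertex, defined via `Set.ncard` (no decidability assumptions). -/
noncomputable def degN {V : Type*} (G : SimpleGraph V) (v : V) : ℕ :=
  (G.neighborSet v).ncard

/-- `G` is `d`-regular. -/
def IsRegN {V : Type*} (G : SimpleGraph V) (d : ℕ) : Prop :=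
  ∀ v, degN G v = d

/-- `H` (a spanning subgraph, viewed as a graph on the full vertex set) is a
Hamilton cycle: it is connected and 2-regular. -/
def IsHamCycleGraph {V : Type*} (H : SimpleGraph V) : Prop :=
  H.Connected ∧ IsRegN H 2

/-- `D` is a Hamiltonian decomposition of `Γ`: a family of pairwise edge-disjoint
Hamilton cycles whose union is `Γ`. -/
def IsHamDecomp {V : Type*} (Γ : SimpleGraph V) (D : Finset (SimpleGraph V)) : Prop :=
  (∀ H ∈ D, IsHamCycleGraph H) ∧
  (D : Set (SimpleGraph V)).Pairwise Disjoint ∧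
  D.sup id = Γ

/-- The number of Hamiltonian decompositions of `Γ`. -/
noncomputable def numHamDecomp {V : Type*} (Γ : SimpleGraph V) : ℕ :=
  {D : Finset (SimpleGraph V) | IsHamDecomp Γ D}.ncard

section Gurvits
open Polynomial

theorem gl_multiset (R : Multiset ℂ) (hR : ∀ r ∈ R, ∃ τ : ℝ, 0 < τ ∧ r = -(τ : ℂ)) :
    ∃ σ : ℝ, 0 ≤ σ ∧ ((R.map (fun r => X - C r)).prod).coeff 1
        = (σ : ℂ) * ((R.map (fun r => X - C r)).prod).coeff 0 ∧
      ∀ t : ℝ, 0 ≤ t → ‖((R.map (fun r => X - C r)).prod).eval (t : ℂ)‖ ≤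
        ‖((R.map (fun r => X - C r)).prod).coeff 0‖ * Real.exp (t * σ) := by
  induction R using Multiset.induction_on with
  | empty => exact ⟨0, le_rfl, by simp [coeff_one], by simp⟩
  | cons a R ih =>
    obtain ⟨σ, hσ, h1, h2⟩ := ih (fun r hr => hR r (Multiset.mem_cons_of_mem hr))
    obtain ⟨τ, hτ, rfl⟩ := hR a (Multiset.mem_cons_self _ _)
    have hτc : (τ : ℂ) ≠ 0 := by exact_mod_cast hτ.ne'
    set Q := (R.map (fun r => X - C r)).prod with hQ
    refine ⟨1 / τ + σ, by positivity, ?_, ?_⟩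
    · simp only [Multiset.map_cons, Multiset.prod_cons, ← hQ]
      rw [sub_mul, coeff_sub, coeff_sub, coeff_C_mul, coeff_C_mul, coeff_X_mul, h1]
      simp only [mul_coeff_zero, coeff_X_zero, zero_mul]
      push_cast
      field_simp
      ring
    · intro t ht
      have h3 := h2 t ht
      simp only [Multiset.map_cons, Multiset.prod_cons, ← hQ, eval_mul, mul_coeff_zero, norm_mul]
      have e1 : ‖eval (t : ℂ) (X - C (-(τ : ℂ)))‖ = t + τ := by
        simp only [eval_sub, eval_X, eval_C, sub_neg_eq_add]
        rw [← Complex.ofReal_add, Complex.norm_real, Real.norm_of_nonneg (by positivity)]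
      have e2 : ‖(X - C (-(τ : ℂ))).coeff 0‖ = τ := by
        simp [abs_of_pos hτ]
      rw [e1, e2]
      have e3 : t + τ ≤ τ * Real.exp (t * (1 / τ)) := by
        have := Real.add_one_le_exp (t * (1 / τ))
        calc t + τ = τ * (t * (1/τ) + 1) := by field_simp
          _ ≤ _ := by gcongr
      calc (t + τ) * ‖eval (t : ℂ) Q‖ ≤ (τ * Real.exp (t * (1 / τ))) * (‖Q.coeff 0‖ * Real.exp (t * σ)) := by
            gcongr
        _ = _ := by rw [mul_add, Real.exp_add]; ring

theorem gl_poly (p : ℂ[X]) (h0 : p.coeff 0 ≠ 0)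
    (hR : ∀ r, p.IsRoot r → ∃ τ : ℝ, 0 < τ ∧ r = -(τ : ℂ)) (t : ℝ) (ht : 0 ≤ t) :
    ‖p.eval (t : ℂ)‖ ≤ ‖p.coeff 0‖ * Real.exp (t * (‖p.coeff 1‖ / ‖p.coeff 0‖)) := by
  have hp : p ≠ 0 := by rintro rfl; simp at h0
  obtain ⟨σ, hσ, h1, h2⟩ := gl_multiset p.roots (fun r hr => hR r (isRoot_of_mem_roots hr))
  have hs := (IsAlgClosed.splits p).eq_prod_roots
  set Q := (p.roots.map (fun r => X - C r)).prod with hQ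
  have h3 := h2 t ht
  have c0 : p.coeff 0 = p.leadingCoeff * Q.coeff 0 := by
    conv_lhs => rw [hs]
    rw [coeff_C_mul]
  have c1 : p.coeff 1 = p.leadingCoeff * Q.coeff 1 := by
    conv_lhs => rw [hs]
    rw [coeff_C_mul]
  have ev : p.eval (t : ℂ) = p.leadingCoeff * Q.eval (t : ℂ) := by
    conv_lhs => rw [hs]
    rw [eval_C_mul]
  have hr : ‖p.coeff 1‖ / ‖p.coeff 0‖ = σ := by
    rw [div_eq_iff (by simpa using h0), c1, c0, h1, norm_mul, norm_mul, norm_mul, Complex.norm_real,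
      Real.norm_of_nonneg hσ]
    ring
  rw [hr, ev, c0, norm_mul, norm_mul, mul_assoc]
  gcongr

theorem gl_deriv (p : ℂ[X]) (hd : 0 < p.natDegree) 
    (hR : ∀ r, p.IsRoot r → r.re < 0) : p.coeff 1 ≠ 0 := by
  intro h
  have hp : p ≠ 0 := by rintro rfl; simp at hd
  have h1 : (0 : ℂ) ∈ (derivative p).rootSet ℂ := by
    rw [mem_rootSet]
    refine ⟨?_, ?_⟩
    · intro h'
      have := derivative_eq_zero.mp h'
      omega
    · simp [← coeff_zero_eq_eval_zero, coeff_derivative, h]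
  have h2 := rootSet_derivative_subset_convexHull_rootSet (P := p)
    (natDegree_pos_iff_degree_pos.mp hd) h1
  have h3 : convexHull ℝ (p.rootSet ℂ) ⊆ {z : ℂ | z.re < 0} := by
    apply convexHull_min
    · intro r hr
      rw [mem_rootSet] at hr
      exact hR r (by simpa using hr.2)
    · exact convex_halfSpace_re_lt 0
  have := h3 h2
  simp at this

end Gurvits

section Gurvits
open Polynomial

noncomputable def gF {R ι V : Type} [CommRing R] [Fintype ι] [Fintype V] [DecidableEq V]
    (w : ι → R) (e : ι → V → ℕ) (D : Finset V) (z : V → R) : R :=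
  ∑ f, w f * ∏ i, (if i ∈ D then (if e f i = 1 then 1 else 0) else z i ^ e f i)

noncomputable def gU {R ι V : Type} [CommRing R] [Fintype ι] [Fintype V] [DecidableEq V]
    (w : ι → R) (e : ι → V → ℕ) (D : Finset V) (j : V) (z : V → R) : R[X] :=
  ∑ f, C (w f * ∏ i ∈ Finset.univ.erase j,
    (if i ∈ D then (if e f i = 1 then 1 else 0) else z i ^ e f i)) * X ^ (e f j)

variable {R ι V : Type} [CommRing R] [Fintype ι] [Fintype V] [DecidableEq V]

theorem gU_eval (w : ι → R) (e : ι → V → ℕ) (D : Finset V) (j : V) (hj : j ∉ D) (z : V → R) (t : R) :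
    (gU w e D j z).eval t = gF w e D (Function.update z j t) := by
  unfold gU gF
  rw [eval_finsetSum]
  refine Finset.sum_congr rfl fun f _ => ?_
  rw [← Finset.mul_prod_erase Finset.univ _ (Finset.mem_univ j)]
  simp only [eval_mul, eval_C, eval_pow, eval_X, hj, if_false, Function.update_self]
  have : ∏ i ∈ Finset.univ.erase j, (if i ∈ D then (if e f i = 1 then 1 else 0)
      else (Function.update z j t) i ^ e f i) = ∏ i ∈ Finset.univ.erase j,
      (if i ∈ D then (if e f i = 1 then 1 else 0) else z i ^ e f i) := by
    refine Finset.prod_congr rfl fun i hi => ?_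
    rw [Function.update_of_ne (Finset.ne_of_mem_erase hi)]
  rw [this]
  ring

theorem gU_coeff_one (w : ι → R) (e : ι → V → ℕ) (D : Finset V) (j : V) (z : V → R) :
    (gU w e D j z).coeff 1 = gF w e (insert j D) z := by
  unfold gU gF
  rw [finsetSum_coeff]
  refine Finset.sum_congr rfl fun f _ => ?_
  rw [← Finset.mul_prod_erase Finset.univ _ (Finset.mem_univ j), coeff_C_mul_X_pow]
  have : ∏ i ∈ Finset.univ.erase j, (if i ∈ insert j D then (if e f i = 1 then 1 else 0)
      else z i ^ e f i) = ∏ i ∈ Finset.univ.erase j,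
      (if i ∈ D then (if e f i = 1 then 1 else 0) else z i ^ e f i) := by
    refine Finset.prod_congr rfl fun i hi => ?_
    simp [Finset.mem_insert, Finset.ne_of_mem_erase hi]
  rw [this]
  by_cases h : e f j = 1
  · simp [h]
  · simp [h, Ne.symm h]

theorem gF_smul (w : ι → R) (e : ι → V → ℕ) (N : ℕ) (hN : ∀ f, ∑ i, e f i = N) (D : Finset V)
    (a : R) (z : V → R) :
    gF w e D (fun i => a * z i) = a ^ (N - D.card) * gF w e D z := by
  unfold gF
  rw [Finset.mul_sum]
  refine Finset.sum_congr rfl fun f _ => ?_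
  by_cases h : ∀ i ∈ D, e f i = 1
  · have h1 : ∑ i ∈ Dᶜ, e f i = N - D.card := by
      have h2 := Finset.sum_add_sum_compl D (e f)
      rw [hN f, Finset.sum_congr rfl h] at h2
      simp at h2
      omega
    have h3 : ∀ z : V → R, ∏ i, (if i ∈ D then (if e f i = 1 then 1 else 0) else z i ^ e f i)
        = ∏ i ∈ Dᶜ, z i ^ e f i := by
      intro z
      rw [← Finset.prod_mul_prod_compl D]
      rw [Finset.prod_congr rfl (g := fun _ => (1 : R)), Finset.prod_const_one, one_mul]
      · refine Finset.prod_congr rfl fun i hi => ?_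
        simp [Finset.mem_compl.mp hi]
      · intro i hi
        simp [hi, h i hi]
    rw [h3, h3, ← h1]
    simp only [mul_pow]
    rw [Finset.prod_mul_distrib, Finset.prod_pow_eq_pow_sum]
    ring
  · push Not at h
    obtain ⟨i, hi, hi'⟩ := h
    have h3 : ∀ z : V → R, ∏ i, (if i ∈ D then (if e f i = 1 then 1 else 0) else z i ^ e f i) = 0 := by
      intro z
      apply Finset.prod_eq_zero (Finset.mem_univ i)
      simp [hi, hi']
    rw [h3, h3]; simp

theorem gU_coeff_top (w : ι → R) (e : ι → V → ℕ) (N : ℕ) (hN : ∀ f, ∑ i, e f i = N) (D : Finset V)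
    (j : V) (hj : j ∉ D) (z : V → R) :
    (gU w e D j z).coeff (N - D.card) = gF w e D (Pi.single j 1) := by
  unfold gU gF
  rw [finsetSum_coeff]
  refine Finset.sum_congr rfl fun f _ => ?_
  rw [← Finset.mul_prod_erase Finset.univ _ (Finset.mem_univ j), coeff_C_mul_X_pow]
  simp only [hj, if_false, Pi.single_eq_same, one_pow, one_mul]
  by_cases h : ∀ i ∈ D, e f i = 1
  · have h1 : ∑ i ∈ Dᶜ, e f i = N - D.card := by
      have h2 := Finset.sum_add_sum_compl D (e f)
      rw [hN f, Finset.sum_congr rfl h] at h2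
      simp at h2
      omega
    rw [← Finset.add_sum_erase Dᶜ (e f) (Finset.mem_compl.mpr hj)] at h1
    by_cases h4 : ∀ i ∈ Dᶜ.erase j, e f i = 0
    · rw [Finset.sum_eq_zero h4] at h1
      rw [if_pos (by omega)]
      congr 1
      refine Finset.prod_congr rfl fun i hi => ?_
      have hij := Finset.ne_of_mem_erase hi
      by_cases hD : i ∈ D
      · simp [hD]
      · simp [hD, h4 i (Finset.mem_erase.mpr ⟨hij, Finset.mem_compl.mpr hD⟩)]
    · push Not at h4
      obtain ⟨i, hi, hi'⟩ := h4
      have : 0 < ∑ i ∈ Dᶜ.erase j, e f i :=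
        Finset.sum_pos' (fun _ _ => Nat.zero_le _) ⟨i, hi, Nat.pos_of_ne_zero hi'⟩
      rw [if_neg (by omega)]
      have hij := Finset.ne_of_mem_erase hi
      have hiD := Finset.mem_compl.mp (Finset.mem_of_mem_erase hi)
      rw [Finset.prod_eq_zero (i := i) (Finset.mem_erase.mpr ⟨hij, Finset.mem_univ _⟩), mul_zero]
      simp [hiD, Pi.single_eq_of_ne hij, hi']
  · push Not at h
    obtain ⟨i, hi, hi'⟩ := h
    have hij : i ≠ j := by rintro rfl; exact hj hi
    have h3 : ∀ z : V → R, ∏ i ∈ Finset.univ.erase j,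
        (if i ∈ D then (if e f i = 1 then 1 else 0) else z i ^ e f i) = 0 := by
      intro z
      apply Finset.prod_eq_zero (Finset.mem_erase.mpr ⟨hij, Finset.mem_univ i⟩)
      simp [hi, hi']
    rw [h3, h3]; simp

theorem gF_ofReal (w : ι → ℝ) (e : ι → V → ℕ) (D : Finset V) (x : V → ℝ) :
    gF (fun f => (w f : ℂ)) e D (fun i => (x i : ℂ)) = ((gF w e D x : ℝ) : ℂ) := by
  unfold gF
  push_cast
  refine Finset.sum_congr rfl fun f _ => ?_
  congr 1
  refine Finset.prod_congr rfl fun i _ => ?_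
  split_ifs <;> simp

theorem gF_nonneg (w : ι → ℝ) (hw : ∀ f, 0 ≤ w f) (e : ι → V → ℕ) (D : Finset V) (x : V → ℝ)
    (hx : ∀ i, 0 ≤ x i) : 0 ≤ gF w e D x := by
  unfold gF
  refine Finset.sum_nonneg fun f _ => mul_nonneg (hw f) (Finset.prod_nonneg fun i _ => ?_)
  have := hx i
  split_ifs <;> positivity

def gStable (w : ι → ℝ) (e : ι → V → ℕ) (D : Finset V) : Prop :=
  ∀ z : V → ℂ, (∀ i ∉ D, z i = 0 ∨ 0 < (z i).re) → (∃ i ∉ D, z i ≠ 0) →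
    gF (fun f => (w f : ℂ)) e D z ≠ 0

theorem gStable.rot {w : ι → ℝ} {e : ι → V → ℕ} {N : ℕ} (hN : ∀ f, ∑ i, e f i = N)
    {D : Finset V} (h : gStable w e D) (a : ℂ) (z : V → ℂ)
    (hz : ∀ i ∉ D, z i = 0 ∨ 0 < (a * z i).re) (hz' : ∃ i ∉ D, z i ≠ 0) :
    gF (fun f => (w f : ℂ)) e D z ≠ 0 := by
  have ha : a ≠ 0 := by
    rintro rfl
    obtain ⟨i, hi, hi'⟩ := hz'
    have := hz i hi
    simp [hi'] at this
  have h1 := h (fun i => a * z i) (fun i hi => (hz i hi).imp (fun h => by simp [h]) id)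
    (by obtain ⟨i, hi, hi'⟩ := hz'; exact ⟨i, hi, mul_ne_zero ha hi'⟩)
  rw [gF_smul _ e N hN] at h1
  exact right_ne_zero_of_mul h1

theorem gStable.step {w : ι → ℝ} {e : ι → V → ℕ} {N : ℕ} (hN : ∀ f, ∑ i, e f i = N)
    {D : Finset V} (hD : D.card < N) (h : gStable w e D) (j : V) (hj : j ∉ D) :
    gStable w e (insert j D) := by
  intro z hz hz'
  rw [← gU_coeff_one]
  apply gl_deriv
  · have h1 : (gU (fun f => (w f : ℂ)) e D j z).coeff (N - D.card) ≠ 0 := by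
      rw [gU_coeff_top _ e N hN D j hj]
      apply h
      · intro i _
        by_cases hi : i = j
        · subst hi; simp
        · simp [Pi.single_eq_of_ne hi]
      · exact ⟨j, hj, by simp⟩
    have := le_natDegree_of_ne_zero h1
    omega
  · intro t ht
    by_contra hre
    push Not at hre
    obtain ⟨i0, hi0, hzi0⟩ := hz'
    have hi0j : i0 ≠ j := by rintro rfl; simp at hi0
    have hi0D : i0 ∉ D := fun h => hi0 (Finset.mem_insert_of_mem h)
    have hroot : gF (fun f => (w f : ℂ)) e D (Function.update z j t) = 0 := by
      rw [← gU_eval _ _ _ _ hj]; exact ht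
    -- choose a rotation
    have hex : ∃ δ : ℝ, 0 < δ ∧ ∀ i ∉ insert j D, z i ≠ 0 → 0 < (z i).re + δ * (t.im * (z i).im) := by
      have : ∀ i, ∀ᶠ δ : ℝ in nhdsWithin 0 (Set.Ioi 0), i ∉ insert j D → z i ≠ 0 →
          0 < (z i).re + δ * (t.im * (z i).im) := by
        intro i
        by_cases hc : i ∉ insert j D ∧ z i ≠ 0
        · have hp : 0 < (z i).re := (hz i hc.1).resolve_left hc.2
          have hcont : Filter.Tendsto (fun δ : ℝ => (z i).re + δ * (t.im * (z i).im)) (nhds 0)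
              (nhds ((z i).re + 0 * (t.im * (z i).im))) := by
            apply Continuous.tendsto; fun_prop
          have := hcont.eventually (lt_mem_nhds (a := 0) (by simpa using hp))
          filter_upwards [this.filter_mono nhdsWithin_le_nhds] with δ hδ _ _ using hδ
        · filter_upwards with δ h1 h2 using absurd ⟨h1, h2⟩ hc
      have h2 := (Filter.eventually_all.mpr this).and (self_mem_nhdsWithin)
      obtain ⟨δ, hδ, hδ'⟩ := h2.exists
      exact ⟨δ, hδ', hδ⟩
    obtain ⟨δ, hδ, hδ'⟩ := hex
    refine gStable.rot hN h (1 - δ * t.im * Complex.I) (Function.update z j t) ?_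
      ⟨i0, hi0D, by rwa [Function.update_of_ne hi0j]⟩ hroot
    intro i hi
    by_cases hij : i = j
    · subst hij
      rw [Function.update_self]
      by_cases ht0 : t = 0
      · exact Or.inl ht0
      · right
        have : ((1 - δ * t.im * Complex.I) * t).re = t.re + δ * (t.im * t.im) := by
          simp [Complex.mul_re]; ring
        rw [this]
        by_cases him : t.im = 0
        · have : t.re ≠ 0 := fun hr => ht0 (Complex.ext hr him)
          rw [him]; simp; exact lt_of_le_of_ne hre this.symm
        · have : 0 < t.im * t.im := mul_self_pos.mpr him
          positivity
    · rw [Function.update_of_ne hij]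
      by_cases hzi : z i = 0
      · exact Or.inl hzi
      · right
        have h1 : ((1 - δ * t.im * Complex.I) * z i).re = (z i).re + δ * (t.im * (z i).im) := by
          simp [Complex.mul_re]; ring
        rw [h1]
        exact hδ' i (by simp [hij, hi]) hzi

theorem gCap_step {w : ι → ℝ} (hw : ∀ f, 0 ≤ w f) {e : ι → V → ℕ} {N : ℕ} (hN : ∀ f, ∑ i, e f i = N)
    {D : Finset V} (hD : D.card < N) (h : gStable w e D) (j : V) (hj : j ∉ D)
    (y : V) (hyj : y ≠ j) (hy : y ∉ D)
    (x : V → ℝ) (hx : ∀ i, 0 < x i) (c : ℝ)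
    (hc : ∀ t : ℝ, 0 < t → c * t ≤ gF w e D (Function.update x j t)) :
    c * Real.exp (-1) ≤ gF w e (insert j D) x := by
  set u := gU (fun f => (w f : ℂ)) e D j (fun i => (x i : ℂ)) with hu
  have hupd : ∀ t : ℝ, Function.update (fun i => (x i : ℂ)) j (t : ℂ) =
      fun i => ((Function.update x j t i : ℝ) : ℂ) := by
    intro t
    ext i
    by_cases hij : i = j
    · subst hij; simp
    · simp [hij]
  have hev : ∀ t : ℝ, u.eval (t : ℂ) = ((gF w e D (Function.update x j t) : ℝ) : ℂ) := by
    intro t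
    rw [hu, gU_eval _ _ _ _ hj, hupd, gF_ofReal]
  have h1 : u.coeff 1 = ((gF w e (insert j D) x : ℝ) : ℂ) := by
    rw [hu, gU_coeff_one, gF_ofReal]
  have hnn : ∀ t : ℝ, 0 ≤ t → 0 ≤ gF w e D (Function.update x j t) := by
    intro t ht
    apply gF_nonneg w hw
    intro i
    by_cases hij : i = j
    · subst hij; simpa using ht
    · simpa [hij] using (hx i).le
  have h0 : u.coeff 0 = ((gF w e D (Function.update x j 0) : ℝ) : ℂ) := by
    rw [coeff_zero_eq_eval_zero, ← hev 0]; simp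
  have h1ne : u.coeff 1 ≠ 0 := by
    rw [hu, gU_coeff_one]
    apply gStable.step hN hD h j hj
    · intro i _; right; simpa using hx i
    · exact ⟨y, by simp [hyj, hy], by simpa using (hx y).ne'⟩
  have h0ne : u.coeff 0 ≠ 0 := by
    have := hev 0
    rw [coeff_zero_eq_eval_zero, hu, gU_eval _ _ _ _ hj]
    apply h
    · intro i _
      by_cases hij : i = j
      · left; subst hij; simp
      · right; simpa [hij] using hx i
    · exact ⟨y, hy, by simpa [hyj] using (hx y).ne'⟩
  have hroots : ∀ r, u.IsRoot r → ∃ τ : ℝ, 0 < τ ∧ r = -(τ : ℂ) := by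
    intro t ht
    by_contra hcon
    have ht0 : t ≠ 0 := by
      rintro rfl
      rw [IsRoot, ← coeff_zero_eq_eval_zero] at ht
      exact h0ne ht
    have hpos : 0 < ‖t‖ + t.re := by
      have h2 : -‖t‖ ≤ t.re := (abs_le.mp (Complex.abs_re_le_norm t)).1
      rcases h2.lt_or_eq with h3 | h3
      · linarith
      · exfalso
        apply hcon
        refine ⟨‖t‖, by positivity, ?_⟩
        have h4 : ‖t‖ ^ 2 = t.re * t.re + t.im * t.im := by
          rw [← Complex.normSq_eq_norm_sq, Complex.normSq_apply]
        have h5 : t.im * t.im = 0 := by rw [← h3] at h4; linarith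
        apply Complex.ext
        · simp [← h3]
        · simpa using h5
    have hroot : gF (fun f => (w f : ℂ)) e D (Function.update (fun i => (x i : ℂ)) j t) = 0 := by
      rw [← gU_eval _ _ _ _ hj]; exact ht
    refine gStable.rot hN h ((‖t‖ : ℂ) + (starRingEnd ℂ) t) _ ?_ ⟨y, hy, by simpa [hyj] using (hx y).ne'⟩ hroot
    intro i _
    right
    by_cases hij : i = j
    · subst hij
      have h4 : ‖t‖ ^ 2 = t.re * t.re + t.im * t.im := by
        rw [← Complex.normSq_eq_norm_sq, Complex.normSq_apply]
      have : (((‖t‖ : ℂ) + (starRingEnd ℂ) t) * t).re = ‖t‖ * (‖t‖ + t.re) := by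
        simp [Complex.mul_re]; linarith
      rw [Function.update_self, this]
      positivity
    · rw [Function.update_of_ne hij]
      have : (((‖t‖ : ℂ) + (starRingEnd ℂ) t) * (x i : ℂ)).re = (‖t‖ + t.re) * x i := by
        simp [Complex.mul_re]
      rw [this]
      exact mul_pos hpos (hx i)
  set a := gF w e D (Function.update x j 0) with ha
  set b := gF w e (insert j D) x with hb
  have ha0 : 0 < a := lt_of_le_of_ne (hnn 0 le_rfl) (by
    intro h; rw [h0, ← h] at h0ne; simp at h0ne)
  have hb0 : 0 < b := lt_of_le_of_ne (gF_nonneg w hw e _ x (fun i => (hx i).le)) (by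
    intro h; rw [h1, ← h] at h1ne; simp at h1ne)
  have key := gl_poly u h0ne hroots (a / b) (by positivity)
  rw [hev, h0, h1, Complex.norm_real, Complex.norm_real, Complex.norm_real,
    Real.norm_of_nonneg (hnn _ (by positivity)), Real.norm_of_nonneg ha0.le,
    Real.norm_of_nonneg hb0.le] at key
  have e1 : a / b * (b / a) = 1 := by field_simp
  rw [e1] at key
  have key2 := (hc (a / b) (by positivity)).trans key
  have : c ≤ b * Real.exp 1 := by
    have h3 : c * (a / b) * (b / a) ≤ a * Real.exp 1 * (b / a) := by gcongr
    have h4 : c * (a / b) * (b / a) = c := by rw [mul_assoc, e1, mul_one]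
    have h5 : a * Real.exp 1 * (b / a) = b * Real.exp 1 := by field_simp
    linarith
  calc c * Real.exp (-1) ≤ b * Real.exp 1 * Real.exp (-1) := by gcongr
    _ = b := by rw [mul_assoc, ← Real.exp_add]; simp

theorem gurvits {w : ι → ℝ} (hw : ∀ f, 0 ≤ w f) {e : ι → V → ℕ} {N : ℕ} (hN : ∀ f, ∑ i, e f i = N)
    (y : V) (hA : Fintype.card V ≤ N + 1) (h : gStable w e ∅) (k : ℕ) (c : ℝ)
    (hc : ∀ x : V → ℝ, (∀ i, 0 < x i) → c * (x y ^ k * ∏ i ∈ Finset.univ.erase y, x i) ≤ gF w e ∅ x) :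
    c * Real.exp (-1) ^ (Fintype.card V - 1) ≤
      ∑ f, w f * ∏ i ∈ Finset.univ.erase y, (if e f i = 1 then 1 else 0) := by
  have main : ∀ D : Finset V, D ⊆ Finset.univ.erase y → gStable w e D ∧
      ∀ x : V → ℝ, (∀ i, 0 < x i) →
        c * Real.exp (-1) ^ D.card * (x y ^ k * ∏ i ∈ Finset.univ.erase y \ D, x i) ≤ gF w e D x := by
    intro D
    induction D using Finset.induction_on with
    | empty => intro _; exact ⟨h, by simpa using hc⟩
    | insert j D hj ih =>
      intro hsub
      obtain ⟨ih1, ih2⟩ := ih ((Finset.subset_insert _ _).trans hsub)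
      have hjy : j ≠ y := Finset.ne_of_mem_erase (hsub (Finset.mem_insert_self _ _))
      have hyD : y ∉ D := fun hh => (Finset.ne_of_mem_erase (hsub (Finset.mem_insert_of_mem hh))) rfl
      have hcard : D.card < N := by
        have := Finset.card_le_card hsub
        rw [Finset.card_insert_of_notMem hj, Finset.card_erase_of_mem (Finset.mem_univ _),
          Finset.card_univ] at this
        omega
      refine ⟨gStable.step hN hcard ih1 j hj, fun x hx => ?_⟩
      have := gCap_step hw hN hcard ih1 j hj y hjy.symm hyD x hx
        (c * Real.exp (-1) ^ D.card * (x y ^ k * ∏ i ∈ Finset.univ.erase y \ insert j D, x i)) ?_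
      · rw [Finset.card_insert_of_notMem hj, pow_succ]
        calc _ = _ := by ring
          _ ≤ _ := this
      · intro t ht
        have h2 := ih2 (Function.update x j t) (by
          intro i
          by_cases hij : i = j
          · subst hij; simpa using ht
          · simpa [hij] using hx i)
        refine le_trans (le_of_eq ?_) h2
        rw [Function.update_of_ne hjy.symm]
        have h3 : Finset.univ.erase y \ D = insert j (Finset.univ.erase y \ insert j D) := by
          ext i
          simp only [Finset.mem_sdiff, Finset.mem_erase, Finset.mem_univ, Finset.mem_insert]
          by_cases hij : i = j
          · subst hij; simp [hjy, hj]
          · simp [hij]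
        rw [h3, Finset.prod_insert (by simp), Function.update_self]
        have h4 : ∏ i ∈ Finset.univ.erase y \ insert j D, Function.update x j t i =
            ∏ i ∈ Finset.univ.erase y \ insert j D, x i := by
          refine Finset.prod_congr rfl fun i hi => ?_
          rw [Function.update_of_ne]
          rintro rfl
          simp at hi
        rw [h4]
        ring
  have := (main (Finset.univ.erase y) le_rfl).2 (fun _ => 1) (by simp)
  rw [Finset.card_erase_of_mem (Finset.mem_univ _), Finset.card_univ] at this
  simp only [one_pow, Finset.prod_const_one, mul_one] at this
  refine this.trans (le_of_eq ?_)
  unfold gF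
  refine Finset.sum_congr rfl fun f _ => ?_
  rw [← Finset.mul_prod_erase Finset.univ _ (Finset.mem_univ y)]
  simp only [Finset.mem_erase, ne_eq, not_true, false_and, if_false, one_pow, one_mul]
  congr 1
  refine Finset.prod_congr rfl fun i hi => ?_
  simp [Finset.ne_of_mem_erase hi]

end Gurvits

section Quad
set_option linter.unusedSectionVars false

variable {R V : Type} [CommRing R] [Fintype V] [DecidableEq V] {s m : ℕ}

/-- coefficients of the quadratic form attached to one colour -/
def gW (A : Fin s → V → R) (p : V × V) : R :=
  ∑ o, ∑ o' ∈ Finset.univ.erase o, A o p.1 * A o' p.2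

/-- exponent vector of a selection -/
def gE (f : Fin m → V × V) (i : V) : ℕ :=
  ∑ c, ((if (f c).1 = i then 1 else 0) + (if (f c).2 = i then 1 else 0))

theorem gE_sum (f : Fin m → V × V) : ∑ i, gE f i = 2 * m := by
  unfold gE
  rw [Finset.sum_comm]
  simp [Finset.sum_add_distrib, mul_comm]

theorem gF_quad (W : Fin m → V × V → R) (z : V → R) :
    gF (fun f : Fin m → V × V => ∏ c, W c (f c)) gE ∅ z = ∏ c, ∑ p, W c p * (z p.1 * z p.2) := by
  unfold gF
  rw [Finset.prod_univ_sum, Fintype.piFinset_univ]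
  refine Finset.sum_congr rfl fun f _ => ?_
  rw [Finset.prod_mul_distrib]
  congr 1
  simp only [Finset.notMem_empty, if_false]
  unfold gE
  simp_rw [← Finset.prod_pow_eq_pow_sum]
  rw [Finset.prod_comm]
  refine Finset.prod_congr rfl fun c _ => ?_
  simp only [pow_add, Finset.prod_mul_distrib, pow_ite, pow_one, pow_zero]
  simp

theorem gW_quad (A : Fin s → V → R) (z : V → R) :
    ∑ p, gW A p * (z p.1 * z p.2) =
      ∑ o, ∑ o' ∈ Finset.univ.erase o, (∑ a, A o a * z a) * (∑ b, A o' b * z b) := by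
  unfold gW
  simp_rw [Finset.sum_mul]
  rw [Finset.sum_comm]
  refine Finset.sum_congr rfl fun o _ => ?_
  rw [Finset.sum_comm]
  refine Finset.sum_congr rfl fun o' _ => ?_
  simp_rw [Finset.mul_sum]
  rw [Fintype.sum_prod_type]
  refine Finset.sum_congr rfl fun a _ => Finset.sum_congr rfl fun b _ => ?_
  ring

theorem gW_ofReal (A : Fin s → V → ℝ) (p : V × V) :
    gW (fun o a => (A o a : ℂ)) p = ((gW A p : ℝ) : ℂ) := by
  unfold gW
  push_cast
  rfl

theorem e2_sq {S : Type} [CommRing S] (Z : Fin s → S) :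
    ∑ o, ∑ o' ∈ Finset.univ.erase o, Z o * Z o' = (∑ o, Z o) ^ 2 - ∑ o, Z o ^ 2 := by
  rw [sq, Finset.sum_mul, ← Finset.sum_sub_distrib]
  refine Finset.sum_congr rfl fun o _ => ?_
  rw [← Finset.mul_sum, Finset.sum_erase_eq_sub (Finset.mem_univ o)]
  ring

theorem e2_ne (hs : 2 ≤ s) (Z : Fin s → ℂ) (hZ : ∀ o, 0 < (Z o).re) :
    ∑ o, ∑ o' ∈ Finset.univ.erase o, Z o * Z o' ≠ 0 := by
  intro h
  rw [e2_sq] at h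
  set A := ∑ o, (Z o).re with hA
  set B := ∑ o, (Z o).im with hB
  have hre : A * A - B * B = ∑ o, ((Z o).re * (Z o).re - (Z o).im * (Z o).im) := by
    have := congrArg Complex.re h
    simp only [sq, Complex.sub_re, Complex.mul_re, Complex.re_sum, Complex.im_sum, Complex.zero_re] at this
    linarith
  have him : A * B = ∑ o, (Z o).re * (Z o).im := by
    have := congrArg Complex.im h
    simp only [sq, Complex.sub_im, Complex.mul_im, Complex.re_sum, Complex.im_sum, Complex.zero_im] at this
    have h2 : ∑ o, ((Z o).re * (Z o).im + (Z o).im * (Z o).re) = 2 * ∑ o, (Z o).re * (Z o).im := by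
      rw [Finset.mul_sum]
      exact Finset.sum_congr rfl fun o _ => by ring
    linarith
  have hne : (Finset.univ : Finset (Fin s)).Nonempty := ⟨⟨0, by omega⟩, Finset.mem_univ _⟩
  have hApos : 0 < A := Finset.sum_pos (fun o _ => hZ o) hne
  have hlt : ∑ o, (Z o).re * (Z o).re < A * A := by
    have h1 := e2_sq (fun o => (Z o).re)
    have h2 : 0 < ∑ o, ∑ o' ∈ Finset.univ.erase o, (Z o).re * (Z o').re := by
      apply Finset.sum_pos _ hne
      intro o _
      apply Finset.sum_pos (fun o' _ => mul_pos (hZ o) (hZ o'))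
      rw [← Finset.card_pos, Finset.card_erase_of_mem (Finset.mem_univ _)]
      simp; omega
    rw [h1] at h2
    simp only [sq] at h2
    linarith
  have hsq : 0 ≤ ∑ o, (A * (Z o).im - B * (Z o).re) ^ 2 := Finset.sum_nonneg fun _ _ => sq_nonneg _
  have hexp : ∀ A B : ℝ, ∑ o, (A * (Z o).im - B * (Z o).re) ^ 2 =
      A * A * ∑ o, (Z o).im * (Z o).im - 2 * A * B * (∑ o, (Z o).re * (Z o).im)
        + B * B * ∑ o, (Z o).re * (Z o).re := by
    intro A B
    rw [Finset.mul_sum, Finset.mul_sum, Finset.mul_sum, ← Finset.sum_sub_distrib, ← Finset.sum_add_distrib]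
    refine Finset.sum_congr rfl fun o _ => ?_
    ring
  rw [hexp, ← him] at hsq
  rw [Finset.sum_sub_distrib] at hre
  set P := ∑ o, (Z o).re * (Z o).re
  set Q := ∑ o, (Z o).im * (Z o).im
  have hQ : Q = P - A * A + B * B := by linarith
  rw [hQ] at hsq
  have : (P - A * A) * (A * A + B * B) < 0 :=
    mul_neg_of_neg_of_pos (by linarith)
      (add_pos_of_pos_of_nonneg (mul_pos hApos hApos) (mul_self_nonneg B))
  nlinarith

theorem quad_cap (hs : 2 ≤ s) (A : Fin s → V → ℝ) (hA : ∀ o a, 0 ≤ A o a) (hrow : ∀ o, ∑ a, A o a = 2)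
    (ξ : V → ℝ) :
    (4 * s * (s - 1) : ℝ) * Real.exp ((1 / s : ℝ) * ∑ a, (∑ o, A o a) * ξ a) ≤
      ∑ p, gW A p * (Real.exp (ξ p.1) * Real.exp (ξ p.2)) := by
  have hs' : (2 : ℝ) ≤ s := by exact_mod_cast hs
  set T : ℝ := 4 * s * (s - 1) with hT
  have hTpos : 0 < T := by
    have : (0 : ℝ) < s - 1 := by linarith
    positivity
  have hW : ∀ p, 0 ≤ gW A p := fun p => Finset.sum_nonneg fun o _ => Finset.sum_nonneg fun o' _ =>
    mul_nonneg (hA _ _) (hA _ _)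
  have hcard : ∀ o : Fin s, ((Finset.univ.erase o).card : ℝ) = s - 1 := by
    intro o
    rw [Finset.card_erase_of_mem (Finset.mem_univ _), Finset.card_univ, Fintype.card_fin,
      Nat.cast_sub (by omega)]
    simp
  have hWs : ∑ p, gW A p = T := by
    have := gW_quad A (fun _ => (1 : ℝ))
    simp only [mul_one, hrow] at this
    rw [this]
    simp only [Finset.sum_const, nsmul_eq_mul, hcard]
    simp [hT]; ring
  have hlin : ∑ p, gW A p * (ξ p.1 + ξ p.2) = 4 * (s - 1) * ∑ a, (∑ o, A o a) * ξ a := by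
    have h1 : ∑ p, gW A p * (ξ p.1 + ξ p.2) = ∑ o, ∑ o' ∈ Finset.univ.erase o,
        ((∑ a, A o a * ξ a) * 2 + 2 * (∑ b, A o' b * ξ b)) := by
      unfold gW
      simp_rw [Finset.sum_mul]
      rw [Finset.sum_comm]
      refine Finset.sum_congr rfl fun o _ => ?_
      rw [Finset.sum_comm]
      refine Finset.sum_congr rfl fun o' _ => ?_
      rw [Fintype.sum_prod_type]
      have : ∀ a b, A o a * A o' b * (ξ a + ξ b) = (A o a * ξ a) * A o' b + A o a * (A o' b * ξ b) := by
        intros; ring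
      simp only [this, Finset.sum_add_distrib, ← Finset.mul_sum, hrow, ← Finset.sum_mul]
    rw [h1]
    have h2 : ∑ a, (∑ o, A o a) * ξ a = ∑ o, ∑ a, A o a * ξ a := by
      simp_rw [Finset.sum_mul]; rw [Finset.sum_comm]
    rw [h2]
    set L := fun o => ∑ a, A o a * ξ a with hL
    have h3 : ∀ o, ∑ o' ∈ Finset.univ.erase o, (L o * 2 + 2 * L o') =
        (s - 1) * (L o * 2) + 2 * (∑ o', L o' - L o) := by
      intro o
      rw [Finset.sum_add_distrib, Finset.sum_const, nsmul_eq_mul, hcard, ← Finset.mul_sum,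
        Finset.sum_erase_eq_sub (Finset.mem_univ o)]
    change ∑ o, ∑ o' ∈ Finset.univ.erase o, (L o * 2 + 2 * L o') = 4 * (s - 1) * ∑ o, L o
    simp_rw [h3]
    rw [Finset.sum_add_distrib, ← Finset.mul_sum, ← Finset.mul_sum, Finset.sum_sub_distrib, ← Finset.sum_mul]
    simp
    ring
  have hj := convexOn_exp.map_sum_le (t := Finset.univ) (w := fun p => gW A p / T)
    (p := fun p : V × V => ξ p.1 + ξ p.2) (fun p _ => div_nonneg (hW p) hTpos.le)
    (by rw [← Finset.sum_div, hWs, div_self hTpos.ne']) (fun _ _ => Set.mem_univ _)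
  simp only [smul_eq_mul, div_mul_eq_mul_div] at hj
  rw [← Finset.sum_div, ← Finset.sum_div, hlin, le_div_iff₀ hTpos] at hj
  have he : 4 * (s - 1) * (∑ a, (∑ o, A o a) * ξ a) / T = (1 / s : ℝ) * ∑ a, (∑ o, A o a) * ξ a := by
    rw [hT]
    have : (s : ℝ) - 1 ≠ 0 := by linarith
    field_simp
  rw [he] at hj
  simp_rw [Real.exp_add] at hj
  linarith

theorem gquad_pos (hs : 2 ≤ s) (A : Fin m → Fin s → V → ℝ) (hA : ∀ c o a, 0 ≤ A c o a)
    (hrow : ∀ c o, ∑ a, A c o a = 2) (y : V) (k : ℕ)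
    (hcol : ∀ a, a ≠ y → ∑ c, ∑ o, A c o a = s) (hcoly : ∑ c, ∑ o, A c o y = s * k)
    (hV : Fintype.card V ≤ 2 * m + 1) (η : ℝ) (hη : 0 < η) :
    (4 * s * (s - 1) : ℝ) ^ m * Real.exp (-1) ^ (Fintype.card V - 1) ≤
      ∑ f : Fin m → V × V, (∏ c, gW (fun o a => A c o a + η) (f c)) *
        ∏ i ∈ Finset.univ.erase y, (if gE f i = 1 then 1 else 0) := by
  have hs' : (2 : ℝ) ≤ s := by exact_mod_cast hs
  have hs1 : (0 : ℝ) < s - 1 := by linarith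
  have hWn : ∀ (B : Fin s → V → ℝ), (∀ o a, 0 ≤ B o a) → ∀ p, 0 ≤ gW B p := fun B hB p =>
    Finset.sum_nonneg fun o _ => Finset.sum_nonneg fun o' _ => mul_nonneg (hB _ _) (hB _ _)
  have hBn : ∀ c o a, 0 ≤ A c o a + η := fun c o a => add_nonneg (hA c o a) hη.le
  refine gurvits (fun f => Finset.prod_nonneg fun c _ => hWn _ (hBn c) _) (N := 2 * m) gE_sum y hV ?_ k _ ?_
  · intro z hz hz'
    have : gF (fun f : Fin m → V × V => ((∏ c, gW (fun o a => A c o a + η) (f c) : ℝ) : ℂ)) gE ∅ z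
        = ∏ c, ∑ p, gW (fun o a => ((A c o a + η : ℝ) : ℂ)) p * (z p.1 * z p.2) := by
      rw [← gF_quad]
      congr 1
      ext f
      push_cast
      refine Finset.prod_congr rfl fun c _ => ?_
      rw [← gW_ofReal]
      push_cast
      rfl
    rw [this, Finset.prod_ne_zero_iff]
    intro c _
    rw [gW_quad]
    apply e2_ne hs
    intro o
    rw [Complex.re_sum]
    obtain ⟨i, hi, hi'⟩ := hz'
    have hp : 0 < (z i).re := (hz i hi).resolve_left hi'
    have hzn : ∀ i, 0 ≤ (z i).re := by
      intro i
      rcases hz i (by simp) with h | h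
      · simp [h]
      · exact h.le
    apply Finset.sum_pos'
    · intro a _
      rw [Complex.re_ofReal_mul]
      exact mul_nonneg (hBn _ _ _) (hzn a)
    · refine ⟨i, Finset.mem_univ _, ?_⟩
      rw [Complex.re_ofReal_mul]
      exact mul_pos (by linarith [hA c o i]) hp
  · intro x hx
    rw [gF_quad]
    have h1 : ∀ c, (4 * s * (s - 1) : ℝ) * Real.exp ((1 / s : ℝ) * ∑ a, (∑ o, A c o a) * Real.log (x a)) ≤
        ∑ p, gW (fun o a => A c o a + η) p * (x p.1 * x p.2) := by
      intro c
      refine (quad_cap hs (A c) (hA c) (hrow c) (fun a => Real.log (x a))).trans ?_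
      refine Finset.sum_le_sum fun p _ => ?_
      rw [Real.exp_log (hx _), Real.exp_log (hx _)]
      refine mul_le_mul_of_nonneg_right ?_ (mul_nonneg (hx _).le (hx _).le)
      unfold gW
      refine Finset.sum_le_sum fun o _ => Finset.sum_le_sum fun o' _ => ?_
      have := hA c o p.1
      have := hA c o' p.2
      gcongr <;> linarith
    have h2 := Finset.prod_le_prod (s := Finset.univ) (fun c _ => by positivity) (fun c _ => h1 c)
    refine le_trans (le_of_eq ?_) h2
    rw [Finset.prod_mul_distrib, Finset.prod_const, Finset.card_univ, Fintype.card_fin]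
    congr 1
    rw [← Real.exp_sum, ← Finset.mul_sum, Finset.sum_comm]
    have h3 : ∑ a, ∑ c, (∑ o, A c o a) * Real.log (x a) =
        (s * k) * Real.log (x y) + ∑ a ∈ Finset.univ.erase y, s * Real.log (x a) := by
      rw [← Finset.add_sum_erase Finset.univ _ (Finset.mem_univ y), ← Finset.sum_mul, hcoly]
      congr 1
      refine Finset.sum_congr rfl fun a ha => ?_
      rw [← Finset.sum_mul, hcol a (Finset.ne_of_mem_erase ha)]
    have hs0 : (s : ℝ) ≠ 0 := by linarith
    have h4 : (1 / s : ℝ) * ((s * k) * Real.log (x y) + ∑ a ∈ Finset.univ.erase y, s * Real.log (x a)) =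
        k * Real.log (x y) + ∑ a ∈ Finset.univ.erase y, Real.log (x a) := by
      rw [← Finset.mul_sum]
      field_simp
    rw [h3, h4, Real.exp_add, Real.exp_nat_mul, Real.exp_log (hx y), Real.exp_sum]
    congr 1
    exact Finset.prod_congr rfl fun a _ => (Real.exp_log (hx a)).symm

theorem gquad (hs : 2 ≤ s) (A : Fin m → Fin s → V → ℝ) (hA : ∀ c o a, 0 ≤ A c o a)
    (hrow : ∀ c o, ∑ a, A c o a = 2) (y : V) (k : ℕ)
    (hcol : ∀ a, a ≠ y → ∑ c, ∑ o, A c o a = s) (hcoly : ∑ c, ∑ o, A c o y = s * k)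
    (hV : Fintype.card V ≤ 2 * m + 1) :
    (4 * s * (s - 1) : ℝ) ^ m * Real.exp (-1) ^ (Fintype.card V - 1) ≤
      ∑ f : Fin m → V × V, (∏ c, gW (A c) (f c)) *
        ∏ i ∈ Finset.univ.erase y, (if gE f i = 1 then 1 else 0) := by
  have hcont : Continuous (fun η : ℝ => ∑ f : Fin m → V × V, (∏ c, gW (fun o a => A c o a + η) (f c)) *
        ∏ i ∈ Finset.univ.erase y, (if gE f i = 1 then (1 : ℝ) else 0)) := by
    unfold gW
    fun_prop
  have ht := (hcont.tendsto 0).mono_left (nhdsWithin_le_nhds (s := Set.Ioi 0))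
  simp only [add_zero] at ht
  refine ge_of_tendsto ht ?_
  filter_upwards [self_mem_nhdsWithin] with η hη
  exact gquad_pos hs A hA hrow y k hcol hcoly hV η hη

end Quad

section Comb
open Classical

/-- degree as a sum of indicators -/
noncomputable def hd {r : ℕ} (H : SimpleGraph (Fin r)) (v : Fin r) : ℕ :=
  ∑ u, if H.Adj v u then 1 else 0

/-- add a new last vertex to `H`, joined to the vertices satisfying `N` -/
def extG {r : ℕ} (H : SimpleGraph (Fin r)) (N : Fin r → Prop) : SimpleGraph (Fin (r + 1)) where
  Adj i j := Fin.lastCases (motive := fun _ => Prop)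
    (Fin.lastCases (motive := fun _ => Prop) False (fun v => N v) j)
    (fun u => Fin.lastCases (motive := fun _ => Prop) (N u) (fun v => H.Adj u v) j) i
  symm := ⟨by
    intro i j
    induction i using Fin.lastCases <;> induction j using Fin.lastCases <;> simp [H.adj_comm]⟩
  loopless := ⟨by
    intro i
    induction i using Fin.lastCases <;> simp⟩

section
variable {r : ℕ} (H : SimpleGraph (Fin r)) (N : Fin r → Prop)

@[simp] theorem extG_cc (u v : Fin r) : (extG H N).Adj u.castSucc v.castSucc ↔ H.Adj u v := by
  simp [extG]
@[simp] theorem extG_cl (u : Fin r) : (extG H N).Adj u.castSucc (Fin.last r) ↔ N u := by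
  simp [extG]
@[simp] theorem extG_lc (u : Fin r) : (extG H N).Adj (Fin.last r) u.castSucc ↔ N u := by
  simp [extG]

theorem extG_reach {u v : Fin r} (h : H.Reachable u v) :
    (extG H N).Reachable u.castSucc v.castSucc :=
  h.map (⟨Fin.castSucc, fun {a b} hab => by simpa using hab⟩ : H →g extG H N)

theorem hd_cast (u : Fin r) : hd (extG H N) u.castSucc = hd H u + if N u then 1 else 0 := by
  unfold hd
  rw [Fin.sum_univ_castSucc]
  simp

theorem hd_last : hd (extG H N) (Fin.last r) = ∑ u, if N u then 1 else 0 := by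
  unfold hd
  rw [Fin.sum_univ_castSucc]
  simp
end

/-- labelled path systems -/
structure Lab {r s : ℕ} (H : SimpleGraph (Fin r)) (lam : Fin r → Fin s) (φ : Fin r → ℕ) : Prop where
  deg : ∀ v, hd H v + φ v = 2
  reach : ∀ u v, lam u = lam v → H.Reachable u v
  tot : ∀ v, (∑ u, if lam u = lam v then φ u else 0) = 2

theorem merge_exists {t : ℕ} (o o' : Fin (t + 1)) (h : o ≠ o') :
    ∃ π : Fin (t + 1) → Fin t, ∀ x x', π x = π x' ↔ (x = x' ∨ ((x = o ∨ x = o') ∧ (x' = o ∨ x' = o'))) := by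
  have h1 : ∀ x : Fin (t + 1), ∃ y : Fin t, o'.succAbove y = if x = o' then o else x := by
    intro x
    apply Fin.exists_succAbove_eq
    split_ifs with hx
    · exact h
    · exact hx
  choose π hπ using h1
  refine ⟨π, fun x x' => ?_⟩
  rw [← (Fin.succAbove_right_injective (p := o')).eq_iff, hπ, hπ]
  split_ifs <;> grind

theorem Lab.step {r t : ℕ} {H : SimpleGraph (Fin r)} {lam : Fin r → Fin (t + 1)} {φ : Fin r → ℕ}
    (hL : Lab H lam φ) (o o' : Fin (t + 1)) (hoo : o ≠ o') (a b : Option (Fin r))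
    (ha : ∀ v, a = some v → lam v = o ∧ 0 < φ v) (ha' : a = none → ∀ u, lam u ≠ o)
    (hb : ∀ v, b = some v → lam v = o' ∧ 0 < φ v) (hb' : b = none → ∀ u, lam u ≠ o')
    (N : Fin r → Prop) (hN : ∀ v, N v ↔ (a = some v ∨ b = some v)) :
    ∃ (lam' : Fin (r + 1) → Fin t) (φ' : Fin (r + 1) → ℕ), Lab (extG H N) lam' φ' := by
  obtain ⟨π, hπ⟩ := merge_exists o o' hoo
  have hab : ∀ v, ¬ (a = some v ∧ b = some v) := by
    rintro v ⟨h1, h2⟩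
    exact hoo ((ha v h1).1.symm.trans (hb v h2).1)
  -- indicator bookkeeping
  set α : Fin r → ℕ := fun u => if a = some u then 1 else 0 with hα
  set β : Fin r → ℕ := fun u => if b = some u then 1 else 0 with hβ
  set α0 : ℕ := if a = none then 0 else 1 with hα0
  set β0 : ℕ := if b = none then 0 else 1 with hβ0
  have hNi : ∀ u, (if N u then 1 else 0) = α u + β u := by
    intro u
    have := hab u
    simp only [hα, hβ, hN]
    split_ifs <;> grind
  have hαs : ∑ u, α u = α0 := by
    rcases a with _ | v
    · simp [hα, hα0]
    · simp [hα, hα0]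
  have hβs : ∑ u, β u = β0 := by
    rcases b with _ | v
    · simp [hβ, hβ0]
    · simp [hβ, hβ0]
  have hα01 : α0 ≤ 1 := by simp only [hα0]; split_ifs <;> omega
  have hβ01 : β0 ≤ 1 := by simp only [hβ0]; split_ifs <;> omega
  have hφ : ∀ u, α u + β u ≤ φ u := by
    intro u
    have := hab u
    have h1 := ha u
    have h2 := hb u
    simp only [hα, hβ]
    split_ifs <;> grind
  set φ0 : Fin r → ℕ := fun u => φ u - (α u + β u) with hφ0
  have hφ0' : ∀ u, φ0 u + α u + β u = φ u := fun u => by have := hφ u; simp only [hφ0]; omega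
  -- class sums
  have hαo : ∀ x, (∑ u, if lam u = x then α u else 0) = if x = o then α0 else 0 := by
    intro x
    rcases a with _ | v
    · simp [hα, hα0]
    · have h1 := (ha v rfl).1
      have : ∀ u, (if lam u = x then α u else 0) = if u = v then (if x = o then 1 else 0) else 0 := by
        intro u
        simp only [hα]
        split_ifs <;> grind
      simp [this, hα0]
  have hβo : ∀ x, (∑ u, if lam u = x then β u else 0) = if x = o' then β0 else 0 := by
    intro x
    rcases b with _ | v
    · simp [hβ, hβ0]
    · have h1 := (hb v rfl).1
      have : ∀ u, (if lam u = x then β u else 0) = if u = v then (if x = o' then 1 else 0) else 0 := by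
        intro u
        simp only [hβ]
        split_ifs <;> grind
      simp [this, hβ0]
  have hφ0s : ∀ x, (∑ u, if lam u = x then φ0 u else 0) + (if x = o then α0 else 0)
      + (if x = o' then β0 else 0) = ∑ u, if lam u = x then φ u else 0 := by
    intro x
    rw [← hαo x, ← hβo x, ← Finset.sum_add_distrib, ← Finset.sum_add_distrib]
    refine Finset.sum_congr rfl fun u _ => ?_
    have := hφ0' u
    split_ifs <;> omega
  have hso : (∑ u, if lam u = o then φ u else 0) = 2 * α0 := by
    rcases a with _ | v
    · simp [hα0, ha' rfl]
    · rw [← (ha v rfl).1, hL.tot v]; simp [hα0]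
  have hso' : (∑ u, if lam u = o' then φ u else 0) = 2 * β0 := by
    rcases b with _ | v
    · simp [hβ0, hb' rfl]
    · rw [← (hb v rfl).1, hL.tot v]; simp [hβ0]
  have h0o : (∑ u, if lam u = o then φ0 u else 0) = α0 := by
    have := hφ0s o
    rw [if_pos rfl, if_neg hoo, hso] at this
    omega
  have h0o' : (∑ u, if lam u = o' then φ0 u else 0) = β0 := by
    have := hφ0s o'
    rw [if_pos rfl, if_neg hoo.symm, hso'] at this
    omega
  have hmerged : (∑ u, if (lam u = o ∨ lam u = o') then φ0 u else 0) = α0 + β0 := by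
    rw [← h0o, ← h0o', ← Finset.sum_add_distrib]
    refine Finset.sum_congr rfl fun u _ => ?_
    split_ifs <;> grind
  have hreach : ∀ u, (lam u = o ∨ lam u = o') → (extG H N).Reachable u.castSucc (Fin.last r) := by
    intro u hu
    rcases hu with hu | hu
    · rcases a with _ | v
      · exact absurd hu (ha' rfl u)
      · have h1 := extG_reach H N (hL.reach u v (hu.trans (ha v rfl).1.symm))
        exact h1.trans (SimpleGraph.Adj.reachable (by simp [hN]))
    · rcases b with _ | v
      · exact absurd hu (hb' rfl u)
      · have h1 := extG_reach H N (hL.reach u v (hu.trans (hb v rfl).1.symm))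
        exact h1.trans (SimpleGraph.Adj.reachable (by simp [hN]))
  refine ⟨Fin.lastCases (π o) (fun u => π (lam u)), Fin.lastCases (2 - (α0 + β0)) φ0, ?_, ?_, ?_⟩
  · intro v
    induction v using Fin.lastCases with
    | last =>
      rw [hd_last]
      simp only [hNi, Finset.sum_add_distrib, hαs, hβs, Fin.lastCases_last]
      omega
    | cast v =>
      rw [hd_cast, hNi]
      simp only [Fin.lastCases_castSucc]
      have := hφ0' v
      have := hL.deg v
      omega
  · intro u v
    induction u using Fin.lastCases with
    | last =>
      induction v using Fin.lastCases with
      | last => intro _; rfl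
      | cast v =>
        simp only [Fin.lastCases_last, Fin.lastCases_castSucc, hπ]
        intro h
        exact (hreach v (by grind)).symm
    | cast u =>
      induction v using Fin.lastCases with
      | last =>
        simp only [Fin.lastCases_last, Fin.lastCases_castSucc, hπ]
        intro h
        exact (hreach u (by grind))
      | cast v =>
        simp only [Fin.lastCases_castSucc, hπ]
        rintro (h | ⟨h1, h2⟩)
        · exact extG_reach H N (hL.reach u v h)
        · exact (hreach u h1).trans (hreach v h2).symm
  · have hcase : ∀ x, (x = o ∨ x = o') → (∑ u, if π (lam u) = π x then φ0 u else 0) = α0 + β0 := by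
      intro x hx
      rw [← hmerged]
      refine Finset.sum_congr rfl fun u _ => ?_
      simp only [hπ]
      split_ifs <;> grind
    intro v
    rw [Fin.sum_univ_castSucc]
    induction v using Fin.lastCases with
    | last =>
      simp only [Fin.lastCases_last, Fin.lastCases_castSucc]
      rw [hcase o (Or.inl rfl)]
      simp; omega
    | cast v =>
      simp only [Fin.lastCases_last, Fin.lastCases_castSucc]
      by_cases hv : lam v = o ∨ lam v = o'
      · rw [hcase _ hv, if_pos]
        · omega
        · rw [hπ]; exact Or.inr ⟨Or.inl rfl, hv⟩
      · rw [if_neg (by rw [hπ]; grind)]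
        have h1 := hφ0s (lam v)
        rw [hL.tot v, if_neg (by grind), if_neg (by grind)] at h1
        rw [← h1]
        simp only [add_zero]
        refine Finset.sum_congr rfl fun u _ => ?_
        simp only [hπ]
        split_ifs <;> grind

/-- partial Hamiltonian decompositions -/
structure Good {m r : ℕ} (s : ℕ) (G : Fin m → SimpleGraph (Fin r)) : Prop where
  cover : ∀ u v, u ≠ v → ∃! c, (G c).Adj u v
  lab : ∀ c, ∃ (lam : Fin r → Fin s) (φ : Fin r → ℕ), Lab (G c) lam φ

def extF {m r : ℕ} (G : Fin m → SimpleGraph (Fin r)) (g : Fin r → Fin m) (c : Fin m) :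
    SimpleGraph (Fin (r + 1)) := extG (G c) (fun v => g v = c)

theorem extF_cover {m r : ℕ} {G : Fin m → SimpleGraph (Fin r)}
    (hG : ∀ u v, u ≠ v → ∃! c, (G c).Adj u v) (g : Fin r → Fin m) :
    ∀ u v, u ≠ v → ∃! c, (extF G g c).Adj u v := by
  intro u v
  induction u using Fin.lastCases with
  | last =>
    induction v using Fin.lastCases with
    | last => intro h; exact absurd rfl h
    | cast v => intro _; simp [extF]
  | cast u =>
    induction v using Fin.lastCases with
    | last => intro _; simp [extF]
    | cast v =>
      intro h
      simpa [extF] using hG u v (fun h' => h (by rw [h']))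

theorem sum_hd {m r : ℕ} {G : Fin m → SimpleGraph (Fin r)}
    (hG : ∀ u v, u ≠ v → ∃! c, (G c).Adj u v) (v : Fin r) : ∑ c, hd (G c) v = r - 1 := by
  unfold hd
  rw [Finset.sum_comm]
  have : ∀ u, (∑ c, if (G c).Adj v u then 1 else 0) = if u = v then 0 else 1 := by
    intro u
    split_ifs with h
    · subst h; simp
    · obtain ⟨c, hc, hc'⟩ := hG v u (Ne.symm h)
      rw [Finset.sum_eq_single c]
      · simp [hc]
      · intro c2 _ h2
        rw [if_neg]
        intro h3; exact h2 (hc' _ h3)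
      · simp
  simp_rw [this]
  rw [← Finset.add_sum_erase _ _ (Finset.mem_univ v), Finset.sum_congr rfl (g := fun _ => 1)]
  · simp [Finset.card_erase_of_mem]
  · intro u hu; simp [Finset.ne_of_mem_erase hu]

end Comb

section Step
open Classical

/-- endpoint weights of a labelled path system -/
noncomputable def abA {r s : ℕ} (lam : Fin r → Fin s) (φ : Fin r → ℕ) (o : Fin s) :
    Option (Fin r) → ℝ
  | some v => if lam v = o then (φ v : ℝ) else 0
  | none => if ∃ v, lam v = o then 0 else 2

theorem abA_nonneg {r s : ℕ} (lam : Fin r → Fin s) (φ : Fin r → ℕ) (o : Fin s) (a : Option (Fin r)) :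
    0 ≤ abA lam φ o a := by
  rcases a with _ | v <;> simp only [abA] <;> split_ifs <;> positivity

theorem abA_some {r s : ℕ} (lam : Fin r → Fin s) (φ : Fin r → ℕ) (v : Fin r) :
    ∑ o, abA lam φ o (some v) = φ v := by
  simp [abA]

theorem abA_none {r s : ℕ} (lam : Fin r → Fin s) (φ : Fin r → ℕ) :
    ∑ o, abA lam φ o none ≤ 2 * s := by
  calc ∑ o, abA lam φ o none ≤ ∑ o : Fin s, (2 : ℝ) := by
        apply Finset.sum_le_sum
        intro o _
        simp only [abA]
        split_ifs <;> norm_num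
    _ = 2 * s := by simp [mul_comm]

theorem abA_row {r s : ℕ} {H : SimpleGraph (Fin r)} {lam : Fin r → Fin s} {φ : Fin r → ℕ}
    (hL : Lab H lam φ) (o : Fin s) : ∑ a, abA lam φ o a = 2 := by
  rw [Fintype.sum_option]
  simp only [abA]
  split_ifs with h
  · obtain ⟨v, rfl⟩ := h
    have := hL.tot v
    rw [zero_add]
    exact_mod_cast this
  · push Not at h
    simp [h]

theorem gW_le {r s : ℕ} {H : SimpleGraph (Fin r)} {lam : Fin r → Fin s} {φ : Fin r → ℕ}
    (hL : Lab H lam φ) (p : Option (Fin r) × Option (Fin r)) :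
    gW (abA lam φ) p ≤ 4 * (s : ℝ) ^ ((if p.1 = none then 1 else 0) + (if p.2 = none then 1 else 0)) := by
  have h1 : ∀ a : Option (Fin r), ∑ o, abA lam φ o a ≤ 2 * (s : ℝ) ^ (if a = none then 1 else 0) := by
    intro a
    rcases a with _ | v
    · simpa using abA_none lam φ
    · rw [abA_some]
      have := hL.deg v
      have : φ v ≤ 2 := by omega
      simpa using (by exact_mod_cast this : (φ v : ℝ) ≤ 2)
  calc gW (abA lam φ) p ≤ ∑ o, ∑ o', abA lam φ o p.1 * abA lam φ o' p.2 := by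
        unfold gW
        refine Finset.sum_le_sum fun o _ => ?_
        refine Finset.sum_le_sum_of_subset_of_nonneg (Finset.erase_subset _ _) fun o' _ _ => ?_
        exact mul_nonneg (abA_nonneg _ _ _ _) (abA_nonneg _ _ _ _)
    _ = (∑ o, abA lam φ o p.1) * ∑ o', abA lam φ o' p.2 := by rw [Finset.sum_mul_sum]
    _ ≤ (2 * (s : ℝ) ^ (if p.1 = none then 1 else 0)) * (2 * (s : ℝ) ^ (if p.2 = none then 1 else 0)) := by
        refine mul_le_mul (h1 _) (h1 _) (Finset.sum_nonneg fun o _ => abA_nonneg _ _ _ _) (by positivity)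
    _ = _ := by rw [pow_add]; ring

theorem gW_pos_imp {r t : ℕ} {H : SimpleGraph (Fin r)} {lam : Fin r → Fin (t + 1)} {φ : Fin r → ℕ}
    (hL : Lab H lam φ) (p : Option (Fin r) × Option (Fin r)) (hp : gW (abA lam φ) p ≠ 0)
    (N : Fin r → Prop) (hN : ∀ v, N v ↔ (p.1 = some v ∨ p.2 = some v)) :
    ∃ (lam' : Fin (r + 1) → Fin t) (φ' : Fin (r + 1) → ℕ), Lab (extG H N) lam' φ' := by
  unfold gW at hp
  obtain ⟨o, _, ho⟩ := Finset.exists_ne_zero_of_sum_ne_zero hp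
  obtain ⟨o', ho', h⟩ := Finset.exists_ne_zero_of_sum_ne_zero ho
  have hA := left_ne_zero_of_mul h
  have hB := right_ne_zero_of_mul h
  have key : ∀ (x : Fin (t + 1)) (a : Option (Fin r)), abA lam φ x a ≠ 0 →
      (∀ v, a = some v → lam v = x ∧ 0 < φ v) ∧ (a = none → ∀ u, lam u ≠ x) := by
    intro x a hx
    constructor
    · rintro v rfl
      simp only [abA] at hx
      split_ifs at hx with h1
      · exact ⟨h1, Nat.pos_of_ne_zero (by exact_mod_cast hx)⟩
      · exact absurd rfl hx
    · rintro rfl u hu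
      simp only [abA] at hx
      exact hx (if_pos ⟨u, hu⟩)
  obtain ⟨a1, a2⟩ := key _ _ hA
  obtain ⟨b1, b2⟩ := key _ _ hB
  exact hL.step o o' (Finset.ne_of_mem_erase ho').symm p.1 p.2 a1 a2 b1 b2 N hN

theorem gE_one {r m : ℕ} {f : Fin m → Option (Fin r) × Option (Fin r)} {v : Fin r}
    (h : gE f (some v) = 1) : ∃! c, ((f c).1 = some v ∨ (f c).2 = some v) := by
  unfold gE at h
  obtain ⟨c, hc⟩ : ∃ c, ((f c).1 = some v ∨ (f c).2 = some v) := by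
    by_contra hno
    push Not at hno
    rw [Finset.sum_eq_zero] at h
    · omega
    · intro c _
      simp [hno c]
  refine ⟨c, hc, fun c' hc' => ?_⟩
  by_contra hne
  have := Finset.add_le_sum (f := fun c => (if (f c).1 = some v then 1 else 0) + (if (f c).2 = some v then 1 else 0))
    (s := Finset.univ) (fun _ _ => Nat.zero_le _) (Finset.mem_univ c) (Finset.mem_univ c') (Ne.symm hne)
  rw [h] at this
  have p1 : 1 ≤ (if (f c).1 = some v then 1 else 0) + (if (f c).2 = some v then 1 else 0) := by
    split_ifs <;> grind
  have p2 : 1 ≤ (if (f c').1 = some v then 1 else 0) + (if (f c').2 = some v then 1 else 0) := by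
    split_ifs <;> grind
  omega

theorem good_step {m r t : ℕ} {G : Fin m → SimpleGraph (Fin r)} (hG : Good (t + 1) G) (ht : 1 ≤ t)
    (hrt : r + t = 2 * m) :
    (4 * ((t : ℝ) + 1) * t) ^ m * Real.exp (-1) ^ r ≤
      36 ^ m * ((t : ℝ) + 1) ^ t *
        ((Finset.univ.filter fun g : Fin r → Fin m => Good t (extF G g)).card : ℝ) := by
  choose lam φ hL using hG.lab
  set A : Fin m → Fin (t + 1) → Option (Fin r) → ℝ := fun c => abA (lam c) (φ c) with hAdef
  have hcol : ∀ a : Option (Fin r), a ≠ none → ∑ c, ∑ o, A c o a = ((t + 1 : ℕ) : ℝ) := by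
    intro a ha
    rcases a with _ | v
    · exact absurd rfl ha
    · simp only [hAdef, abA_some]
      have h1 := sum_hd hG.cover v
      have h2 : ∑ c, (hd (G c) v + φ c v) = 2 * m := by
        simp [(hL _).deg v, mul_comm]
      rw [Finset.sum_add_distrib, h1] at h2
      have : 0 < r := v.pos
      have h3 : ∑ c, φ c v = t + 1 := by omega
      exact_mod_cast h3
  have hrow : ∀ c o, ∑ a, A c o a = 2 := fun c o => abA_row (hL c) o
  have hcoly : ∑ c, ∑ o, A c o none = ((t + 1 : ℕ) : ℝ) * (t : ℕ) := by
    have h1 : ∑ a, ∑ c, ∑ o, A c o a = 2 * m * (t + 1) := by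
      rw [Finset.sum_comm]
      have : ∀ c, ∑ a, ∑ o, A c o a = 2 * (t + 1) := by
        intro c
        rw [Finset.sum_comm]
        simp [hrow, mul_comm]
      simp [this]; ring
    rw [Fintype.sum_option] at h1
    simp only [fun v : Fin r => hcol (some v) (by simp)] at h1
    simp at h1
    have h2 : (r : ℝ) + t = 2 * m := by exact_mod_cast hrt
    push_cast
    rw [← h2] at h1
    linarith
  have hq := gquad (m := m) (s := t + 1) (by omega) A (fun c o a => abA_nonneg _ _ _ _) hrow none t hcol hcoly
    (by simp; omega)
  set T := Finset.univ.filter fun f : Fin m → Option (Fin r) × Option (Fin r) =>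
    (∀ v, gE f (some v) = 1) ∧ ∏ c, gW (A c) (f c) ≠ 0 with hT
  have hnone : ∀ f : Fin m → Option (Fin r) × Option (Fin r), (∀ v, gE f (some v) = 1) → gE f none = t := by
    intro f hf
    have := gE_sum f
    rw [Fintype.sum_option] at this
    simp [hf] at this
    omega
  have hb1 : (∑ f : Fin m → Option (Fin r) × Option (Fin r), (∏ c, gW (A c) (f c)) *
      ∏ i ∈ Finset.univ.erase none, (if gE f i = 1 then (1 : ℝ) else 0)) ≤
      T.card * (4 ^ m * ((t : ℝ) + 1) ^ t) := by
    have hz : ∀ f : Fin m → Option (Fin r) × Option (Fin r), f ∉ T → (∏ c, gW (A c) (f c)) *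
      ∏ i ∈ Finset.univ.erase none, (if gE f i = 1 then (1 : ℝ) else 0) = 0 := by
      intro f hf
      simp only [hT, Finset.mem_filter, Finset.mem_univ, true_and, not_and_or, not_not] at hf
      rcases hf with hf | hf
      · push Not at hf
        obtain ⟨v, hv⟩ := hf
        rw [Finset.prod_eq_zero (i := some v), mul_zero]
        · simp
        · simp [hv]
      · rw [hf, zero_mul]
    rw [← Finset.sum_subset (Finset.subset_univ T) (fun f _ hf => hz f hf), ← nsmul_eq_mul]
    refine Finset.sum_le_card_nsmul _ _ _ fun f hf => ?_
    simp only [hT, Finset.mem_filter, Finset.mem_univ, true_and] at hf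
    have hnn : ∀ c, 0 ≤ gW (A c) (f c) := fun c =>
      Finset.sum_nonneg fun o _ => Finset.sum_nonneg fun o' _ =>
        mul_nonneg (abA_nonneg _ _ _ _) (abA_nonneg _ _ _ _)
    calc _ ≤ (∏ c, gW (A c) (f c)) * 1 := by
          refine mul_le_mul_of_nonneg_left ?_ (Finset.prod_nonneg fun c _ => hnn c)
          refine Finset.prod_le_one ?_ ?_ <;> intro i _ <;> split_ifs <;> norm_num
      _ ≤ ∏ c, (4 * (((t + 1 : ℕ) : ℝ)) ^ ((if (f c).1 = none then 1 else 0) + (if (f c).2 = none then 1 else 0))) := by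
          rw [mul_one]
          exact Finset.prod_le_prod (fun c _ => hnn c) fun c _ => gW_le (hL c) _
      _ = 4 ^ m * ((t : ℝ) + 1) ^ gE f none := by
          rw [Finset.prod_mul_distrib, Finset.prod_pow_eq_pow_sum]
          simp [gE]
      _ = _ := by rw [hnone f hf.1]
  have hex : ∀ f : Fin m → Option (Fin r) × Option (Fin r), ∃ g : Fin r → Fin m,
      f ∈ T → ∀ v c, g v = c ↔ ((f c).1 = some v ∨ (f c).2 = some v) := by
    intro f
    by_cases hf : f ∈ T
    · have hf' := hf
      simp only [hT, Finset.mem_filter, Finset.mem_univ, true_and] at hf'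
      choose g hg hg' using fun v => gE_one (hf'.1 v)
      refine ⟨g, fun _ v c => ⟨?_, ?_⟩⟩
      · rintro rfl; exact hg v
      · intro h; exact (hg' v c h).symm
    · rcases Nat.eq_zero_or_pos m with h0 | h0
      · have : r = 0 := by omega
        subst this
        exact ⟨fun v => v.elim0, fun h => absurd h hf⟩
      · exact ⟨fun _ => ⟨0, h0⟩, fun h => absurd h hf⟩
  choose γ hγ using hex
  have hcard : T.card ≤ 9 ^ m * (Finset.univ.filter fun g : Fin r → Fin m => Good t (extF G g)).card := by
    refine Finset.card_le_mul_card_image_of_maps_to (f := γ) ?_ _ ?_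
    · intro f hf
      simp only [Finset.mem_filter, Finset.mem_univ, true_and]
      have hf' := hf
      simp only [hT, Finset.mem_filter, Finset.mem_univ, true_and] at hf'
      refine ⟨extF_cover hG.cover _, fun c => ?_⟩
      exact gW_pos_imp (hL c) (f c) (Finset.prod_ne_zero_iff.1 hf'.2 c (Finset.mem_univ _)) _
        (fun v => hγ f hf v c)
    · intro g _
      rcases (T.filter fun f => γ f = g).eq_empty_or_nonempty with h0 | ⟨f0, hf0⟩
      · rw [h0]; simp
      · rw [Finset.mem_filter] at hf0
        let S : Fin m → Finset (Option (Fin r)) := fun c => {none, (f0 c).1, (f0 c).2}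
        have hS : ∀ c, (S c).card ≤ 3 := fun c => Finset.card_le_three
        calc (T.filter fun f => γ f = g).card ≤ (Fintype.piFinset fun c => S c ×ˢ S c).card := by
              refine Finset.card_le_card fun f hf => ?_
              rw [Finset.mem_filter] at hf
              rw [Fintype.mem_piFinset]
              intro c
              have h1 : ∀ v, ((f c).1 = some v ∨ (f c).2 = some v) → some v ∈ S c := by
                intro v hv
                have := (hγ f hf.1 v c).2 hv
                rw [hf.2, ← hf0.2] at this
                have := (hγ f0 hf0.1 v c).1 this
                simp only [S, Finset.mem_insert, Finset.mem_singleton]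
                grind
              rw [Finset.mem_product]
              constructor
              · rcases h : (f c).1 with _ | v
                · simp [S]
                · exact h1 v (Or.inl h)
              · rcases h : (f c).2 with _ | v
                · simp [S]
                · exact h1 v (Or.inr h)
          _ ≤ 9 ^ m := by
              rw [Fintype.card_piFinset]
              calc _ ≤ ∏ c : Fin m, 9 := by
                    refine Finset.prod_le_prod' fun c _ => ?_
                    rw [Finset.card_product]
                    have := hS c
                    nlinarith
                _ = _ := by simp
  simp only [Fintype.card_option, Fintype.card_fin, Nat.add_sub_cancel] at hq
  have hcard' : (T.card : ℝ) ≤ 9 ^ m * ((Finset.univ.filter fun g : Fin r → Fin m => Good t (extF G g)).card : ℝ) := by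
    exact_mod_cast hcard
  have e36 : (36 : ℝ) ^ m = 9 ^ m * 4 ^ m := by rw [← mul_pow]; norm_num
  calc _ = (4 * ((t + 1 : ℕ) : ℝ) * (((t + 1 : ℕ) : ℝ) - 1)) ^ m * Real.exp (-1) ^ r := by
        push_cast; rw [add_sub_cancel_right]
    _ ≤ _ := hq
    _ ≤ _ := hb1
    _ ≤ _ := by
      rw [e36]
      calc _ ≤ (9 ^ m * ((Finset.univ.filter fun g : Fin r → Fin m => Good t (extF G g)).card : ℝ)) * (4 ^ m * ((t : ℝ) + 1) ^ t) := by gcongr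
        _ = _ := by ring

end Step

section Count
open Classical

/-- the family of partial decompositions -/
noncomputable def PG (m s r : ℕ) : Finset (Fin m → SimpleGraph (Fin r)) :=
  Finset.univ.filter fun G => Good s G

theorem good_count {m r t : ℕ} {G : Fin m → SimpleGraph (Fin r)} (hG : Good (t + 1) G) (ht : 1 ≤ t)
    (hrt : r + t = 2 * m) :
    (t + 1) ^ r ≤ 162 ^ m * (Finset.univ.filter fun g : Fin r → Fin m => Good t (extF G g)).card := by
  have h := good_step hG ht hrt
  set N := (Finset.univ.filter fun g : Fin r → Fin m => Good t (extF G g)).card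
  have ht' : (1 : ℝ) ≤ t := by exact_mod_cast ht
  have h1 : (2 * ((t : ℝ) + 1) ^ 2) ^ m ≤ (4 * ((t : ℝ) + 1) * t) ^ m := by
    apply pow_le_pow_left₀ (by positivity)
    nlinarith
  have h2 : ((1 : ℝ) / 3) ^ r ≤ Real.exp (-1) ^ r := by
    apply pow_le_pow_left₀ (by positivity)
    rw [Real.exp_neg, one_div]
    apply inv_anti₀ (Real.exp_pos _)
    have := Real.exp_one_lt_d9
    linarith
  have h3 : (2 * ((t : ℝ) + 1) ^ 2) ^ m = 2 ^ m * (((t : ℝ) + 1) ^ r * ((t : ℝ) + 1) ^ t) := by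
    rw [mul_pow, ← pow_mul, ← hrt, pow_add]
  have h4 : (2 ^ m * (((t : ℝ) + 1) ^ r * ((t : ℝ) + 1) ^ t)) * ((1 : ℝ) / 3) ^ r ≤
      36 ^ m * ((t : ℝ) + 1) ^ t * N := by
    rw [← h3]
    exact (mul_le_mul h1 h2 (by positivity) (by positivity)).trans h
  have h5 : (3 : ℝ) ^ r ≤ 9 ^ m := by
    calc (3 : ℝ) ^ r ≤ 3 ^ (2 * m) := pow_le_pow_right₀ (by norm_num) (by omega)
      _ = 9 ^ m := by rw [pow_mul]; norm_num
  have h6 : ((t : ℝ) + 1) ^ r ≤ 162 ^ m * N := by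
    have e1 : (36 : ℝ) ^ m = 2 ^ m * 18 ^ m := by rw [← mul_pow]; norm_num
    have e2 : (162 : ℝ) ^ m = 9 ^ m * 18 ^ m := by rw [← mul_pow]; norm_num
    have hp : (0 : ℝ) < 2 ^ m * ((t : ℝ) + 1) ^ t := by positivity
    have h7 : ((t : ℝ) + 1) ^ r * ((1 : ℝ) / 3) ^ r ≤ 18 ^ m * N := by
      rw [e1] at h4
      refine le_of_mul_le_mul_left ?_ hp
      calc _ = (2 ^ m * (((t : ℝ) + 1) ^ r * ((t : ℝ) + 1) ^ t)) * ((1 : ℝ) / 3) ^ r := by ring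
        _ ≤ _ := h4
        _ = _ := by ring
    calc ((t : ℝ) + 1) ^ r = (((t : ℝ) + 1) ^ r * ((1 : ℝ) / 3) ^ r) * 3 ^ r := by
          rw [mul_assoc, ← mul_pow (1 / 3 : ℝ)]; norm_num
      _ ≤ (18 ^ m * N) * 9 ^ m := by gcongr
      _ = _ := by rw [e2]; ring
  exact_mod_cast h6

theorem extF_inj {m r : ℕ} {G G' : Fin m → SimpleGraph (Fin r)} {g g' : Fin r → Fin m}
    (h : extF G g = extF G' g') : G = G' ∧ g = g' := by
  constructor
  · funext c
    ext u v
    have := congrFun h c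
    have h2 : (extF G g c).Adj u.castSucc v.castSucc ↔ (extF G' g' c).Adj u.castSucc v.castSucc := by rw [this]
    simpa [extF] using h2
  · funext v
    have := congrFun h (g v)
    have h2 : (extF G g (g v)).Adj v.castSucc (Fin.last r) ↔ (extF G' g' (g v)).Adj v.castSucc (Fin.last r) := by
      rw [this]
    simp [extF] at h2
    exact h2.symm

theorem PG_sum (m t r : ℕ) : ∑ G ∈ PG m (t + 1) r,
    (Finset.univ.filter fun g : Fin r → Fin m => Good t (extF G g)).card ≤ (PG m t (r + 1)).card := by
  rw [← Finset.card_sigma]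
  refine Finset.card_le_card_of_injOn (fun p => extF p.1 p.2) ?_ ?_
  · rintro ⟨G, g⟩ h
    simp only [Finset.coe_sigma, Set.mem_sigma_iff, Finset.mem_coe, Finset.mem_filter, Finset.mem_univ, true_and] at h
    simp only [PG, Finset.mem_coe, Finset.mem_filter, Finset.mem_univ, true_and]
    exact h.2
  · rintro ⟨G, g⟩ _ ⟨G', g'⟩ _ h
    obtain ⟨h1, h2⟩ := extF_inj h
    subst h1 h2
    rfl

theorem PG_step {m r t : ℕ} (ht : 1 ≤ t) (hrt : r + t = 2 * m) :
    (t + 1) ^ r * (PG m (t + 1) r).card ≤ 162 ^ m * (PG m t (r + 1)).card := by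
  refine le_trans ?_ (Nat.mul_le_mul_left _ (PG_sum m t r))
  rw [Finset.mul_sum, mul_comm, ← smul_eq_mul, ← Finset.sum_const]
  refine Finset.sum_le_sum fun G hG => ?_
  simp only [PG, Finset.mem_filter, Finset.mem_univ, true_and] at hG
  exact good_count hG ht hrt

theorem PG_mono {m r t : ℕ} (ht : 1 ≤ t) (hrt : r + t = 2 * m) :
    (PG m (t + 1) r).card ≤ (PG m t (r + 1)).card := by
  refine le_trans ?_ (PG_sum m t r)
  rw [Finset.card_eq_sum_ones]
  refine Finset.sum_le_sum fun G hG => ?_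
  simp only [PG, Finset.mem_filter, Finset.mem_univ, true_and] at hG
  have := good_count hG ht hrt
  have h2 : 0 < (t + 1) ^ r := by positivity
  exact Nat.pos_of_mul_pos_left (lt_of_lt_of_le h2 this)

theorem PG_zero (m s : ℕ) : 1 ≤ (PG m s 0).card := by
  rw [Nat.succ_le_iff, Finset.card_pos]
  refine ⟨fun _ => ⊥, ?_⟩
  simp only [PG, Finset.mem_filter, Finset.mem_univ, true_and]
  exact ⟨fun u => u.elim0, fun c => ⟨fun v => v.elim0, fun v => v.elim0, fun v => v.elim0, fun v => v.elim0, fun v => v.elim0⟩⟩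

theorem PG_low (m L : ℕ) (hL : 1 ≤ L) (K : ℕ) (hK : K ≤ 2 * m) (h : K + L ≤ 2 * m + 1) :
    L ^ (∑ i ∈ Finset.range K, i) ≤ 162 ^ (m * K) * (PG m (2 * m + 1 - K) K).card := by
  induction K with
  | zero => simpa using PG_zero m (2 * m + 1)
  | succ K ih =>
    have ih := ih (by omega) (by omega)
    have hs := PG_step (m := m) (r := K) (t := 2 * m - K) (by omega) (by omega)
    rw [show 2 * m - K + 1 = 2 * m + 1 - K by omega] at hs
    rw [show 2 * m + 1 - (K + 1) = 2 * m - K by omega]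
    rw [Finset.sum_range_succ, pow_add, mul_add, pow_add, mul_one]
    calc _ ≤ (162 ^ (m * K) * (PG m (2 * m + 1 - K) K).card) * (2 * m + 1 - K) ^ K := by
          refine Nat.mul_le_mul ih (Nat.pow_le_pow_left (by omega) _)
      _ = 162 ^ (m * K) * ((2 * m + 1 - K) ^ K * (PG m (2 * m + 1 - K) K).card) := by ring
      _ ≤ 162 ^ (m * K) * (162 ^ m * (PG m (2 * m - K) (K + 1)).card) := Nat.mul_le_mul_left _ hs
      _ = _ := by ring

theorem PG_up (m K j : ℕ) (h : K + j ≤ 2 * m) :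
    (PG m (2 * m + 1 - K) K).card ≤ (PG m (2 * m + 1 - (K + j)) (K + j)).card := by
  induction j with
  | zero => simp
  | succ j ih =>
    refine (ih (by omega)).trans ?_
    have := PG_mono (m := m) (r := K + j) (t := 2 * m - (K + j)) (by omega) (by omega)
    rw [show 2 * m - (K + j) + 1 = 2 * m + 1 - (K + j) by omega] at this
    rw [show 2 * m + 1 - (K + (j + 1)) = 2 * m - (K + j) by omega]
    exact this

theorem PG_final (m L K : ℕ) (hL : 1 ≤ L) (hK : K ≤ 2 * m) (h : K + L ≤ 2 * m + 1) :
    L ^ (∑ i ∈ Finset.range K, i) ≤ 162 ^ (m * K) * (PG m 1 (2 * m)).card := by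
  refine (PG_low m L hL K hK h).trans (Nat.mul_le_mul_left _ ?_)
  have := PG_up m K (2 * m - K) (by omega)
  rw [show K + (2 * m - K) = 2 * m by omega] at this
  rwa [show 2 * m + 1 - 2 * m = 1 by omega] at this

end Count

section Final
open Classical

theorem degN_eq_hd {r : ℕ} (H : SimpleGraph (Fin r)) (v : Fin r) : degN H v = hd H v := by
  unfold degN hd
  rw [Finset.sum_boole, Set.ncard_eq_toFinset_card']
  simp only [Nat.cast_id]
  congr 1
  ext u
  simp

theorem close_up {m : ℕ} (hm : 1 ≤ m) {G : Fin m → SimpleGraph (Fin (2 * m))} (hG : Good 1 G) :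
    ∃ g : Fin (2 * m) → Fin m, ∀ c, IsHamCycleGraph (extF G g c) := by
  choose lam φ hL using hG.lab
  have h1 : ∀ v, ∑ c, φ c v = 1 := by
    intro v
    have h1 := sum_hd hG.cover v
    have h2 : ∑ c, (hd (G c) v + φ c v) = 2 * m := by
      simp [(hL _).deg v, mul_comm]
    rw [Finset.sum_add_distrib, h1] at h2
    omega
  have h2 : ∀ v, ∃ c, ∀ c', φ c' v = if c = c' then 1 else 0 := by
    intro v
    obtain ⟨c, _, hc⟩ : ∃ c ∈ Finset.univ, φ c v ≠ 0 := by
      apply Finset.exists_ne_zero_of_sum_ne_zero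
      rw [h1 v]; omega
    have h3 := h1 v
    rw [← Finset.add_sum_erase _ _ (Finset.mem_univ c)] at h3
    have h4 : ∑ c' ∈ Finset.univ.erase c, φ c' v = 0 := by omega
    rw [Finset.sum_eq_zero_iff] at h4
    refine ⟨c, fun c' => ?_⟩
    split_ifs with h
    · subst h; omega
    · exact h4 c' (by simp [Ne.symm h])
  choose g hg using h2
  refine ⟨g, fun c => ?_⟩
  have hv0 : Fin (2 * m) := ⟨0, by omega⟩
  have hsum : (∑ u, if g u = c then 1 else 0) = 2 := by
    have := (hL c).tot hv0
    refine Eq.trans ?_ this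
    refine Finset.sum_congr rfl fun u _ => ?_
    rw [if_pos (Subsingleton.elim (lam c u) (lam c hv0)), hg]
  have hreach : ∀ u v, (extF G g c).Reachable (Fin.castSucc u) (Fin.castSucc v) := fun u v =>
    extG_reach _ _ ((hL c).reach u v (Subsingleton.elim _ _))
  have hlast : ∀ u, (extF G g c).Reachable (Fin.castSucc u) (Fin.last _) := by
    intro u
    obtain ⟨w, _, hw⟩ : ∃ w ∈ Finset.univ, (if g w = c then 1 else 0) ≠ 0 := by
      apply Finset.exists_ne_zero_of_sum_ne_zero
      rw [hsum]; omega
    have hw : g w = c := by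
      by_contra h
      simp [h] at hw
    exact (hreach u w).trans (SimpleGraph.Adj.reachable (by simp [extF, hw]))
  refine ⟨⟨?_⟩, ?_⟩
  · intro u v
    induction u using Fin.lastCases with
    | last =>
      induction v using Fin.lastCases with
      | last => rfl
      | cast v => exact (hlast v).symm
    | cast u =>
      induction v using Fin.lastCases with
      | last => exact hlast u
      | cast v => exact hreach u v
  · intro v
    rw [degN_eq_hd]
    unfold extF
    induction v using Fin.lastCases with
    | last => rw [hd_last]; convert hsum
    | cast v =>
      rw [hd_cast]
      have h3 := (hL c).deg v
      rw [hg] at h3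
      convert h3

theorem PG_le_ham {m : ℕ} (hm : 1 ≤ m) :
    (PG m 1 (2 * m)).card ≤ m ^ m * numHamDecomp (completeGraph (Fin (2 * m + 1))) := by
  have hex : ∀ G : Fin m → SimpleGraph (Fin (2 * m)), ∃ g : Fin (2 * m) → Fin m,
      Good 1 G → ∀ c, IsHamCycleGraph (extF G g c) := by
    intro G
    by_cases h : Good 1 G
    · obtain ⟨g, hg⟩ := close_up hm h
      exact ⟨g, fun _ => hg⟩
    · exact ⟨fun _ => ⟨0, hm⟩, fun h' => absurd h' h⟩
  choose γ hγ using hex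
  unfold numHamDecomp
  rw [Set.ncard_eq_toFinset_card _ (Set.toFinite _)]
  refine Finset.card_le_mul_card_image_of_maps_to
    (f := fun G => Finset.univ.image (extF G (γ G))) ?_ _ ?_
  · intro G hG
    simp only [PG, Finset.mem_filter, Finset.mem_univ, true_and] at hG
    have hcov := extF_cover hG.cover (γ G)
    simp only [Set.Finite.mem_toFinset, Set.mem_ofPred_eq]
    refine ⟨?_, ?_, ?_⟩
    · intro H hH
      simp only [Finset.mem_image, Finset.mem_univ, true_and] at hH
      obtain ⟨c, rfl⟩ := hH
      exact hγ G hG c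
    · intro H hH H' hH' hne
      simp only [Finset.coe_image, Finset.coe_univ, Set.image_univ, Set.mem_range] at hH hH'
      obtain ⟨c, rfl⟩ := hH
      obtain ⟨c', rfl⟩ := hH'
      rw [SimpleGraph.disjoint_left]
      intro x y h1 h2
      obtain ⟨c0, _, hc0⟩ := hcov x y h1.ne
      exact hne (by rw [hc0 c h1, hc0 c' h2])
    · apply le_antisymm
      · rw [Finset.sup_le_iff]
        intro H _
        exact le_top
      · intro x y hxy
        obtain ⟨c, hc, _⟩ := hcov x y (SimpleGraph.Adj.ne hxy)
        have : extF G (γ G) c ≤ (Finset.univ.image (extF G (γ G))).sup id :=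
          Finset.le_sup (f := id) (Finset.mem_image_of_mem _ (Finset.mem_univ c))
        exact this hc
  · intro D _
    by_cases hD : ∃ G, Finset.univ.image (extF G (γ G)) = D
    · have hDm : D.card ≤ m := by
        obtain ⟨G, rfl⟩ := hD
        exact Finset.card_image_le.trans (by simp)
      calc _ ≤ (Fintype.piFinset fun _ : Fin m => D).card := by
            refine Finset.card_le_card_of_injOn (fun G => extF G (γ G)) ?_ ?_
            · intro G hG
              have hG2 := (Finset.mem_filter.1 hG).2
              rw [Finset.mem_coe, Fintype.mem_piFinset]
              intro c
              rw [← hG2]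
              exact Finset.mem_image_of_mem _ (Finset.mem_univ c)
            · intro G _ G' _ h
              exact (extF_inj h).1
        _ ≤ m ^ m := by
            rw [Fintype.card_piFinset]
            simp only [Finset.prod_const, Finset.card_univ, Fintype.card_fin]
            exact Nat.pow_le_pow_left hDm m
    · rw [Finset.filter_eq_empty_iff.2]
      · simp
      · intro G _ h
        exact hD ⟨G, h⟩

theorem ham_upper {n : ℕ} (hn : 1 ≤ n) :
    numHamDecomp (completeGraph (Fin n)) ≤ n ^ (n.choose 2) := by
  let z : Fin n := ⟨0, hn⟩
  have hnb : ∀ H : SimpleGraph (Fin n), ∃ w : Fin n, IsHamCycleGraph H → H.Adj z w := by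
    intro H
    by_cases h : IsHamCycleGraph H
    · have h2 := h.2 z
      unfold degN at h2
      obtain ⟨w, hw⟩ := Set.nonempty_of_ncard_ne_zero (s := H.neighborSet z) (by omega)
      exact ⟨w, fun _ => hw⟩
    · exact ⟨z, fun h' => absurd h' h⟩
  choose nb hnb using hnb
  let E := {e : Sym2 (Fin n) // ¬ e.IsDiag}
  have hfe : ∀ D : Finset (SimpleGraph (Fin n)), ∃ f : E → Fin n, IsHamDecomp (completeGraph (Fin n)) D →
      ∀ H ∈ D, ∀ e : E, e.1 ∈ H.edgeSet ↔ f e = nb H := by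
    intro D
    by_cases hD : IsHamDecomp (completeGraph (Fin n)) D
    · have huniq : ∀ H ∈ D, ∀ H' ∈ D, ∀ e, e ∈ H.edgeSet → e ∈ H'.edgeSet → H = H' := by
        intro H hH H' hH' e h1 h2
        by_contra hne
        have := hD.2.1 hH hH' hne
        rw [← SimpleGraph.disjoint_edgeSet] at this
        exact Set.disjoint_left.1 this h1 h2
      have hcov : ∀ e : E, ∃ H ∈ D, e.1 ∈ H.edgeSet := by
        rintro ⟨e, he⟩
        have h1 : e ∈ (completeGraph (Fin n)).edgeSet := by
          induction e using Sym2.ind with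
          | _ x y => simpa using he
        rw [← hD.2.2] at h1
        induction e using Sym2.ind with
        | _ x y =>
          rw [SimpleGraph.mem_edgeSet, Finset.sup_id_eq_sSup, SimpleGraph.sSup_adj] at h1
          exact h1
      choose h hhD hh using hcov
      refine ⟨fun e => nb (h e), fun _ H hH e => ⟨fun he => ?_, fun he => ?_⟩⟩
      · simp only
        rw [huniq H hH (h e) (hhD e) e.1 he (hh e)]
      · simp only at he
        have h1 := hnb H (hD.1 H hH)
        have h2 := hnb (h e) (hD.1 _ (hhD e))
        rw [he] at h2
        rw [huniq H hH (h e) (hhD e) s(z, nb H) h1 h2]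
        exact hh e
    · exact ⟨fun _ => z, fun h => absurd h hD⟩
  choose F hF using hfe
  have hsub : ∀ D D', IsHamDecomp (completeGraph (Fin n)) D → IsHamDecomp (completeGraph (Fin n)) D' →
      F D = F D' → D ⊆ D' := by
    intro D D' hD hD' hFF H hH
    have h1 := hnb H (hD.1 H hH)
    let e : E := ⟨s(z, nb H), by simpa using h1.ne⟩
    have h2 : F D e = nb H := (hF D hD H hH e).1 h1
    have h3 : (completeGraph (Fin n)).Adj z (nb H) := h1.ne
    rw [← hD'.2.2, Finset.sup_id_eq_sSup, SimpleGraph.sSup_adj] at h3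
    obtain ⟨H', hH', h4⟩ := h3
    have h5 : F D' e = nb H' := (hF D' hD' H' hH' e).1 h4
    have h6 : nb H = nb H' := by rw [← h2, ← h5, hFF]
    have h7 : H = H' := by
      ext x y
      by_cases hxy : x = y
      · subst hxy; simp
      · have a1 := hF D hD H hH ⟨s(x, y), by simpa using hxy⟩
        have a2 := hF D' hD' H' hH' ⟨s(x, y), by simpa using hxy⟩
        rw [hFF, h6] at a1
        exact a1.trans a2.symm
    rw [h7]
    exact hH'
  unfold numHamDecomp
  have hcard : (Set.univ : Set (E → Fin n)).ncard = n ^ (n.choose 2) := by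
    rw [Set.ncard_univ, Nat.card_eq_fintype_card, Fintype.card_fun]
    simp only [E, Fintype.card_fin]
    congr 1
    rw [Sym2.card_subtype_not_diag]
    simp
  rw [← hcard]
  refine Set.ncard_le_ncard_of_injOn F (fun _ _ => Set.mem_univ _) ?_ (Set.toFinite _)
  intro D hD D' hD' h
  exact le_antisymm (hsub D D' hD hD' h) (hsub D' D hD' hD h.symm)

end Final

theorem ham_log_lower {m : ℕ} (hm : 1 ≤ m) (L K : ℕ) (hL : 1 ≤ L) (hK : K + L = 2 * m + 1) :
    1 ≤ numHamDecomp (completeGraph (Fin (2 * m + 1))) ∧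
    (K : ℝ) * (K - 1) / 2 * Real.log L ≤ m * K * Real.log 162 + m * Real.log m
      + Real.log (numHamDecomp (completeGraph (Fin (2 * m + 1)))) := by
  set N := numHamDecomp (completeGraph (Fin (2 * m + 1))) with hN
  have h1 : L ^ (∑ i ∈ Finset.range K, i) ≤ 162 ^ (m * K) * (m ^ m * N) :=
    (PG_final m L K hL (by omega) (by omega)).trans (Nat.mul_le_mul_left _ (PG_le_ham hm))
  have hpos : 0 < L ^ (∑ i ∈ Finset.range K, i) := by positivity
  have hNpos : 1 ≤ N := by
    rcases Nat.eq_zero_or_pos N with h | h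
    · rw [h] at h1; simp at h1; omega
    · exact h
  refine ⟨hNpos, ?_⟩
  have hm0 : (0 : ℝ) < m := by exact_mod_cast hm
  have hN0 : (0 : ℝ) < N := by exact_mod_cast hNpos
  have h2 : (L : ℝ) ^ (∑ i ∈ Finset.range K, i) ≤ 162 ^ (m * K) * ((m : ℝ) ^ m * N) := by exact_mod_cast h1
  have h3 := Real.log_le_log (by exact_mod_cast hpos) h2
  rw [Real.log_mul (by positivity) (by positivity), Real.log_mul (by positivity) (by positivity),
    Real.log_pow, Real.log_pow, Real.log_pow] at h3
  have h4 : ((∑ i ∈ Finset.range K, i : ℕ) : ℝ) = (K : ℝ) * (K - 1) / 2 := by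
    clear * -
    induction K with
    | zero => simp
    | succ K ih => rw [Finset.sum_range_succ, Nat.cast_add, ih]; push_cast; ring
  rw [h4] at h3
  push_cast at h3
  linarith

set_option maxHeartbeats 1000000 in
theorem ham_lower_asymp (ε : ℝ) (hε : 0 < ε) : ∃ n₀ : ℕ, ∀ m : ℕ, n₀ ≤ 2 * m + 1 →
    (1 - ε) * ((2 * m + 1 : ℕ) : ℝ) ^ 2 / 2 * Real.log ((2 * m + 1 : ℕ) : ℝ) ≤
      Real.log (numHamDecomp (completeGraph (Fin (2 * m + 1)))) ∧
      1 ≤ numHamDecomp (completeGraph (Fin (2 * m + 1))) := by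
  set δ : ℝ := min ε 1 / 4 with hδ
  have hδ0 : 0 < δ := by rw [hδ]; positivity
  have hδ1 : δ ≤ 1 / 4 := by rw [hδ]; linarith [min_le_right ε 1]
  have hδε : δ ≤ ε / 4 := by rw [hδ]; linarith [min_le_left ε 1]
  set C : ℝ := Real.log 162 - Real.log δ with hC
  obtain ⟨N1, hN1⟩ := exists_nat_ge (20 / ε)
  obtain ⟨N2, hN2⟩ := exists_nat_ge (Real.exp (4 * C / ε))
  refine ⟨max 12 (max N1 N2), fun m hm => ?_⟩
  have hm12 : 12 ≤ 2 * m + 1 := le_trans (le_max_left _ _) hm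
  have hmN1 : N1 ≤ 2 * m + 1 := le_trans (le_trans (le_max_left _ _) (le_max_right _ _)) hm
  have hmN2 : N2 ≤ 2 * m + 1 := le_trans (le_trans (le_max_right _ _) (le_max_right _ _)) hm
  set n : ℕ := 2 * m + 1 with hn
  have hn12 : (12 : ℝ) ≤ n := by exact_mod_cast hm12
  have hn0 : (0 : ℝ) < n := by linarith
  have hlog0 : 0 ≤ Real.log n := Real.log_nonneg (by linarith)
  have hA : 5 ≤ ε / 4 * n := by
    have : 20 / ε ≤ n := hN1.trans (by exact_mod_cast hmN1)
    rw [div_le_iff₀ hε] at this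
    linarith
  have hB : C ≤ ε / 4 * Real.log n := by
    have : Real.exp (4 * C / ε) ≤ n := hN2.trans (by exact_mod_cast hmN2)
    have h2 := (Real.le_log_iff_exp_le hn0).2 this
    rw [div_le_iff₀ hε] at h2
    linarith
  set L : ℕ := ⌈δ * n⌉₊ with hL
  have hLlo : δ * n ≤ L := Nat.le_ceil _
  have hLhi : (L : ℝ) < δ * n + 1 := Nat.ceil_lt_add_one (by positivity)
  have hL1 : 1 ≤ L := Nat.ceil_pos.2 (by positivity)
  have hLn : L ≤ n := by
    have : (L : ℝ) ≤ n := by nlinarith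
    exact_mod_cast this
  obtain ⟨hN1', hmain⟩ := ham_log_lower (m := m) (by omega) L (n - L) hL1 (by omega)
  refine ⟨?_, hN1'⟩
  rw [Nat.cast_sub hLn] at hmain
  set K : ℝ := (n : ℝ) - L with hK
  have hL1' : (1 : ℝ) ≤ L := by exact_mod_cast hL1
  have hKhi : K ≤ n := by linarith
  have hKlo : (1 - δ) * n - 1 ≤ K := by linarith
  have hm2 : (m : ℝ) ≤ n / 2 := by
    have : (n : ℝ) = 2 * m + 1 := by rw [hn]; push_cast; ring
    linarith
  have hm1 : (1 : ℝ) ≤ m := by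
    have : 1 ≤ m := by omega
    exact_mod_cast this
  set Y : ℝ := (1 - 2 * δ) * n ^ 2 - 3 * n with hY
  have hY0 : 0 ≤ Y := by rw [hY]; nlinarith
  have hYhi : Y ≤ n ^ 2 := by
    have : 0 ≤ δ * (n : ℝ) ^ 2 := by positivity
    rw [hY]; linarith
  have h0 : 0 ≤ (1 - δ) * (n : ℝ) - 1 := by
    have : (3 / 4 : ℝ) * n ≤ (1 - δ) * n := mul_le_mul_of_nonneg_right (by linarith) hn0.le
    linarith
  have hK0 : 0 ≤ K := h0.trans hKlo
  have hYK : Y ≤ K * (K - 1) := by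
    have h1 : ((1 - δ) * n - 1) ^ 2 ≤ K ^ 2 := pow_le_pow_left₀ h0 hKlo 2
    have h2 : (1 - 2 * δ) * n ^ 2 - 2 * n ≤ ((1 - δ) * n - 1) ^ 2 := by nlinarith [sq_nonneg (δ * n)]
    have h3 : K * (K - 1) = K ^ 2 - K := by ring
    rw [hY, h3]; linarith
  have hlogL : Real.log n + Real.log δ ≤ Real.log L := by
    rw [add_comm, ← Real.log_mul hδ0.ne' hn0.ne']
    exact Real.log_le_log (by positivity) hLlo
  have hlogL0 : 0 ≤ Real.log L := Real.log_nonneg hL1'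
  have hlogδ : Real.log δ ≤ 0 := Real.log_nonpos hδ0.le (by linarith)
  have e1 : Y * Real.log n + n ^ 2 * Real.log δ ≤ K * (K - 1) * Real.log L := by
    have h0 : n ^ 2 * Real.log δ ≤ Y * Real.log δ := mul_le_mul_of_nonpos_right hYhi hlogδ
    calc Y * Real.log n + n ^ 2 * Real.log δ ≤ Y * Real.log n + Y * Real.log δ := by
          linarith
      _ = Y * (Real.log n + Real.log δ) := by ring
      _ ≤ Y * Real.log L := by gcongr
      _ ≤ _ := by gcongr
  have hl162 : 0 ≤ Real.log 162 := Real.log_nonneg (by norm_num)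
  have e2 : m * K * Real.log 162 ≤ n ^ 2 / 2 * Real.log 162 := by
    refine mul_le_mul_of_nonneg_right ?_ hl162
    calc (m : ℝ) * K ≤ n / 2 * n := mul_le_mul hm2 hKhi hK0 (by positivity)
      _ = _ := by ring
  have e3 : (m : ℝ) * Real.log m ≤ n * Real.log n := by
    refine mul_le_mul (by linarith) (Real.log_le_log (by linarith) (by linarith)) (Real.log_nonneg hm1) hn0.le
  have e4 : 5 * (n * Real.log n) ≤ (ε / 4 * n) * (n * Real.log n) := by gcongr
  have e5 : n ^ 2 * C ≤ n ^ 2 * (ε / 4 * Real.log n) := by gcongr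
  have e6 : (1 - ε / 2) * n ^ 2 * Real.log n - 3 * n * Real.log n ≤ Y * Real.log n := by
    rw [hY, ← sub_mul]
    refine mul_le_mul_of_nonneg_right ?_ hlog0
    have h5 : (1 - ε / 2) * (n : ℝ) ^ 2 ≤ (1 - 2 * δ) * (n : ℝ) ^ 2 :=
      mul_le_mul_of_nonneg_right (by linarith) (sq_nonneg _)
    linarith
  rw [hC] at e5
  linarith

/-- For every `ε > 0` there exists `n₀` such that for every odd
`n ≥ n₀`, the number of Hamiltonian decompositions of the complete graph `K_n`
satisfies `n^((1-ε) n² / 2) ≤ H(K_n) ≤ n^((1+ε) n² / 2)`. -/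
theorem counting_hamiltonian_decompositions_complete_graph (ε : ℝ) (hε : 0 < ε) :
    ∃ n₀ : ℕ, ∀ n : ℕ, n₀ ≤ n → Odd n →
      (n : ℝ) ^ ((1 - ε) * (n : ℝ) ^ 2 / 2) ≤
        (numHamDecomp (completeGraph (Fin n)) : ℝ) ∧
      (numHamDecomp (completeGraph (Fin n)) : ℝ) ≤
        (n : ℝ) ^ ((1 + ε) * (n : ℝ) ^ 2 / 2) := by
  obtain ⟨n₀, h0⟩ := ham_lower_asymp ε hε
  refine ⟨max n₀ 1, fun n hn hodd => ?_⟩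
  have hn1 : 1 ≤ n := le_trans (le_max_right _ _) hn
  have hn0 : (0 : ℝ) < n := by exact_mod_cast hn1
  have hn1' : (1 : ℝ) ≤ n := by exact_mod_cast hn1
  constructor
  · obtain ⟨m, rfl⟩ := hodd
    obtain ⟨h1, h2⟩ := h0 m (le_trans (le_max_left _ _) hn)
    rw [Real.rpow_def_of_pos hn0, ← Real.le_log_iff_exp_le (by exact_mod_cast h2)]
    rw [mul_comm]
    exact h1
  · have h1 : (numHamDecomp (completeGraph (Fin n)) : ℝ) ≤ (n : ℝ) ^ (n.choose 2) := by
      exact_mod_cast ham_upper hn1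
    refine h1.trans ?_
    rw [← Real.rpow_natCast]
    refine Real.rpow_le_rpow_of_exponent_le hn1' ?_
    rw [Nat.cast_choose_two]
    have h3 : 0 ≤ ε * (n : ℝ) ^ 2 := by positivity
    nlinarith
end

section
/- For every ε > 0 there exists r₀ such that for every even r ≥ r₀ and every n, the number of Hamiltonian decompositions of any r-regular graph Γ on n vertices is at most ((1+ε)·r/e²)^{nr/2}. -/
open SimpleGraph

/-- `φ(m) = log(m!)/m`. -/
noncomputable def phiB (m : ℕ) : ℝ := Real.log (m.factorial : ℝ) / m

lemma phiB_mul (m : ℕ) : (m : ℝ) * phiB m = Real.log (m.factorial : ℝ) := by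
  unfold phiB
  rcases Nat.eq_zero_or_pos m with rfl | h
  · simp
  · field_simp

lemma bregman_comb {V : Type*} [DecidableEq V] (A T : Finset V) (hA : A ⊆ T) (a : V)
    (ha : a ∈ A) :
    Real.log (A.card : ℝ) + ∑ k ∈ T.erase a, phiB (A.erase k).card
      = (T.card : ℝ) * phiB A.card := by
  have hsplit : T.erase a = (A.erase a) ∪ (T \ A) := by
    ext x
    simp only [Finset.mem_erase, Finset.mem_union, Finset.mem_sdiff]
    constructor
    · rintro ⟨h1, h2⟩
      by_cases h : x ∈ A
      · exact Or.inl ⟨h1, h⟩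
      · exact Or.inr ⟨h2, h⟩
    · rintro (⟨h1, h2⟩ | ⟨h1, h2⟩)
      · exact ⟨h1, hA h2⟩
      · exact ⟨fun h => h2 (h ▸ ha), h1⟩
  have hdisj : Disjoint (A.erase a) (T \ A) := by
    rw [Finset.disjoint_left]
    intro x hx hx2
    exact (Finset.mem_sdiff.1 hx2).2 (Finset.mem_of_mem_erase hx)
  rw [hsplit, Finset.sum_union hdisj]
  have h1 : ∑ k ∈ A.erase a, phiB (A.erase k).card
      = ((A.card - 1 : ℕ) : ℝ) * phiB (A.card - 1) := by
    rw [Finset.sum_congr rfl (g := fun _ => phiB (A.card - 1))]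
    · rw [Finset.sum_const, Finset.card_erase_of_mem ha, nsmul_eq_mul]
    · intro k hk
      rw [Finset.card_erase_of_mem (Finset.mem_of_mem_erase hk)]
  have h2 : ∑ k ∈ T \ A, phiB (A.erase k).card
      = ((T.card : ℝ) - A.card) * phiB A.card := by
    rw [Finset.sum_congr rfl (g := fun _ => phiB A.card)]
    · rw [Finset.sum_const, nsmul_eq_mul, Finset.card_sdiff_of_subset hA,
        Nat.cast_sub (Finset.card_le_card hA)]
    · intro k hk
      rw [Finset.erase_eq_of_notMem (Finset.mem_sdiff.1 hk).2]
  rw [h1, h2, phiB_mul]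
  have hpos : 0 < A.card := Finset.card_pos.2 ⟨a, ha⟩
  have h3 : Real.log (A.card : ℝ) + Real.log ((A.card - 1).factorial : ℝ)
      = (A.card : ℝ) * phiB A.card := by
    rw [phiB_mul, ← Real.log_mul (by positivity) (by positivity), ← Nat.cast_mul,
      Nat.mul_factorial_pred hpos.ne']
  linarith

lemma log_sum_ineq {V : Type*} (K : Finset V) (t : V → ℝ) (ht : ∀ k ∈ K, 0 ≤ t k)
    (P : ℝ) (hP : ∑ k ∈ K, t k = P) (hpos : 0 < P) :
    P * Real.log P ≤ P * Real.log K.card + ∑ k ∈ K, t k * Real.log (t k) := by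
  have hK : K.Nonempty := by
    by_contra h
    rw [Finset.not_nonempty_iff_eq_empty] at h
    subst h
    simp at hP
    linarith
  have hc : (0 : ℝ) < K.card := by exact_mod_cast Finset.card_pos.2 hK
  have := Real.convexOn_mul_log.map_sum_le (t := K) (w := fun _ => (K.card : ℝ)⁻¹) (p := t)
    (fun _ _ => by positivity) (by simp; field_simp) (fun i hi => ht i hi)
  simp only [smul_eq_mul, ← Finset.mul_sum, hP] at this
  rw [Real.log_mul (by positivity) hpos.ne', Real.log_inv] at this
  rw [mul_assoc] at this
  have := le_of_mul_le_mul_left this (by positivity)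
  linarith

/-- permutations agreeing with `e0` outside `S` and with `e i ∈ N i` on `S`. -/
def matchB {V : Type*} [Fintype V] [DecidableEq V] (N : V → Finset V) (S : Finset V)
    (e0 : Equiv.Perm V) : Finset (Equiv.Perm V) :=
  Finset.univ.filter (fun e => (∀ i ∈ S, e i ∈ N i) ∧ ∀ i, i ∉ S → e i = e0 i)

lemma matchB_image {V : Type*} [Fintype V] [DecidableEq V] {N : V → Finset V} {S : Finset V}
    {e0 e : Equiv.Perm V} (he : e ∈ matchB N S e0) : S.image e = S.image e0 := by
  have h := (Finset.mem_filter.1 he).2.2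
  have : (Sᶜ).image e = (Sᶜ).image e0 :=
    Finset.image_congr (fun i hi => h i (by simpa using hi))
  have h2 : ∀ f : Equiv.Perm V, (Sᶜ).image f = (S.image f)ᶜ := by
    intro f
    ext x
    obtain ⟨y, rfl⟩ := f.surjective x
    simp
  rw [h2, h2] at this
  exact compl_injective this

theorem bregman_aux {V : Type*} [Fintype V] [DecidableEq V] (N : V → Finset V) (s : ℕ) :
    ∀ (S : Finset V), S.card = s → ∀ e0 : Equiv.Perm V, (matchB N S e0).Nonempty →
      Real.log ((matchB N S e0).card : ℝ) ≤ ∑ j ∈ S, phiB (N j ∩ S.image e0).card := by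
  induction s with
  | zero =>
    intro S hS e0 _
    rw [Finset.card_eq_zero] at hS
    subst hS
    have : matchB N ∅ e0 ⊆ {e0} := by
      intro e he
      have := (Finset.mem_filter.1 he).2.2
      simp only [Finset.mem_singleton]
      ext i
      exact this i (by simp)
    have h := Finset.card_le_card this
    simp only [Finset.card_singleton] at h
    simp only [Finset.sum_empty]
    exact Real.log_nonpos (by positivity) (by exact_mod_cast h)
  | succ s ih =>
    intro S hS e0 hne
    set M := matchB N S e0 with hM
    set T := S.image e0 with hT
    set P : ℝ := (M.card : ℝ) with hP
    have hPpos : 0 < P := by rw [hP]; exact_mod_cast Finset.card_pos.2 hne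
    have hTcard : T.card = s + 1 := by
      rw [hT, Finset.card_image_of_injective _ e0.injective, hS]
    have hmem : ∀ e ∈ M, ∀ i ∈ S, e i ∈ N i ∩ T := by
      intro e he i hi
      refine Finset.mem_inter.2 ⟨(Finset.mem_filter.1 he).2.1 i hi, ?_⟩
      rw [hT, ← matchB_image he]
      exact Finset.mem_image_of_mem _ hi
    let t : V → V → ℕ := fun i k => (M.filter (fun e => e i = k)).card
    -- entropy step for each row
    have hrow : ∀ i ∈ S, P * Real.log P ≤ P * Real.log ((N i ∩ T).card : ℝ)
        + ∑ e ∈ M, Real.log (t i (e i)) := by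
      intro i hi
      have hsum : ∑ k ∈ N i ∩ T, (t i k : ℝ) = P := by
        rw [hP, Finset.card_eq_sum_card_fiberwise (f := fun e : Equiv.Perm V => e i)
          (t := N i ∩ T) (fun e he => hmem e he i hi)]
        push_cast
        rfl
      have h1 := log_sum_ineq (N i ∩ T) (fun k => (t i k : ℝ)) (fun _ _ => by positivity) P hsum hPpos
      have h2 : ∑ k ∈ N i ∩ T, (t i k : ℝ) * Real.log (t i k)
          = ∑ e ∈ M, Real.log (t i (e i)) := by
        rw [← Finset.sum_fiberwise_of_maps_to (g := fun e : Equiv.Perm V => e i)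
          (t := N i ∩ T) (fun e he => hmem e he i hi)]
        refine Finset.sum_congr rfl (fun k _ => ?_)
        rw [Finset.sum_congr rfl (g := fun _ => Real.log (t i k))]
        · rw [Finset.sum_const, nsmul_eq_mul]
        · intro e he
          rw [(Finset.mem_filter.1 he).2]
      rw [← h2]
      exact h1
    -- induction step
    have hind : ∀ e ∈ M, ∀ i ∈ S, Real.log (t i (e i))
        ≤ ∑ j ∈ S.erase i, phiB ((N j ∩ T).erase (e i)).card := by
      intro e he i hi
      have hsub : M.filter (fun e' => e' i = e i) ⊆ matchB N (S.erase i) e := by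
        intro e' he'
        obtain ⟨h1, h2⟩ := Finset.mem_filter.1 he'
        have h3 := (Finset.mem_filter.1 h1).2
        have h4 := (Finset.mem_filter.1 he).2
        refine Finset.mem_filter.2 ⟨Finset.mem_univ _, fun j hj => h3.1 j (Finset.mem_of_mem_erase hj), ?_⟩
        intro j hj
        by_cases hji : j = i
        · subst hji; exact h2
        · have : j ∉ S := fun h => hj (Finset.mem_erase.2 ⟨hji, h⟩)
          rw [h3.2 j this, h4.2 j this]
      have hmem' : e ∈ M.filter (fun e' => e' i = e i) := Finset.mem_filter.2 ⟨he, rfl⟩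
      have h5 := ih (S.erase i) (by rw [Finset.card_erase_of_mem hi, hS]; rfl) e ⟨e, hsub hmem'⟩
      have h6 : (S.erase i).image e = T.erase (e i) := by
        rw [Finset.image_erase e.injective, matchB_image he]
      have hpos : 0 < t i (e i) := Finset.card_pos.2 ⟨e, hmem'⟩
      refine le_trans (Real.log_le_log (by exact_mod_cast hpos)
        (by exact_mod_cast Finset.card_le_card hsub)) (h5.trans (le_of_eq ?_))
      rw [h6]
      refine Finset.sum_congr rfl (fun j _ => ?_)
      rw [Finset.inter_erase]
    -- exchange
    have hex : ∀ e ∈ M, ∑ i ∈ S, (Real.log ((N i ∩ T).card : ℝ) + Real.log (t i (e i)))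
        ≤ (s + 1 : ℝ) * ∑ j ∈ S, phiB (N j ∩ T).card := by
      intro e he
      have h1 : ∑ i ∈ S, Real.log (t i (e i)) ≤
          ∑ i ∈ S, ∑ j ∈ S.erase i, phiB ((N j ∩ T).erase (e i)).card :=
        Finset.sum_le_sum (fun i hi => hind e he i hi)
      have h2 : ∑ i ∈ S, ∑ j ∈ S.erase i, phiB ((N j ∩ T).erase (e i)).card
          = ∑ j ∈ S, ∑ i ∈ S.erase j, phiB ((N j ∩ T).erase (e i)).card := by
        apply Finset.sum_comm'
        intro x y
        simp only [Finset.mem_erase]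
        tauto
      have h3 : ∀ j ∈ S, Real.log ((N j ∩ T).card : ℝ)
          + ∑ i ∈ S.erase j, phiB ((N j ∩ T).erase (e i)).card
          = (s + 1 : ℝ) * phiB (N j ∩ T).card := by
        intro j hj
        have := bregman_comb (N j ∩ T) T Finset.inter_subset_right (e j) (hmem e he j hj)
        rw [hTcard] at this
        push_cast at this
        rw [← this, hT, ← matchB_image he, ← Finset.image_erase e.injective,
          Finset.sum_image (fun _ _ _ _ h => e.injective h)]
      rw [Finset.sum_add_distrib, Finset.mul_sum, ← Finset.sum_congr rfl h3,
        Finset.sum_add_distrib]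
      linarith
    have hfin : (s + 1 : ℝ) * (P * Real.log P) ≤ P * ((s + 1 : ℝ) * ∑ j ∈ S, phiB (N j ∩ T).card) := by
      calc (s + 1 : ℝ) * (P * Real.log P) = ∑ i ∈ S, P * Real.log P := by
            rw [Finset.sum_const, hS, nsmul_eq_mul]; push_cast; rfl
        _ ≤ ∑ i ∈ S, (P * Real.log ((N i ∩ T).card : ℝ) + ∑ e ∈ M, Real.log (t i (e i))) :=
            Finset.sum_le_sum hrow
        _ = ∑ i ∈ S, ∑ e ∈ M, (Real.log ((N i ∩ T).card : ℝ) + Real.log (t i (e i))) := by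
            refine Finset.sum_congr rfl (fun i _ => ?_)
            rw [Finset.sum_add_distrib, Finset.sum_const, nsmul_eq_mul]
        _ = ∑ e ∈ M, ∑ i ∈ S, (Real.log ((N i ∩ T).card : ℝ) + Real.log (t i (e i))) :=
            Finset.sum_comm
        _ ≤ ∑ e ∈ M, (s + 1 : ℝ) * ∑ j ∈ S, phiB (N j ∩ T).card := Finset.sum_le_sum hex
        _ = _ := by rw [Finset.sum_const, nsmul_eq_mul]
    have hs : (0 : ℝ) < s + 1 := by positivity
    have h7 : ((s + 1 : ℝ) * P) * Real.log P ≤ ((s + 1 : ℝ) * P) * ∑ j ∈ S, phiB (N j ∩ T).card := by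
      linarith
    exact le_of_mul_le_mul_left h7 (by positivity)

theorem bregman_reg {V : Type*} [Fintype V] [DecidableEq V] (N : V → Finset V) (d : ℕ)
    (hN : ∀ v, (N v).card = d) :
    ((Finset.univ.filter (fun e : Equiv.Perm V => ∀ i, e i ∈ N i)).card : ℝ)
      ≤ Real.exp (Fintype.card V * phiB d) := by
  have hEq : Finset.univ.filter (fun e : Equiv.Perm V => ∀ i, e i ∈ N i)
      = matchB N Finset.univ 1 := by
    ext e; simp [matchB]
  rw [hEq]
  rcases Finset.eq_empty_or_nonempty (matchB N Finset.univ 1) with h | h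
  · rw [h]; simp; positivity
  · have := bregman_aux N _ Finset.univ rfl 1 h
    have hpos : (0 : ℝ) < (matchB N Finset.univ 1).card := by
      exact_mod_cast Finset.card_pos.2 h
    rw [← Real.log_le_iff_le_exp hpos]
    refine this.trans (le_of_eq ?_)
    simp [hN]

lemma phiB_tendsto :
    Filter.Tendsto (fun m : ℕ => phiB m - (Real.log m - 1)) Filter.atTop (nhds 0) := by
  have h1 : Filter.Tendsto (fun m : ℕ => Real.log (Stirling.stirlingSeq m)) Filter.atTop
      (nhds (Real.log (√Real.pi))) :=
    Filter.Tendsto.log Stirling.tendsto_stirlingSeq_sqrt_pi (by positivity)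
  have h2 : Filter.Tendsto (fun m : ℕ => Real.log (Stirling.stirlingSeq m) / (m : ℝ)) Filter.atTop
      (nhds 0) := h1.div_atTop tendsto_natCast_atTop_atTop
  have h3 : Filter.Tendsto (fun m : ℕ => Real.log (2 * (m : ℝ)) / (2 * (m : ℝ))) Filter.atTop
      (nhds 0) := by
    have := Real.isLittleO_log_id_atTop.tendsto_div_nhds_zero
    exact this.comp ((tendsto_natCast_atTop_atTop (R := ℝ)).const_mul_atTop (by norm_num : (0:ℝ) < 2))
  have := h2.add h3
  rw [add_zero] at this
  refine this.congr' ?_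
  filter_upwards [Filter.eventually_gt_atTop 0] with m hm
  have hm' : (0 : ℝ) < m := by exact_mod_cast hm
  rw [Stirling.log_stirlingSeq_formula, Real.log_div hm'.ne' (Real.exp_pos 1).ne', Real.log_exp]
  unfold phiB
  field_simp
  ring

lemma sum_phiB_eq (k : ℕ) (hk : 0 < k) :
    (k : ℝ)⁻¹ * ∑ j ∈ Finset.range k, phiB (2 * (j + 1))
      = Real.log (2 * k) - 2 + ((phiB k - (Real.log k - 1))
        + (k : ℝ)⁻¹ * ∑ j ∈ Finset.range k,
          (phiB (2 * (j + 1)) - (Real.log ((2 * (j + 1) : ℕ) : ℝ) - 1))) := by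
  have hk' : (0 : ℝ) < k := by exact_mod_cast hk
  have h : ∑ j ∈ Finset.range k, (Real.log ((2 * (j + 1) : ℕ) : ℝ) - 1)
      = k * Real.log 2 + k * phiB k - k := by
    rw [phiB_mul, ← Finset.prod_range_add_one_eq_factorial, Nat.cast_prod,
      Real.log_prod (fun i _ => by positivity), Finset.sum_sub_distrib]
    have : ∀ j ∈ Finset.range k, Real.log ((2 * (j + 1) : ℕ) : ℝ)
        = Real.log 2 + Real.log ((j + 1 : ℕ) : ℝ) := by
      intro j _
      rw [Nat.cast_mul, Real.log_mul (by norm_num) (by positivity)]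
      norm_num
    rw [Finset.sum_congr rfl this, Finset.sum_add_distrib]
    simp
  rw [Finset.sum_sub_distrib, h, Real.log_mul (by norm_num) hk'.ne']
  field_simp
  ring

lemma sum_phiB_le (ε : ℝ) (hε : 0 < ε) : ∃ k₀ : ℕ, 0 < k₀ ∧ ∀ k, k₀ ≤ k →
    ∑ j ∈ Finset.range k, phiB (2 * (j + 1))
      ≤ k * Real.log ((1 + ε) * (2 * k) / (Real.exp 1) ^ 2) := by
  have h1 := phiB_tendsto
  have h2 : Filter.Tendsto (fun j : ℕ => phiB (2 * (j + 1)) - (Real.log ((2 * (j + 1) : ℕ) : ℝ) - 1))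
      Filter.atTop (nhds 0) := by
    refine h1.comp (Filter.tendsto_atTop_mono (fun j => ?_) Filter.tendsto_id)
    simp only [id]; omega
  have h3 := h1.add h2.cesaro
  rw [add_zero] at h3
  have hl : 0 < Real.log (1 + ε) := Real.log_pos (by linarith)
  obtain ⟨k₀, hk₀⟩ := Filter.eventually_atTop.1 (h3.eventually (gt_mem_nhds hl))
  refine ⟨k₀ + 1, by omega, fun k hk => ?_⟩
  have h4 := hk₀ k (by omega)
  have hkpos : 0 < k := by omega
  have hk' : (0 : ℝ) < k := by exact_mod_cast hkpos
  have h5 := sum_phiB_eq k hkpos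
  have h6 : Real.log ((1 + ε) * (2 * k) / (Real.exp 1) ^ 2)
      = Real.log (1 + ε) + Real.log (2 * k) - 2 := by
    rw [Real.log_div (by positivity) (by positivity), Real.log_mul (by positivity) (by positivity),
      Real.log_pow, Real.log_exp]
    norm_num
  rw [h6, ← inv_mul_le_iff₀ hk', h5]
  linarith

lemma ham_perm {V : Type*} [Fintype V] [DecidableEq V] (H : SimpleGraph V)
    (hH : IsHamCycleGraph H) :
    ∃ e : Equiv.Perm V, ∀ u v, H.Adj u v ↔ (e u = v ∨ e v = u) := by
  classical
  obtain ⟨hc, hr⟩ := hH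
  have hcyc : H.IsCycles := fun v _ => hr v
  obtain ⟨v0⟩ := hc.nonempty
  have hn : (H.neighborSet v0).Nonempty := by
    apply Set.nonempty_of_ncard_ne_zero
    have : (H.neighborSet v0).ncard = 2 := hr v0
    omega
  obtain ⟨p, hp, hverts⟩ := hcyc.exists_cycle_toSubgraph_verts_eq_connectedComponentSupp
    (c := H.connectedComponentMk v0) (by simp) hn
  have hall : ∀ w, w ∈ p.toSubgraph.verts := by
    intro w
    rw [hverts]
    simp only [SimpleGraph.ConnectedComponent.mem_supp_iff, SimpleGraph.ConnectedComponent.eq]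
    exact hc.preconnected w v0
  have hadj : ∀ u v, p.toSubgraph.Adj u v ↔ H.Adj u v := fun u v =>
    hp.adj_toSubgraph_iff_of_isCycles hcyc (hall u) v
  have hlen : 3 ≤ p.length := hp.three_le_length
  have hidx : ∀ w, ∃ i, i < p.length ∧ p.getVert i = w := by
    intro w
    have := (p.mem_verts_toSubgraph).1 (hall w)
    rw [SimpleGraph.Walk.mem_support_iff_exists_getVert] at this
    obtain ⟨i, hi, hl⟩ := this
    rcases Nat.lt_or_ge i p.length with h | h
    · exact ⟨i, h, hi⟩
    · have : i = p.length := by omega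
      subst this
      refine ⟨0, by omega, ?_⟩
      rw [← hi]
      simp
  choose f hf1 hf2 using hidx
  have hfg : ∀ i, i < p.length → f (p.getVert i) = i := by
    intro i hi
    have h := hf2 (p.getVert i)
    have hl := hf1 (p.getVert i)
    exact hp.getVert_injOn' (by rw [Set.mem_ofPred_eq]; omega) (by rw [Set.mem_ofPred_eq]; omega) h
  let g : V → V := fun w => p.getVert (f w + 1)
  have hinj : Function.Injective g := by
    intro a b hab
    have := hp.getVert_injOn (by rw [Set.mem_ofPred_eq]; have := hf1 a; omega)
      (by rw [Set.mem_ofPred_eq]; have := hf1 b; omega) hab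
    have h2 : f a = f b := by omega
    rw [← hf2 a, ← hf2 b, h2]
  have hgadj : ∀ a, H.Adj a (g a) := by
    intro a
    have := p.adj_getVert_succ (hf1 a)
    rwa [hf2 a] at this
  refine ⟨Equiv.ofBijective g (Finite.injective_iff_bijective.1 hinj), fun u v => ?_⟩
  simp only [Equiv.ofBijective_apply]
  constructor
  · intro h
    rw [← hadj, SimpleGraph.Walk.toSubgraph_adj_iff] at h
    obtain ⟨i, hi, hl⟩ := h
    have hg : g (p.getVert i) = p.getVert (i + 1) := by
      change p.getVert (f (p.getVert i) + 1) = _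
      rw [hfg i hl]
    rw [Sym2.eq_iff] at hi
    rcases hi with ⟨h1, h2⟩ | ⟨h1, h2⟩
    · left; rw [← h1, ← h2, hg]
    · right; rw [← h1, ← h2, hg]
  · rintro (h | h)
    · rw [← h]; exact hgadj u
    · rw [← h]; exact (hgadj v).symm

lemma card_ham_le {V : Type*} [Fintype V] (Γ : SimpleGraph V) (d : ℕ) (hΓ : IsRegN Γ d) :
    ({H : SimpleGraph V | IsHamCycleGraph H ∧ H ≤ Γ}.ncard : ℝ)
      ≤ Real.exp (Fintype.card V * phiB d) := by
  classical
  have hN : ∀ v, (Γ.neighborFinset v).card = d := by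
    intro v
    rw [← hΓ v, degN, Set.ncard_eq_toFinset_card']
    rfl
  refine le_trans ?_ (bregman_reg (fun v => Γ.neighborFinset v) d hN)
  rw [← Set.ncard_coe_finset]
  have hex : ∀ H : SimpleGraph V, ∃ e : Equiv.Perm V, IsHamCycleGraph H →
      ∀ u v, H.Adj u v ↔ (e u = v ∨ e v = u) := by
    intro H
    by_cases h : IsHamCycleGraph H
    · obtain ⟨e, he⟩ := ham_perm H h
      exact ⟨e, fun _ => he⟩
    · exact ⟨1, fun h' => absurd h' h⟩
  choose F hF using hex
  rw [Nat.cast_le]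
  refine Set.ncard_le_ncard_of_injOn F ?_ ?_ (Finset.finite_toSet _)
  · rintro H ⟨h1, h2⟩
    simp only [Finset.coe_filter, Finset.mem_univ, true_and, Set.mem_setOf_eq,
      SimpleGraph.mem_neighborFinset]
    intro i
    exact h2 ((hF H h1 i _).2 (Or.inl rfl))
  · rintro H ⟨h1, _⟩ H' ⟨h1', _⟩ h
    ext u v
    rw [hF H h1, hF H' h1', h]

lemma sdiff_reg {V : Type*} [Fintype V] (Γ H : SimpleGraph V) (d : ℕ) (hΓ : IsRegN Γ (d + 2))
    (hH : IsRegN H 2) (hle : H ≤ Γ) : IsRegN (Γ \ H) d := by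
  intro v
  have h1 : (Γ \ H).neighborSet v = Γ.neighborSet v \ H.neighborSet v := by
    ext w; simp
  have h2 : (Γ.neighborSet v).ncard = d + 2 := hΓ v
  have h3 : (H.neighborSet v).ncard = 2 := hH v
  have h4 : H.neighborSet v ⊆ Γ.neighborSet v := fun w hw => hle hw
  rw [degN, h1, Set.ncard_sdiff h4 (Set.toFinite _), h2, h3]
  rfl

lemma decomp_erase {V : Type*} [DecidableEq (SimpleGraph V)] (Γ H : SimpleGraph V)
    (D : Finset (SimpleGraph V))
    (hD : IsHamDecomp Γ D) (hH : H ∈ D) : IsHamDecomp (Γ \ H) (D.erase H) := by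
  obtain ⟨h1, h2, h3⟩ := hD
  refine ⟨fun K hK => h1 K (Finset.mem_of_mem_erase hK), ?_, ?_⟩
  · exact h2.mono (by intro x hx; exact Finset.mem_of_mem_erase hx)
  · have h4 : Γ = H ⊔ (D.erase H).sup id := by
      rw [← h3]
      conv_lhs => rw [← Finset.insert_erase hH]
      rw [Finset.sup_insert]
      rfl
    have h5 : Disjoint ((D.erase H).sup id) H := by
      rw [Finset.disjoint_sup_left]
      intro K hK
      exact h2 (Finset.mem_of_mem_erase hK) hH (Finset.ne_of_mem_erase hK)
    rw [h4, sup_sdiff_left_self]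
    exact h5.sdiff_eq_left.symm

lemma numHam_le {V : Type*} [Fintype V] [Nonempty V] (k : ℕ) : ∀ (Γ : SimpleGraph V),
    IsRegN Γ (2 * k) → (numHamDecomp Γ : ℝ)
      ≤ Real.exp (Fintype.card V * ∑ j ∈ Finset.range k, phiB (2 * (j + 1))) := by
  classical
  induction k with
  | zero =>
    intro Γ hΓ
    have hsub : {D : Finset (SimpleGraph V) | IsHamDecomp Γ D} ⊆ {∅} := by
      intro D hD
      rw [Set.mem_singleton_iff, Finset.eq_empty_iff_forall_notMem]
      intro H hH
      obtain ⟨v⟩ := ‹Nonempty V›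
      have hle : H ≤ Γ := by
        rw [← hD.2.2]; exact Finset.le_sup (f := id) hH
      have h2 : (H.neighborSet v).ncard = 2 := (hD.1 H hH).2 v
      have h0 : (Γ.neighborSet v).ncard = 0 := hΓ v
      have := Set.ncard_le_ncard (s := H.neighborSet v) (t := Γ.neighborSet v)
        (fun w hw => hle hw) (Set.toFinite _)
      omega
    have := Set.ncard_le_ncard hsub (Set.toFinite _)
    rw [Set.ncard_singleton] at this
    simp only [Finset.range_zero, Finset.sum_empty, mul_zero, Real.exp_zero]
    exact_mod_cast this
  | succ k ih =>
    intro Γ hΓ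
    set B := Real.exp (Fintype.card V * ∑ j ∈ Finset.range k, phiB (2 * (j + 1))) with hB
    set HS : Finset (SimpleGraph V) := {H : SimpleGraph V | IsHamCycleGraph H ∧ H ≤ Γ}.toFinset
      with hHS
    have hHScard : (HS.card : ℝ) ≤ Real.exp (Fintype.card V * phiB (2 * (k + 1))) := by
      rw [hHS, ← Set.ncard_eq_toFinset_card']
      exact card_ham_le Γ _ hΓ
    have hsub : {D : Finset (SimpleGraph V) | IsHamDecomp Γ D} ⊆
        ⋃ H ∈ HS, (insert H) '' {D : Finset (SimpleGraph V) | IsHamDecomp (Γ \ H) D} := by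
      intro D hD
      have hne : D.Nonempty := by
        by_contra h
        rw [Finset.not_nonempty_iff_eq_empty] at h
        subst h
        obtain ⟨v⟩ := ‹Nonempty V›
        have h1 := hD.2.2
        simp only [Finset.sup_empty] at h1
        have h2 : (Γ.neighborSet v).ncard = 2 * (k + 1) := hΓ v
        rw [← h1] at h2
        simp at h2
      obtain ⟨H, hH⟩ := hne
      have hle : H ≤ Γ := by
        rw [← hD.2.2]; exact Finset.le_sup (f := id) hH
      simp only [Set.mem_iUnion]
      refine ⟨H, ?_, D.erase H, decomp_erase Γ H D hD hH, Finset.insert_erase hH⟩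
      rw [hHS, Set.mem_toFinset]
      exact ⟨hD.1 H hH, hle⟩
    have h1 : numHamDecomp Γ ≤ ∑ H ∈ HS, numHamDecomp (Γ \ H) := by
      refine (Set.ncard_le_ncard hsub (Set.toFinite _)).trans ?_
      refine (Finset.set_ncard_biUnion_le _ _).trans ?_
      exact Finset.sum_le_sum (fun H _ => Set.ncard_image_le (Set.toFinite _))
    have h2 : ∀ H ∈ HS, (numHamDecomp (Γ \ H) : ℝ) ≤ B := by
      intro H hH
      rw [hHS, Set.mem_toFinset] at hH
      exact ih _ (sdiff_reg Γ H (2 * k) hΓ hH.1.2 hH.2)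
    calc (numHamDecomp Γ : ℝ) ≤ ∑ H ∈ HS, (numHamDecomp (Γ \ H) : ℝ) := by exact_mod_cast h1
      _ ≤ ∑ H ∈ HS, B := Finset.sum_le_sum h2
      _ = HS.card * B := by rw [Finset.sum_const, nsmul_eq_mul]
      _ ≤ Real.exp (Fintype.card V * phiB (2 * (k + 1))) * B :=
          mul_le_mul_of_nonneg_right hHScard (Real.exp_pos _).le
      _ = _ := by
          rw [hB, ← Real.exp_add, Finset.sum_range_succ]
          congr 1
          ring

/-- For every `ε > 0` there exists `r₀` such that for every even
`r ≥ r₀` and every `n`, the number of Hamiltonian decompositions of any `r`-regular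
graph `Γ` on `n` vertices is at most `((1+ε) r / e²)^(n r / 2)`. -/
theorem upper_bound_hamiltonian_decompositions (ε : ℝ) (hε : 0 < ε) :
    ∃ r₀ : ℕ, ∀ r : ℕ, Even r → r₀ ≤ r → ∀ (n : ℕ) (Γ : SimpleGraph (Fin n)),
      IsRegN Γ r →
      (numHamDecomp Γ : ℝ) ≤
        ((1 + ε) * (r : ℝ) / (Real.exp 1) ^ 2) ^ ((n : ℝ) * (r : ℝ) / 2) := by
  obtain ⟨k₀, hk₀, hk⟩ := sum_phiB_le ε hε
  refine ⟨2 * k₀, ?_⟩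
  intro r hr hle n Γ hΓ
  obtain ⟨k, rfl⟩ := hr
  have hkk : k₀ ≤ k := by omega
  have hkpos : (0 : ℝ) < k := by exact_mod_cast lt_of_lt_of_le hk₀ hkk
  rcases Nat.eq_zero_or_pos n with rfl | hn
  · have hsub : {D : Finset (SimpleGraph (Fin 0)) | IsHamDecomp Γ D} ⊆ {∅} := by
      intro D hD
      rw [Set.mem_singleton_iff, Finset.eq_empty_iff_forall_notMem]
      intro H hH
      obtain ⟨v⟩ := (hD.1 H hH).1.nonempty
      exact v.elim0
    have := Set.ncard_le_ncard hsub (Set.toFinite _)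
    rw [Set.ncard_singleton] at this
    simp only [Nat.cast_zero, zero_mul, zero_div, Real.rpow_zero]
    exact_mod_cast this
  · have : Nonempty (Fin n) := ⟨⟨0, hn⟩⟩
    rw [← two_mul] at hΓ ⊢
    refine (numHam_le k Γ hΓ).trans ?_
    push_cast
    rw [Real.rpow_def_of_pos (by positivity), Real.exp_le_exp, Fintype.card_fin]
    have := mul_le_mul_of_nonneg_left (hk k hkk) (Nat.cast_nonneg (α := ℝ) n)
    refine this.trans (le_of_eq ?_)
    ring
end

section
/- Let c > 0, 0 < ε < 1/10, and γ > 0 be constants, and let δ, τ, ν satisfy 0 < δ ≤ εc/5, 2δ ≤ τ < 1, and 0 < ν ≤ min(δ, εγ/2). Then for all sufficiently large n the following holds. Let Γ be an n-vertex r-regular graph with even degree r ≥ cn such that e_Γ(A,B) ≥ γn² for any two vertex subsets A, B with |A| ≥ δ²n and |B| ≥ (1/2 - δ)n. Then the edges of Γ can be partitioned into three subgraphs G, F, R such that: (i) G is d-regular with even degree d ≥ (1 - 2ε)r; (ii) for any two vertex sets A, B with |A| ≥ δ²n and |B| ≥ (1/2 - δ)n, there are at least n^{1.6} edges of F between A and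 B; (iii) R is a robust (ν,τ)-expander. -/
open SimpleGraph

/-- The number of edges of `G` with one endpoint in `A` and the other endpoint in `B`
(edges with both endpoints in `A ∩ B` are counted once). -/
noncomputable def eBetween {V : Type*} (G : SimpleGraph V) (A B : Set V) : ℕ :=
  {e ∈ G.edgeSet | ∃ a ∈ A, ∃ b ∈ B, e = s(a, b)}.ncard

/-- The robust `ν`-neighborhood of `S`: all vertices with at least `ν * n` neighbors in `S`. -/
def robustNbhd {V : Type*} [Fintype V] (G : SimpleGraph V) (ν : ℝ) (S : Set V) : Set V :=
  {v | ν * (Fintype.card V : ℝ) ≤ (((G.neighborSet v) ∩ S).ncard : ℝ)}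

/-- `G` is a robust `(ν, τ)`-expander. -/
def IsRobustExpander {V : Type*} [Fintype V] (G : SimpleGraph V) (ν τ : ℝ) : Prop :=
  ∀ S : Set V,
    τ * (Fintype.card V : ℝ) ≤ (S.ncard : ℝ) →
    (S.ncard : ℝ) ≤ (1 - τ) * (Fintype.card V : ℝ) →
    (S.ncard : ℝ) + ν * (Fintype.card V : ℝ) ≤ ((robustNbhd G ν S).ncard : ℝ)

section
open Finset

theorem hall_match {E P Q : Type*} [Fintype E] [DecidableEq E] [Fintype P] [DecidableEq P]
    [Fintype Q] [DecidableEq Q] (p : E → P) (q : E → Q) (k : ℕ) (hk : 0 < k)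
    (hp : ∀ x, #{e | p e = x} = k) (hq : ∀ y, #{e | q e = y} = k) :
    ∃ M : Finset E, (∀ x, #{e ∈ M | p e = x} = 1) ∧ (∀ y, #{e ∈ M | q e = y} = 1) := by
  classical
  have key : ∀ s : Finset P, #s ≤ #(s.biUnion fun x => image q {e | p e = x}) := by
    intro s
    have h1 : #{e | p e ∈ s} = #s * k := by
      rw [card_eq_sum_card_fiberwise (f := p) (t := s) (by intro e he; simpa using he)]
      rw [sum_const_nat (m := k)]
      intro x hx
      rw [← hp x]
      congr 1
      ext e
      simp only [mem_filter, mem_univ, true_and]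
      constructor
      · exact fun h => h.2
      · exact fun h => ⟨h ▸ hx, h⟩
    set t := s.biUnion fun x => image q {e | p e = x} with ht
    have h2 : #{e | q e ∈ t} = #t * k := by
      rw [card_eq_sum_card_fiberwise (f := q) (t := t) (by intro e he; simpa using he)]
      rw [sum_const_nat (m := k)]
      intro x hx
      rw [← hq x]
      congr 1
      ext e
      simp only [mem_filter, mem_univ, true_and]
      constructor
      · exact fun h => h.2
      · exact fun h => ⟨h ▸ hx, h⟩
    have h3 : #{e | p e ∈ s} ≤ #{e | q e ∈ t} := by
      apply card_le_card
      intro e he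
      simp only [mem_filter, mem_univ, true_and] at he ⊢
      rw [ht, mem_biUnion]
      exact ⟨p e, he, mem_image_of_mem _ (by simp)⟩
    rw [h1, h2] at h3
    exact Nat.le_of_mul_le_mul_right h3 hk
  obtain ⟨f, hf, hfm⟩ := (all_card_le_biUnion_card_iff_exists_injective _).1 key
  have hcard : Fintype.card P = Fintype.card Q := by
    have h1 := card_eq_sum_card_fiberwise (s := (univ : Finset E)) (f := p) (t := univ) (by simp [Set.MapsTo])
    have h2 := card_eq_sum_card_fiberwise (s := (univ : Finset E)) (f := q) (t := univ) (by simp [Set.MapsTo])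
    simp only [hp, hq, sum_const, smul_eq_mul] at h1 h2
    exact Nat.eq_of_mul_eq_mul_right hk (h1.symm.trans h2)
  have hb : Function.Bijective f := (Fintype.bijective_iff_injective_and_card f).2 ⟨hf, hcard⟩
  have hex : ∀ x, ∃ e, p e = x ∧ q e = f x := by
    intro x
    have := hfm x
    simpa using this
  choose c hc1 hc2 using hex
  refine ⟨univ.image c, fun x => ?_, fun y => ?_⟩
  · rw [card_eq_one]
    refine ⟨c x, ?_⟩
    ext e
    simp only [mem_filter, mem_image, mem_univ, true_and, mem_singleton]
    constructor
    · rintro ⟨⟨z, rfl⟩, h⟩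
      rw [hc1] at h; rw [h]
    · rintro rfl
      exact ⟨⟨x, rfl⟩, hc1 x⟩
  · obtain ⟨x, rfl⟩ := hb.2 y
    rw [card_eq_one]
    refine ⟨c x, ?_⟩
    ext e
    simp only [mem_filter, mem_image, mem_univ, true_and, mem_singleton]
    constructor
    · rintro ⟨⟨z, rfl⟩, h⟩
      rw [hc2] at h; rw [hf h]
    · rintro rfl
      exact ⟨⟨x, rfl⟩, hc2 x⟩

theorem pairing_exists {E V : Type*} [Fintype E] [DecidableEq E] [Fintype V] [DecidableEq V]
    (g : E → V) (hg : ∀ v, Even #{e | g e = v}) :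
    ∃ (m : V → ℕ) (p : E → Σ v, Fin (m v)), (∀ e, (p e).1 = g e) ∧ (∀ x, #{e | p e = x} = 2) := by
  classical
  have h2 : ∀ v, ∃ m, #{e | g e = v} = m * 2 := fun v => by
    obtain ⟨m, hm⟩ := hg v
    exact ⟨m, by omega⟩
  choose m hm using h2
  have φ : ∀ v, {e // g e = v} ≃ Fin (m v) × Fin 2 := fun v =>
    (Fintype.equivFinOfCardEq (by rw [Fintype.card_subtype, hm v])).trans finProdFinEquiv.symm
  refine ⟨m, fun e => ⟨g e, (φ (g e) ⟨e, rfl⟩).1⟩, fun e => rfl, ?_⟩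
  rintro ⟨v, i⟩
  have : ({e | (⟨g e, (φ (g e) ⟨e, rfl⟩).1⟩ : Σ v, Fin (m v)) = ⟨v, i⟩} : Finset E)
      = (univ : Finset (Fin 2)).image (fun j => ((φ v).symm (i, j)).1) := by
    ext e
    simp only [mem_filter, mem_univ, true_and, mem_image]
    constructor
    · intro h
      have hv : g e = v := congrArg Sigma.fst h
      subst hv
      have hi : (φ (g e) ⟨e, rfl⟩).1 = i := by simpa using h
      refine ⟨(φ (g e) ⟨e, rfl⟩).2, ?_⟩
      rw [← hi]
      simp
    · rintro ⟨j, rfl⟩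
      have hv : g ((φ v).symm (i, j)).1 = v := ((φ v).symm (i, j)).2
      have aux : ∀ (w : V) (z : {e // g e = w}), (⟨g z.1, (φ (g z.1) ⟨z.1, rfl⟩).1⟩ : Σ v, Fin (m v)) = ⟨w, (φ w z).1⟩ := by
        rintro w ⟨z, rfl⟩
        rfl
      rw [aux]
      simp
  rw [this, card_image_of_injective]
  · simp
  · intro a b h
    have := (φ v).symm.injective (Subtype.ext h)
    simpa using this

theorem half_exists {E V W : Type*} [Fintype E] [DecidableEq E] [Fintype V] [DecidableEq V]
    [Fintype W] [DecidableEq W]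
    (g : E → V) (h : E → W) (hg : ∀ v, Even #{e | g e = v}) (hh : ∀ v, Even #{e | h e = v}) :
    ∃ M : Finset E, (∀ v, 2 * #{e ∈ M | g e = v} = #{e | g e = v}) ∧
      (∀ v, 2 * #{e ∈ M | h e = v} = #{e | h e = v}) := by
  classical
  obtain ⟨m, p, hp1, hp2⟩ := pairing_exists g hg
  obtain ⟨m', q, hq1, hq2⟩ := pairing_exists h hh
  obtain ⟨M, hM1, hM2⟩ := hall_match p q 2 (by norm_num) hp2 hq2
  refine ⟨M, fun v => ?_, fun v => ?_⟩
  · rw [card_eq_sum_card_fiberwise (s := {e ∈ M | g e = v}) (f := p) (t := {x | x.1 = v})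
      (by intro e he; simp at he ⊢; rw [hp1]; exact he.2),
      card_eq_sum_card_fiberwise (s := {e | g e = v}) (f := p) (t := {x | x.1 = v})
      (by intro e he; simp at he ⊢; rw [hp1]; exact he), mul_sum]
    apply sum_congr rfl
    intro x hx
    simp only [mem_filter, mem_univ, true_and] at hx
    subst hx
    have e1 : filter (fun e => p e = x) (filter (fun e => g e = x.1) M) = filter (fun e => p e = x) M := by
      ext e; simp only [mem_filter]
      constructor
      · exact fun h => ⟨h.1.1, h.2⟩
      · exact fun h => ⟨⟨h.1, by rw [← hp1, h.2]⟩, h.2⟩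
    have e2 : filter (fun e => p e = x) (filter (fun e => g e = x.1) univ) = filter (fun e => p e = x) univ := by
      ext e; simp only [mem_filter]
      constructor
      · exact fun h => ⟨h.1.1, h.2⟩
      · exact fun h => ⟨⟨h.1, by rw [← hp1, h.2]⟩, h.2⟩
    rw [e1, e2, hM1, hp2, mul_one]
  · rw [card_eq_sum_card_fiberwise (s := {e ∈ M | h e = v}) (f := q) (t := {x | x.1 = v})
      (by intro e he; simp at he ⊢; rw [hq1]; exact he.2),
      card_eq_sum_card_fiberwise (s := {e | h e = v}) (f := q) (t := {x | x.1 = v})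
      (by intro e he; simp at he ⊢; rw [hq1]; exact he), mul_sum]
    apply sum_congr rfl
    intro x hx
    simp only [mem_filter, mem_univ, true_and] at hx
    subst hx
    have e1 : filter (fun e => q e = x) (filter (fun e => h e = x.1) M) = filter (fun e => q e = x) M := by
      ext e; simp only [mem_filter]
      constructor
      · exact fun h => ⟨h.1.1, h.2⟩
      · exact fun h => ⟨⟨h.1, by rw [← hq1, h.2]⟩, h.2⟩
    have e2 : filter (fun e => q e = x) (filter (fun e => h e = x.1) univ) = filter (fun e => q e = x) univ := by
      ext e; simp only [mem_filter]
      constructor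
      · exact fun h => ⟨h.1.1, h.2⟩
      · exact fun h => ⟨⟨h.1, by rw [← hq1, h.2]⟩, h.2⟩
    rw [e1, e2, hM2, hq2, mul_one]

theorem card_filter_sub {α β : Type*} [DecidableEq α] [DecidableEq β] (D : Finset α)
    (M : Finset D) (g : α → β) (v : β) :
    #{e ∈ M.map (Function.Embedding.subtype _) | g e = v} = #{e ∈ M | g e.1 = v} := by
  rw [filter_map, card_map]; rfl

theorem card_filter_sub_univ {α β : Type*} [DecidableEq α] [DecidableEq β] (D : Finset α)
    (g : α → β) (v : β) :
    #{e : D | g e.1 = v} = #{e ∈ D | g e = v} := by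
  rw [← card_filter_sub D univ g v]
  congr 2
  exact attach_map_val

theorem map_sub_subset {α : Type*} [DecidableEq α] (D : Finset α)
    (M : Finset D) : M.map (Function.Embedding.subtype _) ⊆ D := by
  intro x hx
  simp only [mem_map, Function.Embedding.subtype_apply] at hx
  obtain ⟨y, _, rfl⟩ := hx
  exact y.2

theorem half_finset {α V W : Type*} [DecidableEq α] [Fintype V] [DecidableEq V] [Fintype W]
    [DecidableEq W] (D : Finset α) (g : α → V) (h : α → W)
    (hg : ∀ v, Even #{e ∈ D | g e = v}) (hh : ∀ v, Even #{e ∈ D | h e = v}) :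
    ∃ D' ⊆ D, (∀ v, 2 * #{e ∈ D' | g e = v} = #{e ∈ D | g e = v}) ∧
      (∀ v, 2 * #{e ∈ D' | h e = v} = #{e ∈ D | h e = v}) := by
  obtain ⟨M, h1, h2⟩ := half_exists (E := D) (fun e => g e.1) (fun e => h e.1)
    (fun v => by rw [card_filter_sub_univ]; exact hg v)
    (fun v => by rw [card_filter_sub_univ]; exact hh v)
  refine ⟨M.map (Function.Embedding.subtype _), map_sub_subset D M, fun v => ?_, fun v => ?_⟩
  · rw [card_filter_sub, h1, card_filter_sub_univ]
  · rw [card_filter_sub, h2, card_filter_sub_univ]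

theorem match_finset {α V W : Type*} [DecidableEq α] [Fintype V] [DecidableEq V] [Fintype W]
    [DecidableEq W] (D : Finset α) (g : α → V) (h : α → W) (k : ℕ) (hk : 0 < k)
    (hg : ∀ v, #{e ∈ D | g e = v} = k) (hh : ∀ v, #{e ∈ D | h e = v} = k) :
    ∃ D' ⊆ D, (∀ v, #{e ∈ D' | g e = v} = 1) ∧ (∀ v, #{e ∈ D' | h e = v} = 1) := by
  obtain ⟨M, h1, h2⟩ := hall_match (E := D) (fun e => g e.1) (fun e => h e.1) k hk
    (fun v => by rw [card_filter_sub_univ]; exact hg v)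
    (fun v => by rw [card_filter_sub_univ]; exact hh v)
  refine ⟨M.map (Function.Embedding.subtype _), map_sub_subset D M, fun v => ?_, fun v => ?_⟩
  · rw [card_filter_sub, h1]
  · rw [card_filter_sub, h2]

/-- A dense set of pairs contains a four-cycle. -/
theorem exists_C4 {V : Type*} [Fintype V] [DecidableEq V] (D : Finset (V × V)) (n : ℕ)
    (hn : Fintype.card V = n) (h : 2 * n ^ 3 < #D ^ 2) :
    ∃ a a' b b', a ≠ a' ∧ b ≠ b' ∧ (a, b) ∈ D ∧ (a, b') ∈ D ∧ (a', b) ∈ D ∧ (a', b') ∈ D := by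
  by_contra hcon
  push Not at hcon
  have h1 : #D = ∑ b : V, #{a | (a, b) ∈ D} := by
    rw [card_eq_sum_card_fiberwise (f := Prod.snd) (t := univ) (by simp [Set.MapsTo])]
    apply sum_congr rfl
    intro b _
    have : filter (fun e : V × V => e.2 = b) D =
        (filter (fun a => (a, b) ∈ D) univ).map ⟨fun a => (a, b), fun x y h => by simpa using h⟩ := by
      ext ⟨x, y⟩
      simp only [mem_filter, mem_map, mem_univ, true_and]
      constructor
      · rintro ⟨h, rfl⟩; exact ⟨x, h, rfl⟩
      · rintro ⟨a, h, ⟨⟩⟩; exact ⟨h, rfl⟩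
    rw [this, card_map]
  have h2 : (∑ b : V, #{a | (a, b) ∈ D}) ^ 2 ≤ n * ∑ b : V, #{a | (a, b) ∈ D} ^ 2 := by
    have := sq_sum_le_card_mul_sum_sq (s := (univ : Finset V)) (f := fun b => #{a | (a, b) ∈ D})
    rwa [card_univ, hn] at this
  have h3 : ∑ b : V, #{a | (a, b) ∈ D} ^ 2 =
      ∑ x : V × V, #{b | (x.1, b) ∈ D ∧ (x.2, b) ∈ D} := by
    simp only [card_filter, sq, sum_mul_sum]
    rw [← univ_product_univ]
    simp only [sum_product]
    rw [sum_comm]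
    refine sum_congr rfl fun x _ => ?_
    rw [sum_comm]
    refine sum_congr rfl fun y _ => ?_
    refine sum_congr rfl fun z _ => ?_
    by_cases h1 : (x, z) ∈ D <;> by_cases h2 : (y, z) ∈ D <;> simp [h1, h2]
  have h4 : ∀ x : V × V, #{b | (x.1, b) ∈ D ∧ (x.2, b) ∈ D} ≤ 1 + (if x.1 = x.2 then n else 0) := by
    rintro ⟨x, y⟩
    split_ifs with hxy
    · calc _ ≤ #(univ : Finset V) := card_le_card (subset_univ _)
        _ ≤ _ := by rw [card_univ, hn]; omega
    · rw [add_zero, card_le_one]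
      intro b hb b' hb'
      simp only [mem_filter, mem_univ, true_and] at hb hb' hxy
      by_contra hbb
      exact hcon x y b b' hxy hbb hb.1 hb'.1 hb.2 hb'.2
  have h5 : ∑ x : V × V, #{b | (x.1, b) ∈ D ∧ (x.2, b) ∈ D} ≤ 2 * n ^ 2 := by
    calc _ ≤ ∑ x : V × V, (1 + (if x.1 = x.2 then n else 0)) := sum_le_sum fun x _ => h4 x
      _ = 2 * n ^ 2 := by
        rw [← univ_product_univ, sum_product]
        simp [sum_add_distrib, hn]
        ring
  rw [h3, ← h1] at h2
  have : n * ∑ x : V × V, #{b | (x.1, b) ∈ D ∧ (x.2, b) ∈ D} ≤ n * (2 * n ^ 2) := Nat.mul_le_mul_left _ h5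
  nlinarith

/-- Discrepancy of a half. -/
noncomputable def disc {V : Type*} [DecidableEq V] (D' D T : Finset (V × V)) : ℝ :=
  2 * (#(D' ∩ T) : ℝ) - #(D ∩ T)

theorem disc_abs_le {V : Type*} [DecidableEq V] (D' D T : Finset (V × V)) (h : D' ⊆ D) :
    |disc D' D T| ≤ #D := by
  have h1 : #(D' ∩ T) ≤ #(D ∩ T) := card_le_card (inter_subset_inter_right h)
  have h2 : #(D ∩ T) ≤ #D := card_le_card inter_subset_left
  unfold disc
  have h1' : (#(D' ∩ T) : ℝ) ≤ #(D ∩ T) := by exact_mod_cast h1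
  have h2' : (#(D ∩ T) : ℝ) ≤ #D := by exact_mod_cast h2
  have h3 : (0 : ℝ) ≤ #(D' ∩ T) := by positivity
  rw [abs_le]
  constructor <;> linarith

theorem disc_union {V : Type*} [DecidableEq V] (D' D C' C T : Finset (V × V))
    (h : Disjoint D C) (hD : D' ⊆ D) (hC : C' ⊆ C) :
    disc (D' ∪ C') (D ∪ C) T = disc D' D T + disc C' C T := by
  have aux : ∀ X Y : Finset (V × V), Disjoint X Y → #((X ∪ Y) ∩ T) = #(X ∩ T) + #(Y ∩ T) := by
    intro X Y hXY
    rw [union_inter_distrib_right, card_union_of_disjoint]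
    exact hXY.mono inter_subset_left inter_subset_left
  unfold disc
  rw [aux _ _ h, aux _ _ (h.mono hD hC)]
  push_cast
  ring

theorem disc_compl {V : Type*} [DecidableEq V] (D' D T : Finset (V × V)) (h : D' ⊆ D) :
    disc (D \ D') D T = - disc D' D T := by
  have : #((D \ D') ∩ T) + #(D' ∩ T) = #(D ∩ T) := by
    rw [← card_union_of_disjoint, ← union_inter_distrib_right, sdiff_union_of_subset h]
    exact disjoint_sdiff_self_left.mono inter_subset_left inter_subset_left
  have h' : (#((D \ D') ∩ T) : ℝ) + #(D' ∩ T) = #(D ∩ T) := by exact_mod_cast this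
  unfold disc
  linarith

theorem split_induction {V ι : Type*} [Fintype V] [DecidableEq V] [Fintype ι]
    (T : ι → Finset (V × V)) (lam N : ℝ) (hlam : 0 ≤ lam) (hN : 0 ≤ N)
    (hC4 : ∀ D : Finset (V × V), N < #D →
      ∃ a a' b b', a ≠ a' ∧ b ≠ b' ∧ (a, b) ∈ D ∧ (a, b') ∈ D ∧ (a', b) ∈ D ∧ (a', b') ∈ D) :
    ∀ (s : ℕ) (D : Finset (V × V)), #D = s → (∀ v, Even #{e ∈ D | e.1 = v}) →
      (∀ v, Even #{e ∈ D | e.2 = v}) →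
      ∃ D' ⊆ D, (∀ v, 2 * #{e ∈ D' | e.1 = v} = #{e ∈ D | e.1 = v}) ∧
        (∀ v, 2 * #{e ∈ D' | e.2 = v} = #{e ∈ D | e.2 = v}) ∧
        ∑ i, Real.cosh (lam * disc D' D (T i)) ≤
          Fintype.card ι * Real.cosh (lam * N) * Real.cosh (4 * lam) ^ s := by
  intro s
  induction s using Nat.strong_induction_on with
  | _ s ih =>
  intro D hs h1 h2
  by_cases hD : N < #D
  · obtain ⟨a, a', b, b', ha, hb, m1, m2, m3, m4⟩ := hC4 D hD
    set X : Finset (V × V) := {(a, b), (a', b')} with hX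
    set Y : Finset (V × V) := {(a, b'), (a', b)} with hY
    have hXY : Disjoint X Y := by
      rw [Finset.disjoint_left]
      simp only [hX, hY, mem_insert, mem_singleton, Prod.forall, Prod.mk.injEq]
      grind
    set C := X ∪ Y with hC
    have hCD : C ⊆ D := by
      intro e he
      simp only [hC, hX, hY, mem_union, mem_insert, mem_singleton] at he
      rcases he with (rfl | rfl) | (rfl | rfl) <;> assumption
    have hX1 : ∀ v, #{e ∈ X | e.1 = v} = (if a = v then 1 else 0) + if a' = v then 1 else 0 := by
      intro v
      rw [card_filter, hX, sum_pair (by simp [ha])]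
    have hX2 : ∀ v, #{e ∈ X | e.2 = v} = (if b = v then 1 else 0) + if b' = v then 1 else 0 := by
      intro v
      rw [card_filter, hX, sum_pair (by simp [ha])]
    have hY1 : ∀ v, #{e ∈ Y | e.1 = v} = (if a = v then 1 else 0) + if a' = v then 1 else 0 := by
      intro v
      rw [card_filter, hY, sum_pair (by simp [ha])]
    have hY2 : ∀ v, #{e ∈ Y | e.2 = v} = (if b = v then 1 else 0) + if b' = v then 1 else 0 := by
      intro v
      rw [card_filter, hY, sum_pair (by simp [ha]), add_comm]
    have addf : ∀ (A B : Finset (V × V)) (p : V × V → V) (v : V), Disjoint A B →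
        #{e ∈ A ∪ B | p e = v} = #{e ∈ A | p e = v} + #{e ∈ B | p e = v} := by
      intro A B p v hAB
      rw [filter_union, card_union_of_disjoint]
      exact hAB.mono (filter_subset _ _) (filter_subset _ _)
    have hD0 : D \ C ∪ C = D := sdiff_union_of_subset hCD
    have hdis : Disjoint (D \ C) C := disjoint_sdiff_self_left
    have hf : ∀ (p : V × V → V) (v : V), #{e ∈ D | p e = v} = #{e ∈ D \ C | p e = v} +
        (#{e ∈ X | p e = v} + #{e ∈ Y | p e = v}) := by
      intro p v
      rw [← addf X Y p v hXY, ← addf _ _ p v hdis, hD0]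
    have hXc : #X = 2 := card_pair (by simp [ha])
    have hYc : #Y = 2 := card_pair (by simp [ha])
    have hCc : #C = 4 := by rw [hC, card_union_of_disjoint hXY, hXc, hYc]
    have hcard : #(D \ C) = s - 4 ∧ 4 ≤ s := by
      have := card_sdiff_add_card_eq_card hCD
      omega
    obtain ⟨D', hD'D, d1, d2, d3⟩ := ih (s - 4) (by omega) (D \ C) hcard.1
      (fun v => by
        have := h1 v
        rw [hf Prod.fst v, hX1, hY1] at this
        rw [Nat.even_add] at this
        exact this.2 ⟨_, rfl⟩)
      (fun v => by
        have := h2 v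
        rw [hf Prod.snd v, hX2, hY2] at this
        rw [Nat.even_add] at this
        exact this.2 ⟨_, rfl⟩)
    have dX : ∀ i, disc (D' ∪ X) D (T i) = disc D' (D \ C) (T i) + disc X C (T i) := by
      intro i
      rw [← disc_union _ _ _ _ _ hdis hD'D subset_union_left, hD0]
    have dY : ∀ i, disc (D' ∪ Y) D (T i) = disc D' (D \ C) (T i) - disc X C (T i) := by
      intro i
      have : Y = C \ X := by
        rw [hC, union_sdiff_left, sdiff_eq_self_of_disjoint hXY.symm]
      rw [sub_eq_add_neg, ← disc_compl X C _ subset_union_left, ← this,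
        ← disc_union _ _ _ _ _ hdis hD'D subset_union_right, hD0]
    set Φ : Finset (V × V) → ℝ := fun Z => ∑ i, Real.cosh (lam * disc Z D (T i)) with hΦ
    set K : ℝ := Fintype.card ι * Real.cosh (lam * N) * Real.cosh (4 * lam) ^ s with hK
    have hsum : Φ (D' ∪ X) + Φ (D' ∪ Y) ≤ 2 * K := by
      have hone : 1 ≤ Real.cosh (4 * lam) := Real.one_le_cosh _
      calc Φ (D' ∪ X) + Φ (D' ∪ Y)
          = ∑ i, 2 * (Real.cosh (lam * disc D' (D \ C) (T i)) * Real.cosh (lam * disc X C (T i))) := by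
            rw [hΦ, ← sum_add_distrib]
            refine sum_congr rfl fun i _ => ?_
            rw [dX, dY, mul_add, mul_sub, Real.cosh_add, Real.cosh_sub]
            ring
        _ ≤ ∑ i, 2 * (Real.cosh (lam * disc D' (D \ C) (T i)) * Real.cosh (4 * lam)) := by
            refine sum_le_sum fun i _ => ?_
            have : Real.cosh (lam * disc X C (T i)) ≤ Real.cosh (4 * lam) := by
              rw [Real.cosh_le_cosh, abs_mul, abs_mul, mul_comm]
              have := disc_abs_le X C (T i) subset_union_left
              rw [hCc] at this
              apply mul_le_mul_of_nonneg_right _ (abs_nonneg lam)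
              simpa using this
            have h0 := Real.cosh_pos (lam * disc D' (D \ C) (T i))
            gcongr
        _ = 2 * ((∑ i, Real.cosh (lam * disc D' (D \ C) (T i))) * Real.cosh (4 * lam)) := by
            rw [← mul_sum, ← sum_mul]
        _ ≤ 2 * ((Fintype.card ι * Real.cosh (lam * N) * Real.cosh (4 * lam) ^ (s - 4)) * Real.cosh (4 * lam)) := by
            gcongr
        _ ≤ 2 * K := by
            rw [hK, mul_assoc _ _ (Real.cosh (4 * lam)), ← pow_succ]
            have := Real.cosh_pos (lam * N)
            gcongr
            omega
    have fin : ∀ Z, Z ⊆ C → (∀ v, #{e ∈ Z | e.1 = v} = (if a = v then 1 else 0) + if a' = v then 1 else 0) →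
        (∀ v, #{e ∈ Z | e.2 = v} = (if b = v then 1 else 0) + if b' = v then 1 else 0) →
        D' ∪ Z ⊆ D ∧ (∀ v, 2 * #{e ∈ D' ∪ Z | e.1 = v} = #{e ∈ D | e.1 = v}) ∧
        (∀ v, 2 * #{e ∈ D' ∪ Z | e.2 = v} = #{e ∈ D | e.2 = v}) := by
      intro Z hZ z1 z2
      refine ⟨union_subset (hD'D.trans sdiff_subset) (hZ.trans hCD), fun v => ?_, fun v => ?_⟩
      · rw [hf Prod.fst, addf _ _ Prod.fst v (hdis.mono hD'D hZ), mul_add, d1, z1, hX1, hY1]; ring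
      · rw [hf Prod.snd, addf _ _ Prod.snd v (hdis.mono hD'D hZ), mul_add, d2, z2, hX2, hY2]; ring
    by_cases hle : Φ (D' ∪ X) ≤ K
    · obtain ⟨f1, f2, f3⟩ := fin X subset_union_left hX1 hX2
      exact ⟨D' ∪ X, f1, f2, f3, hle⟩
    · obtain ⟨f1, f2, f3⟩ := fin Y subset_union_right hY1 hY2
      refine ⟨D' ∪ Y, f1, f2, f3, ?_⟩
      change Φ (D' ∪ Y) ≤ K
      linarith
  · obtain ⟨D', hD', d1, d2⟩ := half_finset D Prod.fst Prod.snd h1 h2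
    refine ⟨D', hD', d1, d2, ?_⟩
    push Not at hD
    have hone : 1 ≤ Real.cosh (4 * lam) ^ s := one_le_pow₀ (Real.one_le_cosh _)
    calc ∑ i, Real.cosh (lam * disc D' D (T i)) ≤ ∑ i : ι, Real.cosh (lam * N) := by
          refine sum_le_sum fun i _ => ?_
          rw [Real.cosh_le_cosh, abs_mul, abs_mul]
          have := disc_abs_le D' D (T i) hD'
          rw [abs_of_nonneg hN]
          gcongr
          linarith
      _ = Fintype.card ι * Real.cosh (lam * N) := by simp
      _ ≤ _ := by
          have := Real.cosh_pos (lam * N)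
          apply le_mul_of_one_le_right (by positivity) hone

/-- All in- and out-degrees are `k`. -/
def RegD {V : Type*} [DecidableEq V] (D : Finset (V × V)) (k : ℕ) : Prop :=
  (∀ v, #{e ∈ D | e.1 = v} = k) ∧ (∀ v, #{e ∈ D | e.2 = v} = k)

theorem RegD.sdiff {V : Type*} [DecidableEq V] {D D' : Finset (V × V)} {k l : ℕ}
    (h : RegD D k) (h' : RegD D' l) (hs : D' ⊆ D) : RegD (D \ D') (k - l) := by
  have aux : ∀ p : V × V → V, ∀ v, #{e ∈ D \ D' | p e = v} + #{e ∈ D' | p e = v} = #{e ∈ D | p e = v} := by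
    intro p v
    rw [← card_union_of_disjoint, ← filter_union, sdiff_union_of_subset hs]
    exact disjoint_sdiff_self_left.mono (filter_subset _ _) (filter_subset _ _)
  constructor
  · intro v
    have := aux Prod.fst v
    rw [h.1, h'.1] at this
    omega
  · intro v
    have := aux Prod.snd v
    rw [h.2, h'.2] at this
    omega

theorem RegD.card {n : ℕ} {D : Finset (Fin n × Fin n)} {k : ℕ} (h : RegD D k) : #D = n * k := by
  rw [card_eq_sum_card_fiberwise (f := Prod.fst) (t := univ) (by simp [Set.MapsTo])]
  simp [h.1]

theorem halve_even (η : ℝ) (hη : 0 < η) : ∃ n₀ : ℕ, ∀ n : ℕ, n₀ ≤ n →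
    ∀ (T : Finset (Fin n) × Finset (Fin n) → Finset (Fin n × Fin n))
      (D : Finset (Fin n × Fin n)) (k : ℕ), RegD D k → Even k →
      ∃ D' ⊆ D, RegD D' (k / 2) ∧ ∀ i, |disc D' D (T i)| ≤ 3 / 4 * η * n ^ 2 := by
  refine ⟨⌈400 / η ^ 2⌉₊ + 1, fun n hn T D k hD hk => ?_⟩
  have hn1 : 400 / η ^ 2 ≤ (n : ℝ) := (Nat.le_ceil _).trans (by exact_mod_cast (by omega))
  have hn2 : (1 : ℝ) ≤ n := by exact_mod_cast (by omega : 1 ≤ n)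
  have hn3 : 400 ≤ η ^ 2 * n := by
    rw [div_le_iff₀ (by positivity)] at hn1
    linarith
  have hC4 : ∀ D : Finset (Fin n × Fin n), η / 4 * n ^ 2 < #D →
      ∃ a a' b b', a ≠ a' ∧ b ≠ b' ∧ (a, b) ∈ D ∧ (a, b') ∈ D ∧ (a', b) ∈ D ∧ (a', b') ∈ D := by
    intro D hD
    apply exists_C4 D n (by simp)
    have h1 : (η / 4 * n ^ 2) ^ 2 < (#D : ℝ) ^ 2 := by
      gcongr
    have h2 : 2 * (n : ℝ) ^ 3 ≤ (η / 4 * n ^ 2) ^ 2 := by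
      have : (η / 4 * (n : ℝ) ^ 2) ^ 2 = (η ^ 2 * n) / 16 * n ^ 3 := by ring
      rw [this]
      gcongr
      linarith
    have h3 : 2 * (n : ℝ) ^ 3 < (#D : ℝ) ^ 2 := lt_of_le_of_lt h2 h1
    exact_mod_cast h3
  set lam := η / 32 with hlam
  have hl0 : 0 < lam := by positivity
  obtain ⟨D', hD', d1, d2, d3⟩ := split_induction T lam (η / 4 * n ^ 2) hl0.le (by positivity) hC4
    #D D rfl (fun v => by rw [hD.1]; exact hk) (fun v => by rw [hD.2]; exact hk)
  refine ⟨D', hD', ⟨fun v => ?_, fun v => ?_⟩, fun i => ?_⟩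
  · have := d1 v
    rw [hD.1] at this
    omega
  · have := d2 v
    rw [hD.2] at this
    omega
  have e1 : Real.exp (lam * |disc D' D (T i)|) ≤ 2 * Real.cosh (lam * disc D' D (T i)) := by
    rw [← Real.cosh_abs, abs_mul, abs_of_pos hl0, Real.cosh_eq]
    have := Real.exp_pos (-(lam * |disc D' D (T i)|))
    linarith
  have e2 : Real.cosh (lam * disc D' D (T i)) ≤ ∑ i, Real.cosh (lam * disc D' D (T i)) :=
    single_le_sum (f := fun i => Real.cosh (lam * disc D' D (T i)))
      (fun j _ => (Real.cosh_pos _).le) (mem_univ i)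
  have e3 : (Fintype.card (Finset (Fin n) × Finset (Fin n)) : ℝ) ≤ Real.exp (2 * n) := by
    have h2 : (2 : ℝ) ≤ Real.exp 1 := by have := Real.add_one_le_exp (1 : ℝ); linarith
    have : Real.exp (2 * n) = (Real.exp 1) ^ n * (Real.exp 1) ^ n := by
      rw [← Real.exp_nat_mul, ← Real.exp_add]; congr 1; ring
    rw [this]
    simp only [Fintype.card_prod, Fintype.card_finset, Fintype.card_fin]
    push_cast
    gcongr
  have e4 : Real.cosh (lam * (η / 4 * n ^ 2)) ≤ Real.exp (lam * (η / 4 * n ^ 2)) := by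
    have h0 : 0 ≤ lam * (η / 4 * n ^ 2) := by positivity
    rw [Real.cosh_eq]
    have : Real.exp (-(lam * (η / 4 * n ^ 2))) ≤ Real.exp (lam * (η / 4 * n ^ 2)) :=
      Real.exp_le_exp.2 (by linarith)
    linarith
  have e5 : Real.cosh (4 * lam) ^ #D ≤ Real.exp (8 * lam ^ 2 * n ^ 2) := by
    have hc : #D ≤ n ^ 2 := by
      have := card_le_card (subset_univ D)
      simpa [sq] using this
    calc Real.cosh (4 * lam) ^ #D ≤ Real.cosh (4 * lam) ^ (n ^ 2) :=
          pow_le_pow_right₀ (Real.one_le_cosh _) hc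
      _ ≤ Real.exp ((4 * lam) ^ 2 / 2) ^ (n ^ 2) := by
          have := Real.cosh_pos (4 * lam)
          gcongr
          exact Real.cosh_le_exp_half_sq _
      _ = _ := by
          rw [← Real.exp_nat_mul]; congr 1; push_cast; ring
  have e6 : (2 : ℝ) ≤ Real.exp 1 := by have := Real.add_one_le_exp (1 : ℝ); linarith
  have e7 : Real.exp (lam * |disc D' D (T i)|) ≤
      Real.exp (1 + (2 * n + lam * (η / 4 * n ^ 2) + 8 * lam ^ 2 * n ^ 2)) := by
    rw [Real.exp_add, Real.exp_add, Real.exp_add]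
    have := Real.cosh_pos (4 * lam)
    have := Real.cosh_pos (lam * (η / 4 * n ^ 2))
    calc _ ≤ 2 * Real.cosh (lam * disc D' D (T i)) := e1
      _ ≤ 2 * (Fintype.card (Finset (Fin n) × Finset (Fin n)) * Real.cosh (lam * (η / 4 * n ^ 2)) *
          Real.cosh (4 * lam) ^ #D) := by linarith
      _ ≤ _ := by gcongr
  rw [Real.exp_le_exp] at e7
  have e8 : lam * |disc D' D (T i)| ≤ lam * (3 / 4 * η * n ^ 2) := by
    have : lam * (3 / 4 * η * (n : ℝ) ^ 2) - (lam * (η / 4 * n ^ 2) + 8 * lam ^ 2 * n ^ 2)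
        = (η ^ 2 * n) / 128 * n := by
      rw [hlam]; ring
    have h9 : 3 * (n : ℝ) ≤ (η ^ 2 * n) / 128 * n := by
      gcongr
      linarith
    linarith
  exact le_of_mul_le_mul_left e8 hl0

theorem halve_reg (η : ℝ) (hη : 0 < η) : ∃ n₀ : ℕ, ∀ n : ℕ, n₀ ≤ n →
    ∀ (T : Finset (Fin n) × Finset (Fin n) → Finset (Fin n × Fin n))
      (D : Finset (Fin n × Fin n)) (k : ℕ), RegD D k →
      ∃ D' ⊆ D, RegD D' (k / 2) ∧ ∀ i, |disc D' D (T i)| ≤ η * n ^ 2 := by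
  obtain ⟨n₀, h0⟩ := halve_even η hη
  refine ⟨max n₀ ⌈4 / η⌉₊, fun n hn T D k hD => ?_⟩
  have hn1 : n₀ ≤ n := (le_max_left _ _).trans hn
  have hn2 : 4 / η ≤ (n : ℝ) := (Nat.le_ceil _).trans (by exact_mod_cast (le_max_right _ _).trans hn)
  have hn3 : (n : ℝ) ≤ 1 / 4 * η * n ^ 2 := by
    rw [div_le_iff₀ hη] at hn2
    have : 1 / 4 * η * (n : ℝ) ^ 2 = (n * η) / 4 * n := by ring
    rw [this]
    apply le_mul_of_one_le_left (by positivity)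
    linarith
  rcases Nat.even_or_odd k with hk | hk
  · obtain ⟨D', a, b, c⟩ := h0 n hn1 T D k hD hk
    refine ⟨D', a, b, fun i => (c i).trans ?_⟩
    gcongr
    linarith
  · obtain ⟨M, hMD, m1, m2⟩ := match_finset D Prod.fst Prod.snd k hk.pos hD.1 hD.2
    have hM : RegD M 1 := ⟨m1, m2⟩
    have hk2 : (k - 1) / 2 = k / 2 := by obtain ⟨t, rfl⟩ := hk; omega
    obtain ⟨D', a, b, c⟩ := h0 n hn1 T (D \ M) (k - 1) (hD.sdiff hM hMD) (Nat.Odd.sub_odd hk odd_one)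
    rw [hk2] at b
    refine ⟨D', a.trans sdiff_subset, b, fun i => ?_⟩
    have := disc_union D' (D \ M) ∅ M (T i) disjoint_sdiff_self_left a (empty_subset _)
    rw [union_empty, sdiff_union_of_subset hMD] at this
    rw [this]
    have h1 := disc_abs_le ∅ M (T i) (empty_subset _)
    rw [hM.card, mul_one] at h1
    have h2 := c i
    have h3 := abs_add_le (disc D' (D \ M) (T i)) (disc ∅ M (T i))
    linarith

theorem halve_iter {n : ℕ} (err : ℝ)
    (T : Finset (Fin n) × Finset (Fin n) → Finset (Fin n × Fin n))
    (herr : 0 ≤ err)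
    (H : ∀ (D : Finset (Fin n × Fin n)) (k : ℕ), RegD D k →
      ∃ D' ⊆ D, RegD D' (k / 2) ∧ ∀ i, |disc D' D (T i)| ≤ err)
    (D : Finset (Fin n × Fin n)) (k : ℕ) (hD : RegD D k) (j : ℕ) :
    ∃ D' ⊆ D, RegD D' (k / 2 ^ j) ∧ ∀ i, (1 / 2 : ℝ) ^ j * #(D ∩ T i) - err ≤ #(D' ∩ T i) := by
  induction j with
  | zero => exact ⟨D, subset_rfl, by simpa using hD, fun i => by simpa using herr⟩
  | succ j ih =>
    obtain ⟨D', a, b, c⟩ := ih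
    obtain ⟨D2, a2, b2, c2⟩ := H D' _ b
    refine ⟨D2, a2.trans a, by rwa [Nat.div_div_eq_div_mul, ← pow_succ] at b2, fun i => ?_⟩
    have h1 := c i
    have h2 := (abs_le.1 (c2 i)).1
    unfold disc at h2
    rw [pow_succ]
    linarith

theorem exists_orientation {n : ℕ} (Γ : SimpleGraph (Fin n)) (r : ℕ) (hr : IsRegN Γ r)
    (he : Even r) : ∃ D : Finset (Fin n × Fin n), RegD D (r / 2) ∧
      (∀ u v, Γ.Adj u v ↔ (u, v) ∈ D ∨ (v, u) ∈ D) ∧ (∀ u v, (u, v) ∈ D → (v, u) ∉ D) := by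
  classical
  set D0 : Finset (Fin n × Fin n) := {e | Γ.Adj e.1 e.2} with hD0
  have m0 : ∀ u v, (u, v) ∈ D0 ↔ Γ.Adj u v := by intro u v; simp [hD0]
  have hout : ∀ v, #{e ∈ D0 | e.1 = v} = r := by
    intro v
    rw [← hr v, degN]
    have : Γ.neighborSet v = ((({e ∈ D0 | e.1 = v} : Finset _).image Prod.snd : Finset (Fin n)) : Set (Fin n)) := by
      ext w
      simp only [SimpleGraph.mem_neighborSet, coe_image, coe_filter, Set.mem_image, Set.mem_setOf_eq]
      constructor
      · intro h; exact ⟨(v, w), ⟨(m0 v w).2 h, rfl⟩, rfl⟩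
      · rintro ⟨⟨a, b⟩, ⟨h1, h2⟩, h3⟩
        simp only at h2 h3
        subst h2 h3
        exact (m0 _ _).1 h1
    rw [this, Set.ncard_coe_finset, card_image_of_injOn]
    rintro ⟨a, b⟩ h1 ⟨a', b'⟩ h2 h
    simp only [coe_filter, Set.mem_setOf_eq] at h1 h2 h
    rw [h1.2, h2.2, h]
  have hfib : ∀ (S : Finset (Fin n × Fin n)) u v, ({e ∈ S | s(e.1, e.2) = s(u, v)} : Finset _) =
      {e ∈ ({(u, v), (v, u)} : Finset _) | e ∈ S} := by
    intro S u v
    ext ⟨a, b⟩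
    simp only [mem_filter, Sym2.eq_iff, mem_insert, mem_singleton, Prod.mk.injEq]
    tauto
  have hfib0 : ∀ u v, Γ.Adj u v → #{e ∈ D0 | s(e.1, e.2) = s(u, v)} = 2 := by
    intro u v h
    rw [hfib, card_filter, sum_pair (by intro h'; simp only [Prod.mk.injEq] at h'; exact h.ne h'.1)]
    simp [m0, h, h.symm]
  obtain ⟨D, hDD, d1, d2⟩ := half_finset D0 Prod.fst (fun e => s(e.1, e.2))
    (fun v => by rw [hout]; exact he)
    (fun z => by
      induction z using Sym2.ind with
      | _ u v =>
      by_cases h : Γ.Adj u v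
      · rw [hfib0 u v h]; exact even_two
      · have : ({e ∈ D0 | s(e.1, e.2) = s(u, v)} : Finset _) = ∅ := by
          rw [hfib, filter_eq_empty_iff]
          intro e he
          simp only [mem_insert, mem_singleton] at he
          rcases he with rfl | rfl
          · rwa [m0]
          · rw [m0]; exact fun h' => h h'.symm
        rw [this]; simp)
  have hone : ∀ u v, Γ.Adj u v → (if (u, v) ∈ D then 1 else 0) + (if (v, u) ∈ D then 1 else 0) = 1 := by
    intro u v h
    have := d2 s(u, v)
    rw [hfib0 u v h, hfib, card_filter,
      sum_pair (by intro h'; simp only [Prod.mk.injEq] at h'; exact h.ne h'.1)] at this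
    omega
  have hadj : ∀ u v, (u, v) ∈ D → Γ.Adj u v := fun u v h => (m0 u v).1 (hDD h)
  have hanti : ∀ u v, (u, v) ∈ D → (v, u) ∉ D := by
    intro u v h h'
    have := hone u v (hadj u v h)
    simp [h, h'] at this
  have hiff : ∀ u v, Γ.Adj u v ↔ (u, v) ∈ D ∨ (v, u) ∈ D := by
    intro u v
    constructor
    · intro h
      have := hone u v h
      by_contra hc
      push Not at hc
      simp [hc.1, hc.2] at this
    · rintro (h | h)
      · exact hadj _ _ h
      · exact (hadj _ _ h).symm
  have ho : ∀ v, #{e ∈ D | e.1 = v} = r / 2 := by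
    intro v
    have := d1 v
    rw [hout] at this
    omega
  refine ⟨D, ⟨ho, fun v => ?_⟩, hiff, hanti⟩
  have hs : ({e ∈ D0 | e.1 = v} : Finset _) =
      {e ∈ D | e.1 = v} ∪ ({e ∈ D | e.2 = v} : Finset _).map (Equiv.prodComm _ _).toEmbedding := by
    ext ⟨a, b⟩
    simp only [mem_filter, mem_union, mem_map_equiv, Equiv.prodComm_symm, Equiv.prodComm_apply, Prod.swap, m0, hiff]
    tauto
  have hc := congrArg Finset.card hs
  rw [hout, card_union_of_disjoint, card_map, ho] at hc
  · obtain ⟨t, rfl⟩ := he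
    omega
  · rw [Finset.disjoint_left]
    rintro ⟨a, b⟩ h1 h2
    simp only [mem_filter, mem_map_equiv, Equiv.prodComm_symm, Equiv.prodComm_apply, Prod.swap] at h1 h2
    exact hanti _ _ h1.1 h2.1

/-- The graph underlying a set of arcs. -/
def arcGraph {V : Type*} (S : Finset (V × V)) : SimpleGraph V :=
  SimpleGraph.fromRel fun u v => (u, v) ∈ S

/-- No arc appears in both directions. -/
def Anti {V : Type*} (S : Finset (V × V)) : Prop := ∀ u v, (u, v) ∈ S → (v, u) ∉ S

theorem Anti.mono {V : Type*} {S S' : Finset (V × V)} (h : Anti S) (hs : S' ⊆ S) : Anti S' :=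
  fun u v h1 h2 => h u v (hs h1) (hs h2)

theorem arcGraph_adj {V : Type*} {S : Finset (V × V)} (h : Anti S) (u v : V) :
    (arcGraph S).Adj u v ↔ (u, v) ∈ S ∨ (v, u) ∈ S := by
  unfold arcGraph
  rw [SimpleGraph.fromRel_adj]
  constructor
  · exact fun h => h.2
  · intro h'
    refine ⟨?_, h'⟩
    rintro rfl
    rcases h' with h' | h' <;> exact h _ _ h' h'

theorem arcGraph_disjoint {V : Type*} [DecidableEq V] {S X Y : Finset (V × V)} (h : Anti S)
    (hX : X ⊆ S) (hY : Y ⊆ S) (hXY : Disjoint X Y) : Disjoint (arcGraph X) (arcGraph Y) := by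
  rw [SimpleGraph.disjoint_left]
  intro u v h1 h2
  rw [arcGraph_adj (h.mono hX)] at h1
  rw [arcGraph_adj (h.mono hY)] at h2
  rw [Finset.disjoint_left] at hXY
  rcases h1 with h1 | h1 <;> rcases h2 with h2 | h2
  · exact hXY h1 h2
  · exact h _ _ (hX h1) (hY h2)
  · exact h _ _ (hX h1) (hY h2)
  · exact hXY h1 h2

theorem arcGraph_reg {n : ℕ} {S : Finset (Fin n × Fin n)} {k : ℕ} (h : Anti S) (hk : RegD S k) :
    IsRegN (arcGraph S) (2 * k) := by
  classical
  intro v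
  have h1 : (arcGraph S).neighborSet v = (((({e ∈ S | e.1 = v} : Finset _).image Prod.snd) ∪
      (({e ∈ S | e.2 = v} : Finset _).image Prod.fst) : Finset (Fin n)) : Set (Fin n)) := by
    ext w
    simp only [SimpleGraph.mem_neighborSet, arcGraph_adj h, mem_coe, mem_union, mem_image,
      mem_filter, Prod.exists]
    constructor
    · rintro (h | h)
      · exact Or.inl ⟨v, w, ⟨h, rfl⟩, rfl⟩
      · exact Or.inr ⟨w, v, ⟨h, rfl⟩, rfl⟩
    · rintro (⟨a, b, ⟨h, h1⟩, h2⟩ | ⟨a, b, ⟨h, h1⟩, h2⟩)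
      · left; rwa [← h1, ← h2]
      · right; rwa [← h1, ← h2]
  rw [degN, h1, Set.ncard_coe_finset, card_union_of_disjoint, card_image_of_injOn,
    card_image_of_injOn, hk.1, hk.2, two_mul]
  · rintro ⟨a, b⟩ h1 ⟨a', b'⟩ h2 h
    simp only [coe_filter, Set.mem_setOf_eq] at h1 h2 h
    rw [h1.2, h2.2, h]
  · rintro ⟨a, b⟩ h1 ⟨a', b'⟩ h2 h
    simp only [coe_filter, Set.mem_setOf_eq] at h1 h2 h
    rw [h1.2, h2.2, h]
  · rw [Finset.disjoint_left]
    intro w hw1 hw2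
    simp only [mem_image, mem_filter, Prod.exists] at hw1 hw2
    obtain ⟨a, b, ⟨h1, h2⟩, h3⟩ := hw1
    obtain ⟨a', b', ⟨h1', h2'⟩, h3'⟩ := hw2
    subst h2 h3 h2' h3'
    exact absurd h1' (h _ _ h1)

/-- Pairs with one end in each of two given sets. -/
def TT {n : ℕ} (i : Finset (Fin n) × Finset (Fin n)) : Finset (Fin n × Fin n) :=
  {e | (e.1 ∈ i.1 ∧ e.2 ∈ i.2) ∨ (e.1 ∈ i.2 ∧ e.2 ∈ i.1)}

theorem arcGraph_eBetween {n : ℕ} {S : Finset (Fin n × Fin n)} (h : Anti S)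
    (A B : Finset (Fin n)) : eBetween (arcGraph S) (A : Set (Fin n)) (B : Set (Fin n)) = #(S ∩ TT (A, B)) := by
  unfold eBetween
  have : {e ∈ (arcGraph S).edgeSet | ∃ a ∈ (A : Set (Fin n)), ∃ b ∈ (B : Set (Fin n)), e = s(a, b)} =
      (fun e : Fin n × Fin n => s(e.1, e.2)) '' ((S ∩ TT (A, B) : Finset _) : Set (Fin n × Fin n)) := by
    ext z
    simp only [Set.mem_setOf_eq, Set.mem_image, mem_coe, mem_inter, TT, mem_filter, mem_univ, true_and]
    constructor
    · rintro ⟨hz, a, ha, b, hb, rfl⟩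
      rw [SimpleGraph.mem_edgeSet, arcGraph_adj h] at hz
      rcases hz with hz | hz
      · exact ⟨(a, b), ⟨hz, Or.inl ⟨ha, hb⟩⟩, rfl⟩
      · exact ⟨(b, a), ⟨hz, Or.inr ⟨hb, ha⟩⟩, Sym2.eq_swap⟩
    · rintro ⟨⟨a, b⟩, ⟨h1, h2⟩, rfl⟩
      refine ⟨by rw [SimpleGraph.mem_edgeSet, arcGraph_adj h]; exact Or.inl h1, ?_⟩
      rcases h2 with h2 | h2
      · exact ⟨a, h2.1, b, h2.2, rfl⟩
      · exact ⟨b, h2.2, a, h2.1, Sym2.eq_swap⟩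
  rw [this, Set.ncard_image_of_injOn, Set.ncard_coe_finset]
  rintro ⟨a, b⟩ h1 ⟨a', b'⟩ h2 h3
  simp only [Sym2.eq_iff] at h3
  rcases h3 with ⟨rfl, rfl⟩ | ⟨rfl, rfl⟩
  · rfl
  · have h1' : (a, b) ∈ S := (mem_inter.1 h1).1
    have h2' : (b, a) ∈ S := (mem_inter.1 h2).1
    exact absurd h2' (h _ _ h1')

theorem eBetween_le {n : ℕ} (R : SimpleGraph (Fin n)) (S B : Set (Fin n)) (x : ℝ) (hx : 0 ≤ x)
    (hB : ∀ v ∈ B, (((R.neighborSet v) ∩ S).ncard : ℝ) ≤ x) :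
    (eBetween R S B : ℝ) ≤ n * x := by
  classical
  have h1 : eBetween R S B ≤ #((B.toFinset).biUnion fun v =>
      ((R.neighborSet v ∩ S).toFinset).image fun w => s(w, v)) := by
    unfold eBetween
    rw [← Set.ncard_coe_finset]
    apply Set.ncard_le_ncard _ (Finset.finite_toSet _)
    rintro z ⟨hz, a, ha, b, hb, rfl⟩
    simp only [mem_coe, mem_biUnion, Set.mem_toFinset, mem_image]
    exact ⟨b, hb, a, ⟨(SimpleGraph.mem_edgeSet _).1 hz |>.symm, ha⟩, rfl⟩
  have h2 : (eBetween R S B : ℝ) ≤ ∑ v ∈ B.toFinset, (((R.neighborSet v) ∩ S).ncard : ℝ) := by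
    have : eBetween R S B ≤ ∑ v ∈ B.toFinset, ((R.neighborSet v) ∩ S).ncard := by
      refine h1.trans (card_biUnion_le.trans (sum_le_sum fun v _ => ?_))
      refine card_image_le.trans ?_
      rw [Set.ncard_eq_toFinset_card']
    exact_mod_cast this
  refine h2.trans ?_
  calc ∑ v ∈ B.toFinset, (((R.neighborSet v) ∩ S).ncard : ℝ) ≤ ∑ v ∈ B.toFinset, x :=
        sum_le_sum fun v hv => hB v (by simpa using hv)
    _ = #B.toFinset * x := by simp
    _ ≤ n * x := by
        have : #B.toFinset ≤ n := by
          have := card_le_univ B.toFinset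
          simpa using this
        gcongr

theorem eBetween_comm' {n : ℕ} (R : SimpleGraph (Fin n)) (A B : Set (Fin n)) :
    eBetween R A B = eBetween R B A := by
  unfold eBetween
  congr 1
  ext z
  simp only [Set.mem_setOf_eq]
  constructor
  · rintro ⟨h, a, ha, b, hb, rfl⟩
    exact ⟨h, b, hb, a, ha, Sym2.eq_swap⟩
  · rintro ⟨h, a, ha, b, hb, rfl⟩
    exact ⟨h, b, hb, a, ha, Sym2.eq_swap⟩

theorem robust_of_dense {n : ℕ} (R : SimpleGraph (Fin n)) (δ τ ν : ℝ) (hδ₀ : 0 < δ)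
    (hτ₀ : 2 * δ ≤ τ) (hτ₁ : τ < 1) (hν₀ : 0 < ν) (hν : ν ≤ δ)
    (H : ∀ A B : Set (Fin n), δ ^ 2 * (n : ℝ) ≤ (A.ncard : ℝ) →
          (1 / 2 - δ) * (n : ℝ) ≤ (B.ncard : ℝ) → ν * (n : ℝ) ^ 2 < eBetween R A B) :
    IsRobustExpander R ν τ := by
  intro S h1 h2
  rw [Fintype.card_fin] at *
  set N := robustNbhd R ν S with hN
  have hc : (N.ncard : ℝ) + (Nᶜ.ncard : ℝ) = n := by
    have := Set.ncard_add_ncard_compl N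
    rw [Nat.card_eq_fintype_card, Fintype.card_fin] at this
    exact_mod_cast this
  have hn0 : (0 : ℝ) ≤ n := by positivity
  have hδ2 : δ ^ 2 * (n : ℝ) ≤ δ * n := by
    gcongr
    nlinarith
  have hνn : ν * (n : ℝ) ≤ δ * n := by gcongr
  have hτn : 2 * δ * (n : ℝ) ≤ τ * n := by gcongr
  have hδn : 0 ≤ δ * (n : ℝ) := by positivity
  have hle : (eBetween R S Nᶜ : ℝ) ≤ n * (ν * n) := by
    apply eBetween_le _ _ _ _ (by positivity)
    intro v hv
    have : ¬ (ν * (Fintype.card (Fin n) : ℝ) ≤ (((R.neighborSet v) ∩ S).ncard : ℝ)) := hv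
    rw [Fintype.card_fin] at this
    linarith
  have heq : (n : ℝ) * (ν * n) = ν * n ^ 2 := by ring
  rw [heq] at hle
  by_cases hS : (S.ncard : ℝ) ≤ n / 2
  · have : (Nᶜ.ncard : ℝ) < (1 / 2 - δ) * n := by
      by_contra hcon
      push Not at hcon
      have := H S Nᶜ (by linarith) hcon
      linarith
    linarith
  · push Not at hS
    have : (Nᶜ.ncard : ℝ) < δ ^ 2 * n := by
      by_contra hcon
      push Not at hcon
      have := H Nᶜ S hcon (by linarith)
      rw [eBetween_comm'] at this
      linarith
    linarith
end

/-- Lemma 2.1 of the paper. Under the stated conditions on the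
constants, for all sufficiently large `n`, the edges of any `n`-vertex `r`-regular
graph `Γ` (with even `r ≥ c n` and the edge-density condition) can be partitioned
into three graphs `G`, `F`, `R` such that `G` is `d`-regular with even `d ≥ (1-2ε)r`,
`F` has at least `n^1.6` edges between any two large sets, and `R` is a robust
`(ν,τ)`-expander. -/
theorem edge_partition_lemma (c ε γ δ τ ν : ℝ) (hc : 0 < c) (hε₀ : 0 < ε)
    (hε₁ : ε < 1 / 10) (hγ : 0 < γ) (hδ₀ : 0 < δ) (hδ₁ : δ ≤ ε * c / 5)
    (hτ₀ : 2 * δ ≤ τ) (hτ₁ : τ < 1) (hν₀ : 0 < ν) (hν₁ : ν ≤ min δ (ε * γ / 2)) :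
    ∃ n₀ : ℕ, ∀ n : ℕ, n₀ ≤ n →
      ∀ (Γ : SimpleGraph (Fin n)) (r : ℕ),
        IsRegN Γ r → Even r → c * (n : ℝ) ≤ (r : ℝ) →
        (∀ A B : Set (Fin n), δ ^ 2 * (n : ℝ) ≤ (A.ncard : ℝ) →
          (1 / 2 - δ) * (n : ℝ) ≤ (B.ncard : ℝ) →
          γ * (n : ℝ) ^ 2 ≤ (eBetween Γ A B : ℝ)) →
        ∃ G F R : SimpleGraph (Fin n),
          Disjoint G F ∧ Disjoint G R ∧ Disjoint F R ∧ G ⊔ F ⊔ R = Γ ∧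
          (∃ d : ℕ, IsRegN G d ∧ Even d ∧ (1 - 2 * ε) * (r : ℝ) ≤ (d : ℝ)) ∧
          (∀ A B : Set (Fin n), δ ^ 2 * (n : ℝ) ≤ (A.ncard : ℝ) →
            (1 / 2 - δ) * (n : ℝ) ≤ (B.ncard : ℝ) →
            (n : ℝ) ^ (1.6 : ℝ) ≤ (eBetween F A B : ℝ)) ∧
          IsRobustExpander R ν τ := by
  classical
  obtain ⟨m, hm1, hm2⟩ := exists_nat_pow_near_of_lt_one (x := 2 * ε) (y := (1 / 2 : ℝ))
    (by linarith) (by linarith) (by norm_num) (by norm_num)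
  obtain ⟨K, hK1, hK2⟩ : ∃ K : ℕ, (1 / 2 : ℝ) ^ K ≤ 2 * ε ∧ ε < (1 / 2 : ℝ) ^ K := by
    rcases hm2.lt_or_eq with h | h
    · exact ⟨m + 1, hm1.le, by rw [pow_succ]; linarith⟩
    · exact ⟨m, h.ge, by linarith⟩
  set p : ℝ := (1 / 2 : ℝ) ^ K with hp
  set η : ℝ := (p - ε) * γ / 4 with hη
  have hη0 : 0 < η := by
    have : 0 < p - ε := by linarith
    positivity
  obtain ⟨n₁, hn₁⟩ := halve_reg η hη0
  have hlim : ∀ᶠ n : ℕ in Filter.atTop, (n : ℝ) ^ (1.6 : ℝ) ≤ η * (n : ℝ) ^ 2 := by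
    have h1 : Filter.Tendsto (fun n : ℕ => (n : ℝ) ^ (0.4 : ℝ)) Filter.atTop Filter.atTop :=
      (tendsto_rpow_atTop (by norm_num)).comp tendsto_natCast_atTop_atTop
    filter_upwards [h1.eventually_ge_atTop (1 / η), Filter.eventually_gt_atTop 0] with n h2 h3
    have h4 : (0 : ℝ) < n := by exact_mod_cast h3
    have h5 : (n : ℝ) ^ 2 = (n : ℝ) ^ (1.6 : ℝ) * (n : ℝ) ^ (0.4 : ℝ) := by
      rw [← Real.rpow_add h4, ← Real.rpow_natCast]; norm_num
    rw [div_le_iff₀ hη0] at h2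
    rw [h5]
    have h6 : 0 < (n : ℝ) ^ (1.6 : ℝ) := Real.rpow_pos_of_pos h4 _
    nlinarith
  obtain ⟨n₂, hn₂⟩ := Filter.eventually_atTop.1 hlim
  refine ⟨max (max n₁ n₂) 1, fun n hn Γ r hreg hev hcr hdense => ?_⟩
  have hnn1 : n₁ ≤ n := by omega
  have hnn2 : n₂ ≤ n := by omega
  have hn0 : (0 : ℝ) < n := by exact_mod_cast (by omega : 0 < n)
  obtain ⟨D, hD, hadj, hanti⟩ := exists_orientation Γ r hreg hev
  have hanti : Anti D := hanti
  have hΓ : Γ = arcGraph D := by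
    ext u v
    rw [arcGraph_adj hanti, hadj]
  have H := hn₁ n hnn1 TT
  obtain ⟨D1, hD1, r1, e1⟩ := halve_iter (η * n ^ 2) TT (by positivity) H D (r / 2) hD K
  obtain ⟨D2, hD2, r2, e2⟩ := H D1 _ r1
  have a1 : Anti D1 := hanti.mono hD1
  have a2 : Anti D2 := a1.mono hD2
  have a3 : Anti (D1 \ D2) := a1.mono Finset.sdiff_subset
  have a4 : Anti (D \ D1) := hanti.mono Finset.sdiff_subset
  have key : ∀ A B : Set (Fin n), δ ^ 2 * (n : ℝ) ≤ (A.ncard : ℝ) →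
      (1 / 2 - δ) * (n : ℝ) ≤ (B.ncard : ℝ) →
      (ν + η) * (n : ℝ) ^ 2 ≤ eBetween (arcGraph D2) A B ∧
      (ν + η) * (n : ℝ) ^ 2 ≤ eBetween (arcGraph (D1 \ D2)) A B := by
    intro A B hA hB
    have h0 := hdense A B hA hB
    obtain ⟨A', rfl⟩ : ∃ A' : Finset (Fin n), (A' : Set (Fin n)) = A := ⟨A.toFinset, by simp⟩
    obtain ⟨B', rfl⟩ : ∃ B' : Finset (Fin n), (B' : Set (Fin n)) = B := ⟨B.toFinset, by simp⟩
    rw [hΓ, arcGraph_eBetween hanti] at h0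
    rw [arcGraph_eBetween a2, arcGraph_eBetween a3]
    have h1 := e1 (A', B')
    have h2 := e2 (A', B')
    have h3 : |disc (D1 \ D2) D1 (TT (A', B'))| ≤ η * n ^ 2 := by
      rw [disc_compl _ _ _ hD2, abs_neg]; exact h2
    have h2 := (abs_le.1 h2).1
    have h3 := (abs_le.1 h3).1
    unfold disc at h2 h3
    have hp0 : 0 < p := by linarith
    have h4 : p * (γ * (n : ℝ) ^ 2) ≤ p * ((D ∩ TT (A', B')).card : ℝ) := by gcongr
    have h5 : ν * (n : ℝ) ^ 2 ≤ ε * γ / 2 * n ^ 2 := by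
      have := hν₁.trans (min_le_right _ _)
      gcongr
    have h6 : p * (γ * (n : ℝ) ^ 2) = ε * γ * n ^ 2 + 4 * (η * n ^ 2) := by
      rw [hη]; ring
    constructor <;> linarith
  refine ⟨arcGraph (D \ D1), arcGraph D2, arcGraph (D1 \ D2), ?_, ?_, ?_, ?_, ?_, ?_, ?_⟩
  · exact arcGraph_disjoint hanti Finset.sdiff_subset (hD2.trans hD1)
      (disjoint_sdiff_self_left.mono_right hD2)
  · exact arcGraph_disjoint hanti Finset.sdiff_subset (Finset.sdiff_subset.trans hD1)
      (disjoint_sdiff_self_left.mono_right Finset.sdiff_subset)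
  · exact arcGraph_disjoint hanti (hD2.trans hD1) (Finset.sdiff_subset.trans hD1)
      Finset.disjoint_sdiff
  · rw [hΓ]
    ext u v
    simp only [SimpleGraph.sup_adj, arcGraph_adj hanti, arcGraph_adj a2, arcGraph_adj a3,
      arcGraph_adj a4, Finset.mem_sdiff]
    have hmem : ∀ e, e ∈ D ↔ ((e ∈ D ∧ e ∉ D1) ∨ e ∈ D2) ∨ (e ∈ D1 ∧ e ∉ D2) := by
      intro e
      have g1 : e ∈ D1 → e ∈ D := fun h => hD1 h
      have g2 : e ∈ D2 → e ∈ D1 := fun h => hD2 h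
      clear * - g1 g2
      tauto
    refine Iff.trans ?_ (or_congr (hmem (u, v)) (hmem (v, u))).symm
    generalize ((u, v) ∈ D ∧ (u, v) ∉ D1) = P1
    generalize ((v, u) ∈ D ∧ (v, u) ∉ D1) = P2
    generalize ((u, v) ∈ D1 ∧ (u, v) ∉ D2) = P3
    generalize ((v, u) ∈ D1 ∧ (v, u) ∉ D2) = P4
    clear * -
    tauto
  · refine ⟨_, arcGraph_reg a4 (hD.sdiff r1 hD1), even_two_mul _, ?_⟩
    have hle : r / 2 / 2 ^ K ≤ r / 2 := Nat.div_le_self _ _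
    have h1 : ((r / 2 / 2 ^ K : ℕ) : ℝ) ≤ (r / 2 : ℕ) * p := by
      refine Nat.cast_div_le.trans (le_of_eq ?_)
      rw [hp]
      push_cast
      rw [one_div, inv_pow, div_eq_mul_inv]
    have h2 : ((r / 2 : ℕ) : ℝ) * 2 = r := by
      have : r / 2 * 2 = r := Nat.div_mul_cancel hev.two_dvd
      exact_mod_cast this
    rw [Nat.cast_mul, Nat.cast_sub hle]
    have h3 : ((r / 2 : ℕ) : ℝ) * p ≤ (r / 2 : ℕ) * (2 * ε) := by gcongr
    rw [← h2]
    push_cast at *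
    linarith
  · intro A B hA hB
    have h1 := (key A B hA hB).1
    have h2 := hn₂ n hnn2
    have : 0 ≤ ν * (n : ℝ) ^ 2 := by positivity
    linarith
  · apply robust_of_dense _ δ τ ν hδ₀ hτ₀ hτ₁ hν₀ (hν₁.trans (min_le_left _ _))
    intro A B hA hB
    have h1 := (key A B hA hB).2
    have : 0 < η * (n : ℝ) ^ 2 := by positivity
    linarith
end
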